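/- Let m, n ≥ 1 be mutually prime integers with n > 2m, and let α > 0. Let h₀ : ℝ → ℝ be a smooth function with period 2mπ/n (hence 2mπ-periodic) satisfying h₀ + h₀'' > 0 everywhere (the support function of a locally convex closed curve of total curvature 2mπ with n-fold rotational symmetry, i.e. a curve in the class H_{m,n}). Then the area-preserving (AP) support-function flow with initial data h₀ admits a smooth solution h on ℝ × [0,∞), 2mπ-periodic in θ with h + h_θθ > 0 for all time, and there exists a constant c > 0 such that the curvature κ = (h + h_θθ)^{−1} converges, together with all its θ-derivatives, uniformly to c as t → ∞; that is, the flow exists globally and converges in the C^∞ metric to an m-fold circle. -/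

import Mathlib

open Real MeasureTheory Filter

/-- Second derivative of the support function in the angle variable. -/
noncomputable def hpp (h : ℝ → ℝ → ℝ) (θ t : ℝ) : ℝ :=
  iteratedDeriv 2 (fun x => h x t) θ

/-- Nonlocal term of the area-preserving flow. -/
noncomputable def lamAP (m : ℕ) (α : ℝ) (h : ℝ → ℝ → ℝ) (t : ℝ) : ℝ :=
  (∫ θ in (0:ℝ)..(2 * m * π), (h θ t + hpp h θ t) ^ (1 - α)) /
    (∫ θ in (0:ℝ)..(2 * m * π), h θ t)


section APFProof

open scoped ContDiff Topology

open scoped ContDiff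

namespace APF

/-- smooth `P`-periodic functions -/
def SP (P : ℝ) (f : ℝ → ℝ) : Prop := ContDiff ℝ ∞ f ∧ Function.Periodic f P

/-- squared `L²` norm of the `k`-th derivative -/
noncomputable def X (P : ℝ) (k : ℕ) (f : ℝ → ℝ) : ℝ := ∫ x in (0:ℝ)..P, (iteratedDeriv k f x) ^ 2

theorem SP.cont {P : ℝ} {f : ℝ → ℝ} (hf : SP P f) : Continuous f := hf.1.continuous

theorem SP.diff {P : ℝ} {f : ℝ → ℝ} (hf : SP P f) : Differentiable ℝ f :=
  hf.1.differentiable (by simp)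

theorem SP.deriv {P : ℝ} {f : ℝ → ℝ} (hf : SP P f) : SP P (deriv f) := by
  refine ⟨(contDiff_infty_iff_deriv.1 hf.1).2, fun x => ?_⟩
  have h : (fun y => f (y + P)) = f := funext hf.2
  have := deriv_comp_add_const f P x
  rw [← this]
  rw [h]

theorem SP.iter {P : ℝ} {f : ℝ → ℝ} (hf : SP P f) (k : ℕ) : SP P (iteratedDeriv k f) := by
  induction k with
  | zero => simpa [iteratedDeriv_zero] using hf
  | succ k ih => rw [iteratedDeriv_succ]; exact ih.deriv

theorem SP.add {P : ℝ} {f g : ℝ → ℝ} (hf : SP P f) (hg : SP P g) : SP P (fun x => f x + g x) :=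
  ⟨hf.1.add hg.1, fun x => by simp [hf.2 x, hg.2 x]⟩

theorem SP.sub {P : ℝ} {f g : ℝ → ℝ} (hf : SP P f) (hg : SP P g) : SP P (fun x => f x - g x) :=
  ⟨hf.1.sub hg.1, fun x => by simp [hf.2 x, hg.2 x]⟩

theorem SP.mul {P : ℝ} {f g : ℝ → ℝ} (hf : SP P f) (hg : SP P g) : SP P (fun x => f x * g x) :=
  ⟨hf.1.mul hg.1, fun x => by simp [hf.2 x, hg.2 x]⟩

theorem SP.const (P c : ℝ) : SP P (fun _ => c) := ⟨contDiff_const, fun _ => rfl⟩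

theorem SP.comp {P : ℝ} {f b : ℝ → ℝ} (hf : SP P f) (hb : ContDiff ℝ ∞ b) :
    SP P (fun x => b (f x)) := ⟨hb.comp hf.1, fun x => by simp [hf.2 x]⟩

theorem iter_iter (k l : ℕ) (f : ℝ → ℝ) :
    iteratedDeriv k (iteratedDeriv l f) = iteratedDeriv (k + l) f := by
  simp only [iteratedDeriv_eq_iterate, Function.iterate_add_apply]

theorem SP.hasDerivAt_iter {P : ℝ} {f : ℝ → ℝ} (hf : SP P f) (k : ℕ) (x : ℝ) :
    HasDerivAt (iteratedDeriv k f) (iteratedDeriv (k+1) f x) x := by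
  rw [iteratedDeriv_succ]
  exact ((hf.iter k).diff x).hasDerivAt

theorem SP.integral_deriv {P : ℝ} {f : ℝ → ℝ} (hf : SP P f) :
    ∫ x in (0:ℝ)..P, _root_.deriv f x = 0 := by
  rw [intervalIntegral.integral_deriv_eq_sub (fun x _ => hf.diff x)
    (hf.deriv.cont.intervalIntegrable _ _)]
  have := hf.2 0
  simp at this
  simp [this]

theorem SP.ibp {P : ℝ} {f g : ℝ → ℝ} (hf : SP P f) (hg : SP P g) :
    ∫ x in (0:ℝ)..P, f x * _root_.deriv g x = - ∫ x in (0:ℝ)..P, _root_.deriv f x * g x := by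
  have h := (hf.mul hg).integral_deriv
  have e : ∀ x, _root_.deriv (fun x => f x * g x) x = _root_.deriv f x * g x + f x * _root_.deriv g x :=
    fun x => deriv_fun_mul (hf.diff x) (hg.diff x)
  simp only [e] at h
  rw [intervalIntegral.integral_add ((hf.deriv.mul hg).cont.intervalIntegrable _ _)
    ((hf.mul hg.deriv).cont.intervalIntegrable _ _)] at h
  linarith

/-- moving `k` derivatives -/
theorem SP.ibp_iter {P : ℝ} {f g : ℝ → ℝ} (hf : SP P f) (hg : SP P g) (k l : ℕ) :
    ∫ x in (0:ℝ)..P, f x * iteratedDeriv (k + l) g x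
      = (-1)^k * ∫ x in (0:ℝ)..P, iteratedDeriv k f x * iteratedDeriv l g x := by
  induction k generalizing l with
  | zero => simp
  | succ k ih =>
    rw [show k + 1 + l = k + (l+1) by ring, ih (l+1)]
    rw [iteratedDeriv_succ (n := l), (hf.iter k).ibp (hg.iter l), ← iteratedDeriv_succ]
    ring

theorem SP.exists_deriv_zero {P : ℝ} (hP : 0 < P) {f : ℝ → ℝ} (hf : SP P f) :
    ∃ x, _root_.deriv f x = 0 := by
  obtain ⟨c, -, hc⟩ := exists_deriv_eq_zero hP hf.cont.continuousOn
    (by have := hf.2 0; simp at this; exact this.symm)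
  exact ⟨c, hc⟩

theorem SP.integral_shift {P : ℝ} {f : ℝ → ℝ} (hf : SP P f) (a : ℝ) :
    ∫ x in a..(a+P), f x = ∫ x in (0:ℝ)..P, f x := by
  have := hf.2.intervalIntegral_add_eq a 0
  simpa using this

theorem per_integral_shift {P : ℝ} {f : ℝ → ℝ} (hf : Function.Periodic f P) (a : ℝ) :
    ∫ x in a..(a+P), f x = ∫ x in (0:ℝ)..P, f x := by
  have := hf.intervalIntegral_add_eq a 0
  simpa using this

/-- every point has a representative in `[a, a+P)` -/
theorem exists_rep {P : ℝ} (hP : 0 < P) (a x : ℝ) :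
    ∃ y ∈ Set.Ico a (a+P), ∀ f : ℝ → ℝ, Function.Periodic f P → f y = f x := by
  refine ⟨toIcoMod hP a x, toIcoMod_mem_Ico hP a x, fun f hf => ?_⟩
  rw [toIcoMod]
  exact hf.sub_zsmul_eq _

theorem SP.abs_le_integral {P : ℝ} (hP : 0 < P) {f : ℝ → ℝ} (hf : SP P f) {x₀ : ℝ} (h0 : f x₀ = 0)
    (x : ℝ) : |f x| ≤ ∫ y in (0:ℝ)..P, |_root_.deriv f y| := by
  obtain ⟨y, hy, he⟩ := exists_rep hP x₀ x
  rw [← he f hf.2]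
  have h1 : f y = ∫ z in x₀..y, _root_.deriv f z := by
    rw [intervalIntegral.integral_deriv_eq_sub (fun x _ => hf.diff x)
      (hf.deriv.cont.intervalIntegrable _ _), h0, sub_zero]
  rw [h1]
  have hc : Continuous (fun z => |_root_.deriv f z|) := hf.deriv.cont.abs
  refine (intervalIntegral.abs_integral_le_integral_abs hy.1).trans ?_
  have hper : Function.Periodic (fun z => |_root_.deriv f z|) P := fun z => by
    simp [hf.deriv.2 z]
  rw [← per_integral_shift hper x₀]
  refine intervalIntegral.integral_mono_interval le_rfl hy.1 hy.2.le
    (Eventually.of_forall fun z => abs_nonneg _) (hc.intervalIntegrable _ _)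

/-- interpolation -/
theorem SP.sq_le_interp {P : ℝ} (hP : 0 < P) {f : ℝ → ℝ} (hf : SP P f) {x₀ : ℝ} (h0 : f x₀ = 0)
    {ε : ℝ} (hε : 0 < ε) (x : ℝ) :
    f x ^ 2 ≤ ε * (∫ y in (0:ℝ)..P, _root_.deriv f y ^ 2) + ε⁻¹ * ∫ y in (0:ℝ)..P, f y ^ 2 := by
  have h := (hf.mul hf).abs_le_integral hP (x₀ := x₀) (by simp [h0]) x
  have e : ∀ x, _root_.deriv (fun x => f x * f x) x = _root_.deriv f x * f x + f x * _root_.deriv f x :=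
    fun x => deriv_fun_mul (hf.diff x) (hf.diff x)
  simp only [e] at h
  have hc1 : Continuous (fun y => _root_.deriv f y ^ 2) := hf.deriv.cont.pow 2
  have hc2 : Continuous (fun y => f y ^ 2) := hf.cont.pow 2
  have hc0 : Continuous fun y => |_root_.deriv f y * f y + f y * _root_.deriv f y| :=
    ((hf.deriv.cont.mul hf.cont).add (hf.cont.mul hf.deriv.cont)).abs
  rw [← intervalIntegral.integral_const_mul, ← intervalIntegral.integral_const_mul,
    ← intervalIntegral.integral_add ((hc1.const_mul _).intervalIntegrable _ _)
      ((hc2.const_mul _).intervalIntegrable _ _)]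
  calc f x ^ 2 = |f x * f x| := by rw [abs_mul_self, sq]
    _ ≤ _ := h
    _ ≤ _ := by
      refine intervalIntegral.integral_mono_on hP.le (hc0.intervalIntegrable _ _)
        (((hc1.const_mul _).add (hc2.const_mul _)).intervalIntegrable _ _) fun y _ => ?_
      set a := _root_.deriv f y
      set c := f y
      have h3 : ε * a^2 + ε⁻¹ * c^2 - 2 * (|a| * |c|) = ε * (|a| - ε⁻¹ * |c|)^2 := by
        rw [← sq_abs a, ← sq_abs c]; field_simp; ring
      have h4 : 0 ≤ ε * (|a| - ε⁻¹ * |c|)^2 := by positivity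
      have h5 : |a * c + c * a| = 2 * (|a| * |c|) := by
        rw [mul_comm c a, ← two_mul, abs_mul, abs_mul]; simp
      rw [h5]; linarith

theorem cs_abs {P : ℝ} (hP : 0 < P) {f : ℝ → ℝ} (hf : Continuous f) :
    (∫ y in (0:ℝ)..P, |f y|) ^ 2 ≤ P * ∫ y in (0:ℝ)..P, f y ^ 2 := by
  set m := (∫ y in (0:ℝ)..P, |f y|) with hm
  have h : 0 ≤ ∫ y in (0:ℝ)..P, (P * |f y| - m)^2 :=
    intervalIntegral.integral_nonneg hP.le fun _ _ => sq_nonneg _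
  have e : ∀ y, (P * |f y| - m)^2 = P^2 * f y ^2 - 2 * P * m * |f y| + m^2 := by
    intro y; rw [← sq_abs (f y)]; ring
  simp only [e] at h
  have hc2 : Continuous (fun y => f y ^ 2) := hf.pow 2
  have hc1 : Continuous (fun y => |f y|) := hf.abs
  have i1 : IntervalIntegrable (fun y => P^2 * f y ^2) volume 0 P :=
    (hc2.const_mul _).intervalIntegrable _ _
  have i2 : IntervalIntegrable (fun y => 2 * P * m * |f y|) volume 0 P :=
    (hc1.const_mul _).intervalIntegrable _ _
  rw [intervalIntegral.integral_add (i1.sub i2) (by simp),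
    intervalIntegral.integral_sub i1 i2,
    intervalIntegral.integral_const_mul, intervalIntegral.integral_const_mul, ← hm] at h
  simp at h
  have : 0 ≤ P * (P * (∫ y in (0:ℝ)..P, f y ^ 2) - m^2) := by nlinarith
  have := nonneg_of_mul_nonneg_right this hP
  linarith

theorem SP.sq_le_sup {P : ℝ} (hP : 0 < P) {f : ℝ → ℝ} (hf : SP P f) {x₀ : ℝ} (h0 : f x₀ = 0)
    (x : ℝ) : f x ^ 2 ≤ P * ∫ y in (0:ℝ)..P, _root_.deriv f y ^ 2 := by
  refine le_trans ?_ (cs_abs hP hf.deriv.cont)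
  rw [← sq_abs]
  exact pow_le_pow_left₀ (abs_nonneg _) (hf.abs_le_integral hP h0 x) 2

theorem X_nonneg {P : ℝ} (hP : 0 < P) (k : ℕ) (f : ℝ → ℝ) : 0 ≤ X P k f :=
  intervalIntegral.integral_nonneg hP.le fun _ _ => sq_nonneg _

theorem SP.iter_zero {P : ℝ} (hP : 0 < P) {f : ℝ → ℝ} (hf : SP P f) (k : ℕ) :
    ∃ x, iteratedDeriv (k+1) f x = 0 := by
  rw [iteratedDeriv_succ]
  exact (hf.iter k).exists_deriv_zero hP

theorem SP.sup_iter {P : ℝ} (hP : 0 < P) {f : ℝ → ℝ} (hf : SP P f) (k : ℕ) (x : ℝ) :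
    iteratedDeriv (k+1) f x ^ 2 ≤ P * X P (k+2) f := by
  obtain ⟨x₀, h0⟩ := hf.iter_zero hP k
  have := (hf.iter (k+1)).sq_le_sup hP h0 x
  rwa [← iteratedDeriv_succ] at this

theorem SP.interp_iter {P : ℝ} (hP : 0 < P) {f : ℝ → ℝ} (hf : SP P f) (k : ℕ)
    {ε : ℝ} (hε : 0 < ε) (x : ℝ) :
    iteratedDeriv (k+1) f x ^ 2 ≤ ε * X P (k+2) f + ε⁻¹ * X P (k+1) f := by
  obtain ⟨x₀, h0⟩ := hf.iter_zero hP k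
  have := (hf.iter (k+1)).sq_le_interp hP h0 hε x
  rwa [← iteratedDeriv_succ] at this

/-- derivative towers -/
theorem tower_iter {D : ℕ → ℝ → ℝ} (hD : ∀ k x, HasDerivAt (D k) (D (k+1) x) x) (k : ℕ) :
    iteratedDeriv k (D 0) = D k := by
  induction k with
  | zero => simp
  | succ k ih => rw [iteratedDeriv_succ, ih]; funext x; exact (hD k x).deriv

theorem tower_contDiff {D : ℕ → ℝ → ℝ} (hD : ∀ k x, HasDerivAt (D k) (D (k+1) x) x) :
    ContDiff ℝ ∞ (D 0) := by
  refine contDiff_of_differentiable_iteratedDeriv fun k _ => ?_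
  rw [tower_iter hD]
  exact fun x => (hD k x).differentiableAt

theorem SP.le_sup_all {P : ℝ} (hP : 0 < P) {f : ℝ → ℝ} (hf : Continuous f)
    (hper : Function.Periodic f P) :
    ∃ C, ∀ x, |f x| ≤ C := by
  obtain ⟨C, hC⟩ := (isCompact_Icc (a := (0:ℝ)) (b := 0 + P)).exists_bound_of_continuousOn hf.continuousOn
  refine ⟨C, fun x => ?_⟩
  obtain ⟨y, hy, he⟩ := exists_rep hP 0 x
  rw [← he f hper]
  exact hC y ⟨hy.1, hy.2.le⟩

end APF

open scoped ContDiff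

namespace APF

/-- admissible coefficients -/
structure Coef (b ψ : ℝ → ℝ) (c : ℝ) : Prop where
  hc : 0 < c
  b_smooth : ContDiff ℝ ∞ b
  ψ_smooth : ContDiff ℝ ∞ ψ
  b_bd : ∀ k : ℕ, ∃ C, ∀ y, |iteratedDeriv k b y| ≤ C
  ψ_bd : ∀ k : ℕ, ∃ C, ∀ y, |iteratedDeriv k ψ y| ≤ C
  b_low : ∀ y, c ≤ b y
  ψ_low : ∀ y, c ≤ ψ y

noncomputable def Lam (P : ℝ) (ψ f : ℝ → ℝ) : ℝ :=
  (∫ x in (0:ℝ)..P, ψ (f x) * f x) / (∫ x in (0:ℝ)..P, ψ (f x))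

noncomputable def gg (P : ℝ) (ψ f : ℝ → ℝ) (x : ℝ) : ℝ := iteratedDeriv 2 f x + (f x - Lam P ψ f)

noncomputable def FF (P : ℝ) (b ψ f : ℝ → ℝ) (x : ℝ) : ℝ := b (f x) * gg P ψ f x

theorem gg_SP {P : ℝ} {ψ f : ℝ → ℝ} (hf : SP P f) : SP P (gg P ψ f) :=
  (hf.iter 2).add (hf.sub (SP.const P _))

theorem FF_SP {P : ℝ} {b ψ f : ℝ → ℝ} (hb : ContDiff ℝ ∞ b) (hf : SP P f) : SP P (FF P b ψ f) :=
  (hf.comp hb).mul (gg_SP hf)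

theorem int_psi_pos {P : ℝ} (hP : 0 < P) {b ψ : ℝ → ℝ} {c : ℝ} (hC : Coef b ψ c) {f : ℝ → ℝ}
    (hf : Continuous f) : c * P ≤ ∫ x in (0:ℝ)..P, ψ (f x) := by
  have : ∫ x in (0:ℝ)..P, c = c * P := by simp [mul_comm]
  rw [← this]
  exact intervalIntegral.integral_mono_on hP.le (by simp)
    ((hC.ψ_smooth.continuous.comp hf).intervalIntegrable _ _) fun x _ => hC.ψ_low _

theorem abs_sub_lam_le {P : ℝ} (hP : 0 < P) {b ψ : ℝ → ℝ} {c : ℝ} (hC : Coef b ψ c) {f : ℝ → ℝ}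
    (hf : Continuous f) {K x : ℝ} (hK : ∀ y, |f x - f y| ≤ K) : |f x - Lam P ψ f| ≤ K := by
  have h1 := int_psi_pos hP hC hf
  set I := ∫ x in (0:ℝ)..P, ψ (f x) with hI
  have hI0 : 0 < I := lt_of_lt_of_le (mul_pos hC.hc hP) h1
  have hcψ : Continuous fun y => ψ (f y) := hC.ψ_smooth.continuous.comp hf
  have e : f x - Lam P ψ f = (∫ y in (0:ℝ)..P, ψ (f y) * (f x - f y)) / I := by
    rw [Lam, ← hI]
    simp only [mul_sub]
    have i1 : IntervalIntegrable (fun y => ψ (f y) * f x) volume 0 P :=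
      (hcψ.mul continuous_const).intervalIntegrable _ _
    have i2 : IntervalIntegrable (fun y => ψ (f y) * f y) volume 0 P :=
      (hcψ.mul hf).intervalIntegrable _ _
    rw [intervalIntegral.integral_sub i1 i2, intervalIntegral.integral_mul_const, ← hI]
    field_simp
  rw [e, abs_div, abs_of_pos hI0, div_le_iff₀ hI0]
  refine (intervalIntegral.abs_integral_le_integral_abs hP.le).trans ?_
  rw [hI, ← intervalIntegral.integral_const_mul]
  refine intervalIntegral.integral_mono_on hP.le
    ((hcψ.mul (continuous_const.sub hf)).abs.intervalIntegrable _ _)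
    ((hcψ.const_mul _).intervalIntegrable _ _) fun y _ => ?_
  rw [abs_mul, abs_of_pos (hC.hc.trans_le (hC.ψ_low _)), mul_comm]
  exact mul_le_mul_of_nonneg_right (hK y) (hC.hc.le.trans (hC.ψ_low _))

theorem sq_sub_le {P : ℝ} (hP : 0 < P) {f : ℝ → ℝ} (hf : SP P f) (x y : ℝ) :
    (f x - f y)^2 ≤ P * X P 1 f := by
  have := (hf.sub (SP.const P (f y))).sq_le_sup hP (x₀ := y) (by simp) x
  simpa [X, iteratedDeriv_one] using this

theorem sq_sub_lam_le {P : ℝ} (hP : 0 < P) {b ψ : ℝ → ℝ} {c : ℝ} (hC : Coef b ψ c) {f : ℝ → ℝ}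
    (hf : SP P f) (x : ℝ) : (f x - Lam P ψ f)^2 ≤ P * X P 1 f := by
  have h : |f x - Lam P ψ f| ≤ √(P * X P 1 f) :=
    abs_sub_lam_le hP hC hf.cont fun y => Real.abs_le_sqrt (sq_sub_le hP hf x y)
  have h2 : 0 ≤ P * X P 1 f := mul_nonneg hP.le (X_nonneg hP _ _)
  calc (f x - Lam P ψ f)^2 = |f x - Lam P ψ f|^2 := (sq_abs _).symm
    _ ≤ (√(P * X P 1 f))^2 := pow_le_pow_left₀ (abs_nonneg _) h 2
    _ = _ := Real.sq_sqrt h2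

theorem bd_upto {b : ℝ → ℝ} (hb : ∀ k : ℕ, ∃ C, ∀ y, |iteratedDeriv k b y| ≤ C) (k : ℕ) :
    ∃ C, 0 ≤ C ∧ ∀ i ≤ k, ∀ y, |iteratedDeriv i b y| ≤ C := by
  choose C hC using hb
  have hC0 : ∀ i, 0 ≤ C i := fun i => (abs_nonneg _).trans (hC i 0)
  refine ⟨∑ i ∈ Finset.range (k+1), C i, Finset.sum_nonneg fun i _ => hC0 i, fun i hi y => ?_⟩
  exact (hC i y).trans (Finset.single_le_sum (f := C) (fun i _ => hC0 i)
    (Finset.mem_range.2 (by omega)))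

theorem comp_bound {b f : ℝ → ℝ} (hb : ContDiff ℝ ∞ b) (hf : ContDiff ℝ ∞ f) {k : ℕ} {C D x : ℝ}
    (hC : ∀ i ≤ k, ∀ y, |iteratedDeriv i b y| ≤ C)
    (hD : ∀ i, 1 ≤ i → i ≤ k → |iteratedDeriv i f x| ≤ D ^ i) :
    |iteratedDeriv k (fun x => b (f x)) x| ≤ k.factorial * C * D ^ k := by
  have := norm_iteratedFDeriv_comp_le (𝕜 := ℝ) hb hf (n := k) (by exact_mod_cast le_top) x
    (C := C) (D := D)
    (fun i hi => by rw [norm_iteratedFDeriv_eq_norm_iteratedDeriv]; exact hC i hi _)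
    (fun i h1 hi => by rw [norm_iteratedFDeriv_eq_norm_iteratedDeriv]; exact hD i h1 hi)
  rw [norm_iteratedFDeriv_eq_norm_iteratedDeriv] at this
  exact this

theorem iter_abs_le {P M : ℝ} (hP : 0 < P) {f : ℝ → ℝ} (hf : SP P f) {i : ℕ} (hi : 1 ≤ i)
    (hM : X P (i+1) f ≤ M) (x : ℝ) : |iteratedDeriv i f x| ≤ 1 + P * M := by
  obtain ⟨i, rfl⟩ := Nat.exists_eq_add_of_le' hi
  have h := hf.sup_iter hP i x
  have h2 : iteratedDeriv (i+1) f x ^ 2 ≤ P * M := h.trans (by gcongr)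
  have h3 : 0 ≤ P * M := (sq_nonneg _).trans h2
  apply abs_le_of_sq_le_sq _ (by linarith)
  nlinarith

theorem comp_sup {P M : ℝ} (hP : 0 < P) (hM : 0 ≤ M) {b : ℝ → ℝ} (hb : ContDiff ℝ ∞ b)
    (hbd : ∀ k : ℕ, ∃ C, ∀ y, |iteratedDeriv k b y| ≤ C) (j : ℕ) :
    ∃ C, 0 ≤ C ∧ ∀ f, SP P f → (∀ i, 1 ≤ i → i ≤ j + 1 → X P i f ≤ M) →
      ∀ x, |iteratedDeriv j (fun x => b (f x)) x| ≤ C := by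
  obtain ⟨C, hC0, hC⟩ := bd_upto hbd j
  refine ⟨j.factorial * C * (1 + P * M)^j, by positivity, fun f hf hX x => ?_⟩
  refine comp_bound hb hf.1 hC fun i hi hij => ?_
  have h1 := iter_abs_le hP hf hi (hX (i+1) (by omega) (by omega)) x
  exact h1.trans (le_self_pow₀ (by nlinarith) (by omega))

theorem comp_top {P M : ℝ} (hP : 0 < P) (hM : 0 ≤ M) {b : ℝ → ℝ} (hb : ContDiff ℝ ∞ b)
    (hbd : ∀ k : ℕ, ∃ C, ∀ y, |iteratedDeriv k b y| ≤ C) (k : ℕ) (hk : 1 ≤ k) :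
    ∃ C, 0 ≤ C ∧ ∀ f, SP P f → (∀ i, 1 ≤ i → i ≤ k → X P i f ≤ M) →
      ∀ x, |iteratedDeriv k (fun x => b (f x)) x| ≤ C * (1 + |iteratedDeriv k f x|) := by
  obtain ⟨C, hC0, hC⟩ := bd_upto hbd k
  have hPM : 0 ≤ P * M := by positivity
  refine ⟨k.factorial * C * (1 + P * M)^k, by positivity, fun f hf hX x => ?_⟩
  set d := |iteratedDeriv k f x| with hd
  have hd0 : 0 ≤ d := abs_nonneg _
  have hdk : (d ^ (1 / (k:ℝ)))^k = d := by
    rw [one_div, Real.rpow_inv_natCast_pow hd0 (by omega)]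
  set D := max (1 + P * M) (d ^ (1/(k:ℝ))) with hD
  have h := comp_bound (D := D) (x := x) hb hf.1 hC fun i hi hik => ?_
  · refine h.trans ?_
    rw [mul_assoc _ _ (1 + d)]
    gcongr
    rcases max_choice (1 + P * M) (d ^ (1/(k:ℝ))) with h1 | h1
    · rw [hD, h1]
      exact le_mul_of_one_le_right (by positivity) (by linarith)
    · rw [hD, h1, hdk]
      have : 1 ≤ (1 + P * M)^k := one_le_pow₀ (by linarith)
      nlinarith
  · rcases hik.lt_or_eq with h1 | rfl
    · have h1 := iter_abs_le hP hf hi (hX (i+1) (by omega) (by omega)) x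
      have h2 : 1 + P * M ≤ (1 + P * M) ^ i := le_self_pow₀ (by linarith) (by omega)
      have h3 : (1 + P * M) ^ i ≤ D ^ i := pow_le_pow_left₀ (by linarith) (le_max_left _ _) _
      exact h1.trans (h2.trans h3)
    · rw [← hd]
      calc d = (d ^ (1 / (i:ℝ)))^i := hdk.symm
        _ ≤ _ := pow_le_pow_left₀ (by positivity) (le_max_right _ _) _

/-- the sum `X_1 + ... + X_k` -/
noncomputable def SX (P : ℝ) (k : ℕ) (f : ℝ → ℝ) : ℝ := ∑ i ∈ Finset.Icc 1 k, X P i f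

theorem X_le_SX {P : ℝ} (hP : 0 < P) {k i : ℕ} (h1 : 1 ≤ i) (h2 : i ≤ k) (f : ℝ → ℝ) :
    X P i f ≤ SX P k f :=
  Finset.single_le_sum (f := fun i => X P i f) (fun i _ => X_nonneg hP i f)
    (Finset.mem_Icc.2 ⟨h1, h2⟩)

theorem SX_nonneg {P : ℝ} (hP : 0 < P) (k : ℕ) (f : ℝ → ℝ) : 0 ≤ SX P k f :=
  Finset.sum_nonneg fun i _ => X_nonneg hP i f

theorem int_sq_le {P : ℝ} (hP : 0 < P) {f g : ℝ → ℝ} (hf : Continuous f) (hg : Continuous g)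
    {C : ℝ} (h : ∀ x, |f x| ≤ C * |g x|) :
    ∫ x in (0:ℝ)..P, f x ^ 2 ≤ C^2 * ∫ x in (0:ℝ)..P, g x ^ 2 := by
  rw [← intervalIntegral.integral_const_mul]
  refine intervalIntegral.integral_mono_on hP.le ((hf.pow 2).intervalIntegrable _ _)
    (((hg.pow 2).const_mul _).intervalIntegrable _ _) fun x _ => ?_
  rw [← sq_abs (f x), ← sq_abs (g x), ← mul_pow]
  exact pow_le_pow_left₀ (abs_nonneg _) (h x) 2

theorem int_sq_le_const {P : ℝ} (hP : 0 < P) {f : ℝ → ℝ} (hf : Continuous f)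
    {C : ℝ} (h : ∀ x, f x ^ 2 ≤ C) : ∫ x in (0:ℝ)..P, f x ^ 2 ≤ P * C := by
  have : ∫ x in (0:ℝ)..P, C = P * C := by simp
  rw [← this]
  exact intervalIntegral.integral_mono_on hP.le ((hf.pow 2).intervalIntegrable _ _) (by simp)
    fun x _ => h x

theorem int_sq_add_le {P : ℝ} (hP : 0 < P) {f g : ℝ → ℝ} (hf : Continuous f) (hg : Continuous g) :
    ∫ x in (0:ℝ)..P, (f x + g x) ^ 2 ≤
      2 * (∫ x in (0:ℝ)..P, f x ^ 2) + 2 * ∫ x in (0:ℝ)..P, g x ^ 2 := by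
  have i1 : IntervalIntegrable (fun x => 2 * f x ^ 2) volume 0 P :=
    ((hf.pow 2).const_mul _).intervalIntegrable _ _
  have i2 : IntervalIntegrable (fun x => 2 * g x ^ 2) volume 0 P :=
    ((hg.pow 2).const_mul _).intervalIntegrable _ _
  rw [← intervalIntegral.integral_const_mul, ← intervalIntegral.integral_const_mul,
    ← intervalIntegral.integral_add i1 i2]
  refine intervalIntegral.integral_mono_on hP.le (((hf.add hg).pow 2).intervalIntegrable _ _)
    (i1.add i2) fun x _ => ?_
  nlinarith [sq_nonneg (f x - g x)]

/-- `e = f - Λ` -/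
theorem int_e_le {P : ℝ} (hP : 0 < P) {b ψ : ℝ → ℝ} {c : ℝ} (hC : Coef b ψ c) {f : ℝ → ℝ}
    (hf : SP P f) (q k : ℕ) (hk : 1 ≤ k) (hqk : q ≤ k) :
    ∫ x in (0:ℝ)..P, (iteratedDeriv q (fun x => f x - Lam P ψ f) x)^2 ≤ (1 + P^2) * SX P k f := by
  have hS := SX_nonneg hP k f
  rcases Nat.eq_zero_or_pos q with rfl | hq
  · have h := int_sq_le_const hP (f := fun x => f x - Lam P ψ f) (hf.cont.sub continuous_const)
      (fun x => sq_sub_lam_le hP hC hf x)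
    have h1 := X_le_SX hP le_rfl hk f
    simp only [iteratedDeriv_zero]
    calc _ ≤ _ := h
      _ = P^2 * X P 1 f := by ring
      _ ≤ P^2 * SX P k f := by gcongr
      _ ≤ _ := by linarith
  · have : iteratedDeriv q (fun x => f x - Lam P ψ f) = iteratedDeriv q f := by
      obtain ⟨q, rfl⟩ := Nat.exists_eq_add_of_le' hq
      rw [iteratedDeriv_succ', iteratedDeriv_succ']
      congr 1; funext x; simp
    rw [this]
    have h1 : X P q f ≤ SX P k f := X_le_SX hP hq hqk f
    rw [X] at h1
    nlinarith [sq_nonneg P]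

theorem iter_gg {P : ℝ} {ψ f : ℝ → ℝ} (hf : SP P f) (q : ℕ) (x : ℝ) :
    iteratedDeriv q (gg P ψ f) x
      = iteratedDeriv (q+2) f x + iteratedDeriv q (fun x => f x - Lam P ψ f) x := by
  have := iteratedDeriv_add (n := q) (x := x) (f := iteratedDeriv 2 f)
    (g := fun x => f x - Lam P ψ f) ((hf.iter 2).1.of_le (by exact_mod_cast le_top)).contDiffAt
    ((hf.sub (SP.const P (Lam P ψ f))).1.of_le (by exact_mod_cast le_top)).contDiffAt
  rw [iter_iter] at this
  exact this

theorem int_gg_le {P : ℝ} (hP : 0 < P) {b ψ : ℝ → ℝ} {c : ℝ} (hC : Coef b ψ c) {f : ℝ → ℝ}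
    (hf : SP P f) (q k : ℕ) (hqk : q + 2 ≤ k) :
    ∫ x in (0:ℝ)..P, (iteratedDeriv q (gg P ψ f) x)^2 ≤ (4 + 2 * P^2) * SX P k f := by
  simp only [iter_gg hf]
  have h1 := int_e_le hP hC hf q k (by omega) (by omega)
  have h2 := int_sq_add_le hP (hf.iter (q+2)).cont
    ((hf.sub (SP.const P (Lam P ψ f))).iter q).cont
  have h3 : X P (q+2) f ≤ SX P k f := X_le_SX hP (by omega) hqk f
  rw [X] at h3
  linarith

theorem sup_gg_le {P : ℝ} (hP : 0 < P) {b ψ : ℝ → ℝ} {c : ℝ} (hC : Coef b ψ c) {f : ℝ → ℝ}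
    (hf : SP P f) {ε : ℝ} (hε : 0 < ε) (x : ℝ) :
    (gg P ψ f x)^2 ≤ 2 * ε * X P 3 f + 2 * ε⁻¹ * X P 2 f + 2 * P * X P 1 f := by
  have h1 := hf.interp_iter hP 1 hε x
  have h2 := sq_sub_lam_le hP hC hf x
  simp only [Nat.reduceAdd] at h1
  rw [gg]
  nlinarith [sq_nonneg (iteratedDeriv 2 f x - (f x - Lam P ψ f))]

noncomputable def TT (P : ℝ) (b ψ f : ℝ → ℝ) (q j : ℕ) (x : ℝ) : ℝ :=
  if j = 0 then b (f x) * iteratedDeriv q (fun x => f x - Lam P ψ f) x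
  else (q.choose j) * iteratedDeriv j (fun x => b (f x)) x * iteratedDeriv (q - j) (gg P ψ f) x

theorem TT_cont {P : ℝ} {b ψ f : ℝ → ℝ} (hb : ContDiff ℝ ∞ b) (hf : SP P f) (q j : ℕ) :
    Continuous (TT P b ψ f q j) := by
  unfold TT
  split_ifs
  · exact (hf.comp hb).cont.mul ((hf.sub (SP.const P (Lam P ψ f))).iter q).cont
  · exact (continuous_const.mul ((hf.comp hb).iter j).cont).mul ((gg_SP hf).iter _).cont

theorem iter_FF {P : ℝ} {b ψ f : ℝ → ℝ} (hb : ContDiff ℝ ∞ b) (hf : SP P f) (q : ℕ) (x : ℝ) :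
    iteratedDeriv q (FF P b ψ f) x = b (f x) * iteratedDeriv (q+2) f x
      + ∑ j ∈ Finset.range (q+1), TT P b ψ f q j x := by
  have h := iteratedDeriv_mul (n := q) (x := x) (f := fun x => b (f x)) (g := gg P ψ f)
    ((hf.comp hb).1.of_le (by exact_mod_cast le_top)).contDiffAt
    ((gg_SP hf).1.of_le (by exact_mod_cast le_top)).contDiffAt
  have h' : iteratedDeriv q (FF P b ψ f) x = _ := h
  rw [h', Finset.sum_range_succ', Finset.sum_range_succ' (fun j => TT P b ψ f q j x)]
  simp only [TT, if_true, Nat.choose_zero_right, Nat.cast_one, one_mul, iteratedDeriv_zero,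
    Nat.sub_zero, iter_gg hf q]
  rw [mul_add]
  have : ∀ j, ¬ (j + 1 = 0) := fun j => by omega
  simp only [this, if_false]
  ring

theorem TT_bound {P M : ℝ} (hP : 0 < P) (hM : 0 ≤ M) {b ψ : ℝ → ℝ} {c : ℝ} (hC : Coef b ψ c)
    (q j : ℕ) (hj : j ≤ q) {ε : ℝ} (hε : 0 < ε) :
    ∃ C, 0 ≤ C ∧ ∀ f, SP P f → (∀ i, 1 ≤ i → i ≤ q → X P i f ≤ M) →
      ∫ x in (0:ℝ)..P, (TT P b ψ f q j x)^2 ≤ ε * X P (q+2) f + C * SX P (q+1) f := by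
  rcases Nat.eq_zero_or_pos j with rfl | hj0
  · obtain ⟨C, hC0, hCb⟩ := bd_upto hC.b_bd 0
    refine ⟨C^2 * (1 + P^2), by positivity, fun f hf hX => ?_⟩
    have h1 := int_e_le hP hC hf q (q+1) (by omega) (by omega)
    have h2 := int_sq_le hP (TT_cont (ψ := ψ) hC.b_smooth hf q 0)
      ((hf.sub (SP.const P (Lam P ψ f))).iter q).cont (C := C) (fun x => by
        have := hCb 0 le_rfl (f x)
        rw [iteratedDeriv_zero] at this
        simp only [TT, if_true, abs_mul]
        gcongr)
    have h3 := X_nonneg hP (q+2) f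
    calc _ ≤ _ := h2
      _ ≤ C^2 * ((1 + P^2) * SX P (q+1) f) := by gcongr
      _ ≤ _ := by nlinarith
  · rcases hj.lt_or_eq with hlt | rfl
    · obtain ⟨C, hC0, hCb⟩ := comp_sup hP hM hC.b_smooth hC.b_bd j
      refine ⟨(q.choose j * C)^2 * (4 + 2*P^2), by positivity, fun f hf hX => ?_⟩
      have h1 := int_gg_le hP hC hf (q-j) (q+1) (by omega)
      have h2 := int_sq_le hP (TT_cont (ψ := ψ) hC.b_smooth hf q j)
        ((gg_SP (ψ := ψ) hf).iter (q-j)).cont (C := q.choose j * C) (fun x => by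
          have := hCb f hf (fun i h1 h2 => hX i h1 (by omega)) x
          simp only [TT, if_neg (show ¬ j = 0 by omega), abs_mul, Nat.abs_cast]
          gcongr)
      have h3 := X_nonneg hP (q+2) f
      calc _ ≤ _ := h2
        _ ≤ (q.choose j * C)^2 * ((4 + 2*P^2) * SX P (q+1) f) := by gcongr
        _ ≤ _ := by nlinarith
    · obtain ⟨C, hC0, hCb⟩ := comp_top hP hM hC.b_smooth hC.b_bd j hj0
      -- K bounds the squared norm of the top derivative of `b ∘ f`
      set K := C^2 * (2 * P + 2 * M) with hK
      have hK0 : 0 ≤ K := by positivity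
      set δ := ε / (2 * (K + 1)) with hδ
      have hδ0 : 0 < δ := by positivity
      refine ⟨K * (2 * δ + 2 * δ⁻¹ + 2 * P), by positivity, fun f hf hX => ?_⟩
      set G := 2 * δ * X P 3 f + 2 * δ⁻¹ * X P 2 f + 2 * P * X P 1 f with hG
      have hX1 := X_nonneg hP 1 f
      have hX2 := X_nonneg hP 2 f
      have hX3 := X_nonneg hP 3 f
      have hXj := X_nonneg hP (j+2) f
      have hS := SX_nonneg hP (j+1) f
      have hG0 : 0 ≤ G := by positivity
      have hsup : ∀ x, (gg P ψ f x)^2 ≤ G := fun x => sup_gg_le hP hC hf hδ0 x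
      have hc1 : Continuous fun x => (2:ℝ) + 2 * iteratedDeriv j f x ^2 :=
        continuous_const.add (((hf.iter j).cont.pow 2).const_mul _)
      have h1 : ∫ x in (0:ℝ)..P, (TT P b ψ f j j x)^2 ≤ K * G := by
        calc ∫ x in (0:ℝ)..P, (TT P b ψ f j j x)^2
            ≤ ∫ x in (0:ℝ)..P, (C^2 * G) * (2 + 2 * iteratedDeriv j f x ^2) := by
              refine intervalIntegral.integral_mono_on hP.le
                (((TT_cont (ψ := ψ) hC.b_smooth hf j j).pow 2).intervalIntegrable _ _)
                ((hc1.const_mul _).intervalIntegrable _ _) fun x _ => ?_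
              have h2 := hCb f hf hX x
              simp only [TT, if_neg (show ¬ j = 0 by omega), Nat.choose_self, Nat.cast_one, one_mul,
                Nat.sub_self, iteratedDeriv_zero, mul_pow]
              have h3 : (iteratedDeriv j (fun x => b (f x)) x)^2 ≤
                  C^2 * (2 + 2 * iteratedDeriv j f x ^2) := by
                calc _ = |iteratedDeriv j (fun x => b (f x)) x|^2 := (sq_abs _).symm
                  _ ≤ (C * (1 + |iteratedDeriv j f x|))^2 := pow_le_pow_left₀ (abs_nonneg _) h2 2
                  _ = C^2 * (1 + |iteratedDeriv j f x|)^2 := by ring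
                  _ ≤ _ := by
                    gcongr
                    rw [← sq_abs (iteratedDeriv j f x)]
                    nlinarith [sq_nonneg (1 - |iteratedDeriv j f x|)]
              calc _ ≤ (C^2 * (2 + 2 * iteratedDeriv j f x ^2)) * G :=
                    mul_le_mul h3 (hsup x) (sq_nonneg _) (by positivity)
                _ = _ := by ring
          _ = (C^2 * G) * (2 * P + 2 * X P j f) := by
              have i2 : IntervalIntegrable (fun x => 2 * iteratedDeriv j f x ^ 2) volume 0 P :=
                (((hf.iter j).cont.pow 2).const_mul _).intervalIntegrable _ _
              rw [intervalIntegral.integral_const_mul, intervalIntegral.integral_add (by simp) i2,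
                intervalIntegral.integral_const_mul]
              simp [X, mul_comm]
          _ ≤ (C^2 * G) * (2 * P + 2 * M) := by
              have := hX j hj0 le_rfl
              gcongr
          _ = K * G := by rw [hK]; ring
      refine h1.trans ?_
      have e1 : X P 1 f ≤ SX P (j+1) f := X_le_SX hP le_rfl (by omega) f
      have e2 : X P 2 f ≤ SX P (j+1) f := X_le_SX hP (by omega) (by omega) f
      have e3 : X P 3 f ≤ X P (j+2) f + SX P (j+1) f := by
        rcases Nat.eq_or_lt_of_le hj0 with h | h
        · have : j = 1 := h.symm
          subst this
          simp only [Nat.reduceAdd] at *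
          linarith
        · have := X_le_SX hP (k := j+1) (i := 3) (by omega) (by omega) f
          linarith
      have hKδ : K * (2 * δ) ≤ ε := by
        rw [hδ]
        have : K * (2 * (ε / (2 * (K+1)))) = ε * (K / (K+1)) := by field_simp
        rw [this]
        have : K / (K+1) ≤ 1 := by rw [div_le_one (by linarith)]; linarith
        nlinarith
      calc K * G ≤ K * (2 * δ * (X P (j+2) f + SX P (j+1) f) + 2 * δ⁻¹ * SX P (j+1) f
              + 2 * P * SX P (j+1) f) := by rw [hG]; gcongr
        _ = K * (2 * δ) * X P (j+2) f + K * (2 * δ + 2 * δ⁻¹ + 2 * P) * SX P (j+1) f := by ring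
        _ ≤ _ := by gcongr

/-- Key energy inequality. -/
theorem key_ineq {P M : ℝ} (hP : 0 < P) (hM : 0 ≤ M) {b ψ : ℝ → ℝ} {c : ℝ} (hC : Coef b ψ c)
    (q : ℕ) :
    ∃ C, 0 ≤ C ∧ ∀ f, SP P f → (∀ i, 1 ≤ i → i ≤ q → X P i f ≤ M) →
      -2 * ∫ x in (0:ℝ)..P, iteratedDeriv q (FF P b ψ f) x * iteratedDeriv (q+2) f x
        ≤ -c * X P (q+2) f + C * SX P (q+1) f := by
  have hc := hC.hc
  set ε := c^2 / 4 / (q+1)^2 with hε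
  have hε0 : 0 < ε := by positivity
  have H : ∀ j, ∃ C, 0 ≤ C ∧ (j ≤ q → ∀ f, SP P f → (∀ i, 1 ≤ i → i ≤ q → X P i f ≤ M) →
      ∫ x in (0:ℝ)..P, (TT P b ψ f q j x)^2 ≤ ε * X P (q+2) f + C * SX P (q+1) f) := by
    intro j
    by_cases hj : j ≤ q
    · obtain ⟨C, h0, h1⟩ := TT_bound hP hM hC q j hj hε0
      exact ⟨C, h0, fun _ => h1⟩
    · exact ⟨0, le_rfl, fun h => absurd h hj⟩
  choose C hC0 hCj using H
  set CC := ∑ j ∈ Finset.range (q+1), C j with hCC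
  have hCC0 : 0 ≤ CC := Finset.sum_nonneg fun j _ => hC0 j
  refine ⟨2 / c * ((q+1) * CC), by positivity, fun f hf hX => ?_⟩
  set R := fun x => ∑ j ∈ Finset.range (q+1), TT P b ψ f q j x with hR
  have hRc : Continuous R := continuous_finsetSum _ fun j _ => TT_cont hC.b_smooth hf q j
  have hR2 : ∫ x in (0:ℝ)..P, R x ^2 ≤ c^2/4 * X P (q+2) f + ((q+1) * CC) * SX P (q+1) f := by
    calc ∫ x in (0:ℝ)..P, R x ^2
        ≤ ∫ x in (0:ℝ)..P, ((q:ℝ)+1) * ∑ j ∈ Finset.range (q+1), (TT P b ψ f q j x)^2 := by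
          refine intervalIntegral.integral_mono_on hP.le ((hRc.pow 2).intervalIntegrable _ _)
            (Continuous.intervalIntegrable (continuous_const.mul (continuous_finsetSum _
              fun j _ => (TT_cont hC.b_smooth hf q j).pow 2)) _ _) fun x _ => ?_
          have := sq_sum_le_card_mul_sum_sq (s := Finset.range (q+1)) (f := fun j => TT P b ψ f q j x)
          simpa using this
      _ = ((q:ℝ)+1) * ∑ j ∈ Finset.range (q+1), ∫ x in (0:ℝ)..P, (TT P b ψ f q j x)^2 := by
          rw [intervalIntegral.integral_const_mul, intervalIntegral.integral_finsetSum]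
          exact fun j _ => ((TT_cont hC.b_smooth hf q j).pow 2).intervalIntegrable _ _
      _ ≤ ((q:ℝ)+1) * ∑ j ∈ Finset.range (q+1), (ε * X P (q+2) f + C j * SX P (q+1) f) := by
          gcongr with j hj
          exact hCj j (by simp at hj; omega) f hf hX
      _ = _ := by
          rw [Finset.sum_add_distrib, Finset.sum_const, Finset.card_range,
            nsmul_eq_mul, ← Finset.sum_mul, ← hCC, hε]
          push_cast
          field_simp
  simp only [iter_FF hC.b_smooth hf]
  set v := iteratedDeriv (q+2) f with hv
  have hvc : Continuous v := (hf.iter (q+2)).cont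
  have hbc : Continuous fun x => b (f x) := (hf.comp hC.b_smooth).cont
  have hXv : X P (q+2) f = ∫ x in (0:ℝ)..P, v x ^ 2 := rfl
  have i1 : IntervalIntegrable (fun x => (2 * c - c/2) * v x ^2) volume 0 P :=
    ((hvc.pow 2).const_mul _).intervalIntegrable _ _
  have i2 : IntervalIntegrable (fun x => 2/c * R x ^2) volume 0 P :=
    ((hRc.pow 2).const_mul _).intervalIntegrable _ _
  have key : ∫ x in (0:ℝ)..P, ((2 * c - c/2) * v x ^2 - 2/c * R x ^2)
      ≤ ∫ x in (0:ℝ)..P, 2 * ((b (f x) * v x + R x) * v x) := by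
    refine intervalIntegral.integral_mono_on hP.le (i1.sub i2)
      ((((hbc.mul hvc).add hRc).mul hvc).const_mul _ |>.intervalIntegrable _ _) fun x _ => ?_
    have h1 := hC.b_low (f x)
    have h2 : 0 ≤ 2 / c * (R x + c/2 * v x)^2 := by positivity
    have h3 : 2 / c * (R x + c/2 * v x)^2 = 2/c * R x ^2 + 2 * R x * v x + c/2 * v x ^2 := by
      field_simp; ring
    nlinarith [mul_le_mul_of_nonneg_right h1 (sq_nonneg (v x))]
  rw [intervalIntegral.integral_sub i1 i2, intervalIntegral.integral_const_mul,
    intervalIntegral.integral_const_mul, intervalIntegral.integral_const_mul, ← hXv] at key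
  have h5 : 2/c * (∫ x in (0:ℝ)..P, R x ^2) ≤
      2/c * (c^2/4 * X P (q+2) f + ((q+1) * CC) * SX P (q+1) f) := by gcongr
  have h6 : 2/c * (c^2/4 * X P (q+2) f + ((q+1) * CC) * SX P (q+1) f)
    = c/2 * X P (q+2) f + 2/c * ((q+1) * CC) * SX P (q+1) f := by field_simp; ring
  have h7 : ∫ x in (0:ℝ)..P, (b (f x) * v x + ∑ j ∈ Finset.range (q+1), TT P b ψ f q j x) * v x
    = ∫ x in (0:ℝ)..P, (b (f x) * v x + R x) * v x := rfl
  rw [h7]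
  have h8 := X_nonneg hP (q+2) f
  linarith

end APF

open scoped ContDiff

namespace APF

/-- frequency -/
noncomputable def om (P : ℝ) (j : ℤ) : ℝ := j * (2 * π / P)

/-- `k`-th derivative of the Hartley function -/
noncomputable def Dph (P : ℝ) (j : ℤ) (k : ℕ) (x : ℝ) : ℝ :=
  om P j ^ k * (cos (om P j * x + k * (π / 2)) + sin (om P j * x + k * (π / 2)))

/-- Hartley function -/
noncomputable def ph (P : ℝ) (j : ℤ) : ℝ → ℝ := Dph P j 0

theorem ph_apply (P : ℝ) (j : ℤ) (x : ℝ) : ph P j x = cos (om P j * x) + sin (om P j * x) := by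
  simp [ph, Dph]

theorem Dph_hasDerivAt (P : ℝ) (j : ℤ) (k : ℕ) (x : ℝ) :
    HasDerivAt (Dph P j k) (Dph P j (k+1) x) x := by
  have h1 : HasDerivAt (fun x => om P j * x + k * (π / 2)) (om P j) x := by
    simpa using ((hasDerivAt_id x).const_mul (om P j)).add_const ((k:ℝ) * (π/2))
  have h2 := (h1.cos.add h1.sin).const_mul (om P j ^ k)
  refine h2.congr_deriv ?_
  simp only [Dph]
  push_cast
  have e : om P j * x + ((k:ℝ) + 1) * (π/2) = (om P j * x + k * (π / 2)) + π/2 := by ring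
  rw [e, cos_add_pi_div_two, sin_add_pi_div_two]
  ring

theorem om_mul_period {P : ℝ} (hP : 0 < P) (j : ℤ) : om P j * P = j * (2 * π) := by
  rw [om]; field_simp

theorem ph_SP {P : ℝ} (hP : 0 < P) (j : ℤ) : SP P (ph P j) := by
  refine ⟨tower_contDiff (Dph_hasDerivAt P j), fun x => ?_⟩
  rw [ph_apply, ph_apply, mul_add, om_mul_period hP, cos_add_int_mul_two_pi, sin_add_int_mul_two_pi]

theorem iter_ph (P : ℝ) (j : ℤ) (k : ℕ) : iteratedDeriv k (ph P j) = Dph P j k :=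
  tower_iter (Dph_hasDerivAt P j) k

theorem Dph_bound (P : ℝ) (j : ℤ) (k : ℕ) (x : ℝ) : |Dph P j k x| ≤ 2 * |om P j| ^ k := by
  rw [Dph, abs_mul, abs_pow, mul_comm]
  gcongr
  refine (abs_add_le _ _).trans ?_
  linarith [abs_cos_le_one (om P j * x + k * (π / 2)), abs_sin_le_one (om P j * x + k * (π / 2))]

theorem ph_bound (P : ℝ) (j : ℤ) (x : ℝ) : |ph P j x| ≤ 2 := by
  simpa [ph] using Dph_bound P j 0 x

theorem Dph_cont (P : ℝ) (j : ℤ) (k : ℕ) : Continuous (Dph P j k) := by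
  unfold Dph; fun_prop

theorem Dph_even (P : ℝ) (j : ℤ) (k : ℕ) (x : ℝ) :
    Dph P j (2*k) x = (-1)^k * om P j ^ (2*k) * ph P j x := by
  rw [ph_apply, Dph]
  have e : om P j * x + ((2*k : ℕ):ℝ) * (π/2) = om P j * x + k * π := by push_cast; ring
  rw [e, cos_add_nat_mul_pi, sin_add_nat_mul_pi]
  ring

theorem int_sin_om {P : ℝ} (hP : 0 < P) (j : ℤ) : ∫ x in (0:ℝ)..P, sin (om P j * x) = 0 := by
  by_cases h : om P j = 0
  · simp [h]
  · rw [intervalIntegral.integral_comp_mul_left _ h, integral_sin, om_mul_period hP]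
    simp [cos_int_mul_two_pi]

theorem int_cos_om {P : ℝ} (hP : 0 < P) (j : ℤ) :
    ∫ x in (0:ℝ)..P, cos (om P j * x) = if j = 0 then P else 0 := by
  by_cases h : j = 0
  · simp [h, om]
  · have h' : om P j ≠ 0 := by
      have := pi_pos
      rw [om]; positivity
    rw [intervalIntegral.integral_comp_mul_left _ h', integral_cos, om_mul_period hP]
    have := sin_int_mul_two_pi_sub 0 j
    have h2 : sin ((j:ℝ) * (2 * π)) = 0 := by
      have := Real.sin_int_mul_pi (j*2)
      rw [← this]; push_cast; ring_nf
    simp [h, h2]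

theorem ph_orth {P : ℝ} (hP : 0 < P) (i j : ℤ) :
    ∫ x in (0:ℝ)..P, ph P i x * ph P j x = if i = j then P else 0 := by
  have e : ∀ x, ph P i x * ph P j x = cos (om P (i - j) * x) + sin (om P (i + j) * x) := by
    intro x
    have e1 : om P (i - j) * x = om P i * x - om P j * x := by simp only [om]; push_cast; ring
    have e2 : om P (i + j) * x = om P i * x + om P j * x := by simp only [om]; push_cast; ring
    rw [ph_apply, ph_apply, e1, e2, cos_sub, sin_add]
    ring
  simp only [e]
  have i1 : IntervalIntegrable (fun x => cos (om P (i - j) * x)) volume 0 P :=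
    Continuous.intervalIntegrable (by fun_prop) _ _
  have i2 : IntervalIntegrable (fun x => sin (om P (i + j) * x)) volume 0 P :=
    Continuous.intervalIntegrable (by fun_prop) _ _
  rw [intervalIntegral.integral_add i1 i2, int_cos_om hP, int_sin_om hP]
  simp [sub_eq_zero]

/-- Hartley coefficients -/
noncomputable def cf (P : ℝ) (f : ℝ → ℝ) (j : ℤ) : ℝ := (1/P) * ∫ x in (0:ℝ)..P, f x * ph P j x

theorem cf_bound {P : ℝ} (hP : 0 < P) {f : ℝ → ℝ} {K : ℝ} (hK : ∀ x, |f x| ≤ K) (j : ℤ) :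
    |cf P f j| ≤ 2 * K := by
  have h : ‖∫ x in (0:ℝ)..P, f x * ph P j x‖ ≤ (K * 2) * |P - 0| := by
    refine intervalIntegral.norm_integral_le_of_norm_le_const fun x _ => ?_
    rw [norm_mul]
    exact mul_le_mul (hK x) (ph_bound P j x) (abs_nonneg _) ((abs_nonneg _).trans (hK x))
  rw [Real.norm_eq_abs, sub_zero, abs_of_pos hP] at h
  rw [cf, abs_mul, abs_of_pos (by positivity : 0 < 1/P)]
  calc 1/P * |∫ x in (0:ℝ)..P, f x * ph P j x| ≤ 1/P * (K * 2 * P) := by gcongr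
    _ = 2 * K := by field_simp

theorem cf_decay {P : ℝ} (hP : 0 < P) {f : ℝ → ℝ} (hf : SP P f) (k : ℕ) (j : ℤ) :
    om P j ^ (2*k) * cf P f j = (-1)^k * cf P (iteratedDeriv (2*k) f) j := by
  have h := hf.ibp_iter (ph_SP hP j) (2*k) 0
  simp only [add_zero, iter_ph, Dph_even, iteratedDeriv_zero, pow_mul, even_two, Even.neg_pow,
    one_pow, one_mul] at h
  have e : ∀ x, f x * ((-1)^k * (om P j ^ 2)^k * ph P j x) = ((-1)^k * (om P j ^ 2)^k) * (f x * ph P j x) := by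
    intro x; ring
  simp only [e, intervalIntegral.integral_const_mul] at h
  have s : ((-1:ℝ)^k) * (-1)^k = 1 := by rw [← mul_pow]; simp
  rw [cf, cf, ← h, pow_mul]
  linear_combination (-(om P j ^ 2)^k * (1/P * ∫ x in (0:ℝ)..P, f x * ph P j x)) * s

/-- rapid decay with explicit constants -/
def RD (C : ℕ → ℝ) (a : ℤ → ℝ) : Prop := ∀ k j, |a j| * (1 + |(j:ℝ)|) ^ k ≤ C k

theorem summable_ZZ : Summable fun j : ℤ => 1 / (1 + |(j:ℝ)|)^2 := by
  have h : Summable fun j : ℤ => 1 / (j:ℝ)^2 := by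
    have := Real.summable_one_div_int_pow (p := 2)
    exact this.2 (by norm_num)
  have h2 : Summable fun j : ℤ => 1 / (j:ℝ)^2 + (if j = 0 then 1 else 0) :=
    h.add (hasSum_ite_eq 0 1).summable
  refine Summable.of_nonneg_of_le (fun j => by positivity) (fun j => ?_) h2
  by_cases hj : j = 0
  · simp [hj]
  · simp only [hj, if_false, add_zero]
    have : 0 < |(j:ℝ)| := by positivity
    rw [← sq_abs (j:ℝ)]
    gcongr
    linarith

theorem RD.term {P : ℝ} (hP : 0 < P) {C : ℕ → ℝ} {a : ℤ → ℝ} (ha : RD C a) (k : ℕ) (j : ℤ) (x : ℝ) :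
    ‖a j * Dph P j k x‖ ≤ 2 * (2*π/P)^k * C (k+2) * (1 / (1 + |(j:ℝ)|)^2) := by
  have h1 := ha (k+2) j
  have h2 := Dph_bound P j k x
  have h3 : |om P j| ≤ (1 + |(j:ℝ)|) * (2*π/P) := by
    have : 0 < 2 * π/P := by have := pi_pos; positivity
    rw [om, abs_mul, abs_of_pos this]
    gcongr; linarith
  have h0 : 0 < 1 + |(j:ℝ)| := by positivity
  rw [norm_mul, Real.norm_eq_abs, Real.norm_eq_abs, mul_one_div, le_div_iff₀ (by positivity)]
  have hp := pi_pos
  calc |a j| * |Dph P j k x| * (1 + |(j:ℝ)|)^2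
      ≤ |a j| * (2 * ((1 + |(j:ℝ)|) * (2*π/P))^k) * (1 + |(j:ℝ)|)^2 := by
        gcongr; exact h2.trans (by gcongr)
    _ = 2 * (2*π/P)^k * (|a j| * (1 + |(j:ℝ)|)^(k+2)) := by rw [mul_pow]; ring
    _ ≤ _ := by gcongr

theorem RD.summ (P : ℝ) (C : ℕ → ℝ) (k : ℕ) :
    Summable fun j : ℤ => 2 * (2*π/P)^k * C (k+2) * (1 / (1 + |(j:ℝ)|)^2) :=
  summable_ZZ.mul_left _

/-- `k`-th derivative of Hartley series -/
noncomputable def DS (P : ℝ) (a : ℤ → ℝ) (k : ℕ) (x : ℝ) : ℝ := ∑' j : ℤ, a j * Dph P j k x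

theorem RD.hasDerivAt {P : ℝ} (hP : 0 < P) {C : ℕ → ℝ} {a : ℤ → ℝ} (ha : RD C a) (k : ℕ) (x : ℝ) :
    HasDerivAt (DS P a k) (DS P a (k+1) x) x := by
  refine hasDerivAt_tsum (g := fun j x => a j * Dph P j k x) (g' := fun j x => a j * Dph P j (k+1) x)
    (RD.summ P C (k+1)) (fun j y => (Dph_hasDerivAt P j k y).const_mul _)
    (fun j y => ha.term hP (k+1) j y) (y₀ := 0) ?_ x
  exact Summable.of_norm_bounded (RD.summ P C k) fun j => ha.term hP k j 0

theorem RD.iter {P : ℝ} (hP : 0 < P) {C : ℕ → ℝ} {a : ℤ → ℝ} (ha : RD C a) (k : ℕ) :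
    iteratedDeriv k (DS P a 0) = DS P a k := tower_iter (ha.hasDerivAt hP) k

theorem RD.SP {P : ℝ} (hP : 0 < P) {C : ℕ → ℝ} {a : ℤ → ℝ} (ha : RD C a) : SP P (DS P a 0) := by
  refine ⟨tower_contDiff (ha.hasDerivAt hP), fun x => ?_⟩
  simp only [DS]
  congr 1; funext j
  rw [show Dph P j 0 = ph P j from rfl, (ph_SP hP j).2 x]

theorem RD.bound {P : ℝ} (hP : 0 < P) {C : ℕ → ℝ} {a : ℤ → ℝ} (ha : RD C a) (k : ℕ) (x : ℝ) :
    |DS P a k x| ≤ ∑' j : ℤ, 2 * (2*π/P)^k * C (k+2) * (1 / (1 + |(j:ℝ)|)^2) :=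
  tsum_of_norm_bounded (RD.summ P C k).hasSum fun j => ha.term hP k j x

theorem RD.cf {P : ℝ} (hP : 0 < P) {C : ℕ → ℝ} {a : ℤ → ℝ} (ha : RD C a) (i : ℤ) :
    cf P (DS P a 0) i = a i := by
  have h := intervalIntegral.hasSum_integral_of_dominated_convergence (μ := volume) (a := 0) (b := P)
    (F := fun (j:ℤ) x => (a j * Dph P j 0 x) * ph P i x) (f := fun x => DS P a 0 x * ph P i x)
    (fun (j:ℤ) _ => (2 * (2*π/P)^0 * C (0+2) * (1 / (1 + |(j:ℝ)|)^2)) * 2)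
    (fun j => (((Dph_cont P j 0).const_mul _).mul (Dph_cont P i 0)).aestronglyMeasurable)
    (fun j => ae_of_all _ fun x _ => by
      rw [norm_mul]
      exact mul_le_mul (ha.term hP 0 j x) (ph_bound P i x) (norm_nonneg _)
        ((norm_nonneg _).trans (ha.term hP 0 j x)))
    (ae_of_all _ fun x _ => (RD.summ P C 0).mul_right 2)
    (by simp)
    (ae_of_all _ fun x _ => (Summable.of_norm_bounded (RD.summ P C 0)
      fun j => ha.term hP 0 j x).hasSum.mul_right _)
  have e : ∀ j : ℤ, ∫ x in (0:ℝ)..P, (a j * Dph P j 0 x) * ph P i x = if j = i then a i * P else 0 := by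
    intro j
    simp only [mul_assoc, intervalIntegral.integral_const_mul]
    rw [show Dph P j 0 = ph P j from rfl, ph_orth hP]
    by_cases hh : j = i <;> simp [hh]
  simp only [e] at h
  have h2 := h.unique (hasSum_ite_eq i (a i * P))
  rw [APF.cf, h2]
  field_simp

/-- completeness -/
theorem eq_zero_of_cf {P : ℝ} (hP : 0 < P) {f : ℝ → ℝ} (hf : Continuous f)
    (hper : Function.Periodic f P) (h0 : ∀ j, cf P f j = 0) (x : ℝ) : f x = 0 := by
  haveI : Fact (0 < P) := ⟨hP⟩
  have hper' : Function.Periodic (fun x => (f x : ℂ)) P := fun x => by simp [hper x]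
  have hcont : Continuous hper'.lift := by
    refine continuous_coinduced_dom.2 ?_
    exact Complex.continuous_ofReal.comp hf
  let g : C(AddCircle P, ℂ) := ⟨hper'.lift, hcont⟩
  have hg : ∀ x : ℝ, g (x : AddCircle P) = (f x : ℂ) := fun x => rfl
  have hi : ∀ j, ∫ x in (0:ℝ)..P, f x * ph P j x = 0 := by
    intro j
    have := h0 j
    rw [cf] at this
    exact (mul_eq_zero.1 this).resolve_left (by positivity)
  have hc : ∀ j, ∫ x in (0:ℝ)..P, f x * cos (om P j * x) = 0 := by
    intro j
    have i1 : IntervalIntegrable (fun x => f x * ph P j x) volume 0 P :=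
      (hf.mul (Dph_cont P j 0)).intervalIntegrable _ _
    have i2 : IntervalIntegrable (fun x => f x * ph P (-j) x) volume 0 P :=
      (hf.mul (Dph_cont P (-j) 0)).intervalIntegrable _ _
    have := intervalIntegral.integral_add i1 i2
    rw [hi, hi] at this
    have e : ∀ x, f x * ph P j x + f x * ph P (-j) x = 2 * (f x * cos (om P j * x)) := by
      intro x
      have : om P (-j) * x = - (om P j * x) := by simp [om]
      rw [ph_apply, ph_apply, this, cos_neg, sin_neg]; ring
    simp only [e, intervalIntegral.integral_const_mul] at this
    linarith
  have hs : ∀ j, ∫ x in (0:ℝ)..P, f x * sin (om P j * x) = 0 := by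
    intro j
    have i1 : IntervalIntegrable (fun x => f x * ph P j x) volume 0 P :=
      (hf.mul (Dph_cont P j 0)).intervalIntegrable _ _
    have i2 : IntervalIntegrable (fun x => f x * ph P (-j) x) volume 0 P :=
      (hf.mul (Dph_cont P (-j) 0)).intervalIntegrable _ _
    have := intervalIntegral.integral_sub i1 i2
    rw [hi, hi] at this
    have e : ∀ x, f x * ph P j x - f x * ph P (-j) x = 2 * (f x * sin (om P j * x)) := by
      intro x
      have : om P (-j) * x = - (om P j * x) := by simp [om]
      rw [ph_apply, ph_apply, this, cos_neg, sin_neg]; ring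
    simp only [e, intervalIntegral.integral_const_mul] at this
    linarith
  have hz : ∀ n, fourierCoeff g n = 0 := by
    intro n
    rw [fourierCoeff_eq_intervalIntegral _ _ 0, zero_add]
    have e : ∀ x : ℝ, (fourier (-n) (x : AddCircle P)) • g (x : AddCircle P)
        = ((f x * cos (om P n * x) : ℝ) : ℂ) + (-Complex.I) * ((f x * sin (om P n * x) : ℝ) : ℂ) := by
      intro x
      rw [hg, fourier_coe_apply]
      have : 2 * (π:ℂ) * Complex.I * ((-n : ℤ):ℂ) * x / P = ((-(om P n * x) : ℝ) : ℂ) * Complex.I := by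
        simp only [om]; push_cast; ring
      rw [this, Complex.exp_mul_I, ← Complex.ofReal_cos, ← Complex.ofReal_sin, cos_neg, sin_neg]
      simp only [smul_eq_mul]
      push_cast
      ring
    simp only [e]
    have i1 : IntervalIntegrable (fun x => ((f x * cos (om P n * x) : ℝ) : ℂ)) volume 0 P :=
      Continuous.intervalIntegrable (by fun_prop) _ _
    have i2 : IntervalIntegrable (fun x => (-Complex.I) * ((f x * sin (om P n * x) : ℝ) : ℂ)) volume 0 P :=
      Continuous.intervalIntegrable (by fun_prop) _ _
    rw [intervalIntegral.integral_add i1 i2, intervalIntegral.integral_const_mul,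
      intervalIntegral.integral_ofReal, intervalIntegral.integral_ofReal, hc, hs]
    simp
  have hsum := has_pointwise_sum_fourier_series_of_summable (f := g)
    (by rw [show fourierCoeff g = fun _ => 0 from funext hz]; exact summable_zero) (x : AddCircle P)
  simp only [hz, zero_smul] at hsum
  have := hsum.unique hasSum_zero
  rw [hg] at this
  exact_mod_cast this

theorem eq_of_cf {P : ℝ} (hP : 0 < P) {f g : ℝ → ℝ} (hf : Continuous f) (hg : Continuous g)
    (pf : Function.Periodic f P) (pg : Function.Periodic g P) (h0 : ∀ j, cf P f j = cf P g j) :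
    f = g := by
  funext x
  have := eq_zero_of_cf hP (f := fun x => f x - g x) (hf.sub hg) (fun x => by simp [pf x, pg x])
    (fun j => ?_) x
  · linarith
  · have i1 : IntervalIntegrable (fun x => f x * ph P j x) volume 0 P :=
      (hf.mul (Dph_cont P j 0)).intervalIntegrable _ _
    have i2 : IntervalIntegrable (fun x => g x * ph P j x) volume 0 P :=
      (hg.mul (Dph_cont P j 0)).intervalIntegrable _ _
    have := h0 j
    simp only [cf, sub_mul] at this ⊢
    rw [intervalIntegral.integral_sub i1 i2, mul_sub, this, sub_self]

end APF

open scoped ContDiff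

namespace APF

/-- global existence for ODEs with linear growth -/
theorem ode_exists {ι : Type*} [Fintype ι] (V : (ι → ℝ) → (ι → ℝ)) {C : ℝ} (hC0 : 0 ≤ C)
    (hC : ∀ a, ‖V a‖ ≤ C * ‖a‖)
    (hL : ∀ R, ∃ K, ∀ a b, ‖a‖ ≤ R → ‖b‖ ≤ R → ‖V a - V b‖ ≤ K * ‖a - b‖) (a0 : ι → ℝ)
    {T : ℝ} (hT : 0 ≤ T) :
    ∃ a : ℝ → ι → ℝ, a 0 = a0 ∧ ∀ t ∈ Set.Icc 0 T, HasDerivWithinAt a (V (a t)) (Set.Icc 0 T) t := by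
  set R := ‖a0‖ * exp (C * T) + 1 with hR
  have hR0 : 0 ≤ R := by positivity
  let r : (ι → ℝ) → (ι → ℝ) := fun a i => max (-R) (min R (a i))
  have hr1 : ∀ a, ‖r a‖ ≤ R := by
    intro a
    refine (pi_norm_le_iff_of_nonneg hR0).2 fun i => ?_
    rw [Real.norm_eq_abs, abs_le]
    exact ⟨le_max_left _ _, max_le (by linarith) (min_le_left _ _)⟩
  have hr2 : ∀ a b, ‖r a - r b‖ ≤ ‖a - b‖ := by
    intro a b
    refine (pi_norm_le_iff_of_nonneg (norm_nonneg _)).2 fun i => ?_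
    refine le_trans ?_ (norm_le_pi_norm (a - b) i)
    simp only [Pi.sub_apply, Real.norm_eq_abs, r]
    rw [max_comm, max_comm (-R)]
    refine (abs_max_sub_max_le_abs _ _ _).trans ?_
    rw [min_comm, min_comm R]
    have := abs_min_sub_min_le_max (a i) R (b i) R
    simpa using this
  have hr3 : ∀ a, ‖a‖ ≤ R → r a = a := by
    intro a ha
    funext i
    have := (norm_le_pi_norm a i).trans ha
    rw [Real.norm_eq_abs, abs_le] at this
    simp only [r]
    rw [min_eq_right this.2, max_eq_right this.1]
  have hr0 : r 0 = 0 := hr3 0 (by simpa using hR0)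
  have hr4 : ∀ a, ‖r a‖ ≤ ‖a‖ := by
    intro a
    simpa [hr0] using hr2 a 0
  obtain ⟨K, hK⟩ := hL R
  have hPL : IsPicardLindelof (fun _ : ℝ => fun a => V (r a)) (tmin := 0) (tmax := T)
      ⟨0, le_rfl, hT⟩ a0 (Real.toNNReal (C * R * T)) 0 (Real.toNNReal (C * R)) (Real.toNNReal K) := by
    refine ⟨fun t _ => ?_, fun x _ => continuousOn_const, fun t _ x _ => ?_, ?_⟩
    · refine LipschitzOnWith.of_dist_le_mul fun x _ y _ => ?_
      rw [dist_eq_norm, dist_eq_norm]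
      calc ‖V (r x) - V (r y)‖ ≤ K * ‖r x - r y‖ := hK _ _ (hr1 x) (hr1 y)
        _ ≤ (Real.toNNReal K) * ‖r x - r y‖ := by gcongr; exact Real.le_coe_toNNReal K
        _ ≤ _ := by gcongr; exact hr2 x y
    · rw [Real.coe_toNNReal _ (by positivity)]
      exact (hC _).trans (by gcongr; exact hr1 x)
    · rw [Real.coe_toNNReal _ (by positivity), Real.coe_toNNReal _ (by positivity)]
      simp [hT]
  obtain ⟨a, ha0, ha⟩ := hPL.exists_eq_forall_mem_Icc_hasDerivWithinAt₀
  have hb : ∀ t ∈ Set.Icc 0 T, ‖a t‖ ≤ R := by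
    intro t ht
    have := norm_le_gronwallBound_of_norm_deriv_right_le (f := a) (f' := fun t => V (r (a t)))
      (δ := ‖a0‖) (K := C) (ε := 0) (a := 0) (b := T) (fun t ht => (ha t ht).continuousWithinAt)
      (fun t ht => ((ha t ⟨ht.1, ht.2.le⟩).mono (Set.Icc_subset_Icc_left ht.1)).mono_of_mem_nhdsWithin
        (Icc_mem_nhdsGE ht.2))
      (by rw [← ha0]) (fun t ht => by
        rw [add_zero]
        exact (hC _).trans (by gcongr; exact hr4 _)) t ht
    rw [gronwallBound_ε0, sub_zero] at this
    refine this.trans ?_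
    have : ‖a0‖ * exp (C * t) ≤ ‖a0‖ * exp (C * T) := by
      gcongr; exact ht.2
    linarith
  refine ⟨a, ha0, fun t ht => ?_⟩
  have := ha t ht
  simp only [hr3 _ (hb t ht)] at this
  exact this

/-- bounded Lipschitz families -/
structure BL {E : Type*} [NormedAddCommGroup E] (s : Set E) (G : E → ℝ → ℝ) : Prop where
  cont : ∀ a, Continuous (G a)
  bd : ∃ B, 0 ≤ B ∧ ∀ a ∈ s, ∀ x, |G a x| ≤ B
  lip : ∃ K, 0 ≤ K ∧ ∀ a ∈ s, ∀ a' ∈ s, ∀ x, |G a x - G a' x| ≤ K * ‖a - a'‖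

theorem BL.add {E : Type*} [NormedAddCommGroup E] {s : Set E} {G H : E → ℝ → ℝ} (hG : BL s G)
    (hH : BL s H) : BL s (fun a x => G a x + H a x) := by
  obtain ⟨B, hB0, hB⟩ := hG.bd
  obtain ⟨B', hB0', hB'⟩ := hH.bd
  obtain ⟨K, hK0, hK⟩ := hG.lip
  obtain ⟨K', hK0', hK'⟩ := hH.lip
  refine ⟨fun a => (hG.cont a).add (hH.cont a), ⟨B + B', by positivity, fun a ha x => ?_⟩,
    ⟨K + K', by positivity, fun a ha a' ha' x => ?_⟩⟩
  · exact (abs_add_le _ _).trans (add_le_add (hB a ha x) (hB' a ha x))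
  · have e : G a x + H a x - (G a' x + H a' x) = (G a x - G a' x) + (H a x - H a' x) := by ring
    rw [e, add_mul]
    exact (abs_add_le _ _).trans (add_le_add (hK a ha a' ha' x) (hK' a ha a' ha' x))

theorem BL.mul {E : Type*} [NormedAddCommGroup E] {s : Set E} {G H : E → ℝ → ℝ} (hG : BL s G)
    (hH : BL s H) : BL s (fun a x => G a x * H a x) := by
  obtain ⟨B, hB0, hB⟩ := hG.bd
  obtain ⟨B', hB0', hB'⟩ := hH.bd
  obtain ⟨K, hK0, hK⟩ := hG.lip
  obtain ⟨K', hK0', hK'⟩ := hH.lip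
  refine ⟨fun a => (hG.cont a).mul (hH.cont a), ⟨B * B', by positivity, fun a ha x => ?_⟩,
    ⟨K * B' + B * K', by positivity, fun a ha a' ha' x => ?_⟩⟩
  · rw [abs_mul]; exact mul_le_mul (hB a ha x) (hB' a ha x) (abs_nonneg _) hB0
  · have e : G a x * H a x - G a' x * H a' x = (G a x - G a' x) * H a x + G a' x * (H a x - H a' x) := by
      ring
    rw [e]
    refine (abs_add_le _ _).trans ?_
    rw [abs_mul, abs_mul]
    have h1 := mul_le_mul (hK a ha a' ha' x) (hB' a ha x) (abs_nonneg _) (by positivity)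
    have h2 := mul_le_mul (hB a' ha' x) (hK' a ha a' ha' x) (abs_nonneg _) hB0
    linarith

theorem BL.const {E : Type*} [NormedAddCommGroup E] (s : Set E) {f : ℝ → ℝ} (hf : Continuous f)
    {B : ℝ} (hB : ∀ x, |f x| ≤ B) : BL s (fun _ x => f x) :=
  ⟨fun _ => hf, ⟨B, (abs_nonneg _).trans (hB 0), fun _ _ => hB⟩, ⟨0, le_rfl, by simp⟩⟩

theorem BL.neg {E : Type*} [NormedAddCommGroup E] {s : Set E} {G : E → ℝ → ℝ} (hG : BL s G) :
    BL s (fun a x => - G a x) := by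
  simpa using (BL.const s (continuous_const (y := (-1:ℝ))) (B := 1) (by simp)).mul hG

theorem BL.comp {E : Type*} [NormedAddCommGroup E] {s : Set E} {G : E → ℝ → ℝ} (hG : BL s G)
    {b : ℝ → ℝ} (hb : ContDiff ℝ ∞ b) (hbd : ∀ k : ℕ, ∃ C, ∀ y, |iteratedDeriv k b y| ≤ C) :
    BL s (fun a x => b (G a x)) := by
  obtain ⟨C, hC0, hC⟩ := bd_upto hbd 1
  obtain ⟨K, hK0, hK⟩ := hG.lip
  have h0 : ∀ y, |b y| ≤ C := fun y => by simpa using hC 0 (by norm_num) y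
  have h1 : ∀ y, |deriv b y| ≤ C := fun y => by simpa using hC 1 le_rfl y
  refine ⟨fun a => hb.continuous.comp (hG.cont a), ⟨C, hC0, fun a _ x => h0 _⟩,
    ⟨C * K, by positivity, fun a ha a' ha' x => ?_⟩⟩
  have := Convex.norm_image_sub_le_of_norm_deriv_le (f := b) (s := Set.univ) (C := C)
    (fun x _ => (hb.differentiable (by simp)) x) (fun x _ => h1 x) convex_univ
    (Set.mem_univ (G a' x)) (Set.mem_univ (G a x))
  rw [Real.norm_eq_abs, Real.norm_eq_abs] at this
  refine this.trans ?_
  rw [mul_assoc]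
  gcongr
  exact hK a ha a' ha' x

theorem BL.integral {E : Type*} [NormedAddCommGroup E] {s : Set E} {G : E → ℝ → ℝ} (hG : BL s G)
    {P : ℝ} (hP : 0 < P) : BL s (fun a _ => ∫ x in (0:ℝ)..P, G a x) := by
  obtain ⟨B, hB0, hB⟩ := hG.bd
  obtain ⟨K, hK0, hK⟩ := hG.lip
  refine ⟨fun a => continuous_const, ⟨B * P, by positivity, fun a ha x => ?_⟩,
    ⟨K * P, by positivity, fun a ha a' ha' x => ?_⟩⟩
  · have := intervalIntegral.norm_integral_le_of_norm_le_const (f := G a) (a := 0) (b := P)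
      fun x _ => hB a ha x
    rwa [sub_zero, abs_of_pos hP] at this
  · rw [← intervalIntegral.integral_sub ((hG.cont a).intervalIntegrable _ _)
      ((hG.cont a').intervalIntegrable _ _)]
    have := intervalIntegral.norm_integral_le_of_norm_le_const (f := fun x => G a x - G a' x)
      (a := 0) (b := P) fun x _ => hK a ha a' ha' x
    rw [sub_zero, abs_of_pos hP] at this
    rw [mul_assoc, mul_comm P, ← mul_assoc]
    exact this

theorem BL.inv {E : Type*} [NormedAddCommGroup E] {s : Set E} {G : E → ℝ → ℝ} (hG : BL s G)
    {c : ℝ} (hc : 0 < c) (h : ∀ a x, c ≤ G a x) : BL s (fun a x => (G a x)⁻¹) := by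
  obtain ⟨K, hK0, hK⟩ := hG.lip
  have hp : ∀ a x, 0 < G a x := fun a x => hc.trans_le (h a x)
  refine ⟨fun a => (hG.cont a).inv₀ fun x => (hp a x).ne', ⟨c⁻¹, by positivity, fun a ha x => ?_⟩,
    ⟨K * (c⁻¹ * c⁻¹), by positivity, fun a ha a' ha' x => ?_⟩⟩
  · rw [abs_of_pos (inv_pos.2 (hp a x))]
    exact inv_anti₀ hc (h a x)
  · have e : (G a x)⁻¹ - (G a' x)⁻¹ = (G a' x - G a x) * ((G a x)⁻¹ * (G a' x)⁻¹) := by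
      have := (hp a x).ne'
      have := (hp a' x).ne'
      field_simp
    have h1 : (G a x)⁻¹ ≤ c⁻¹ := inv_anti₀ hc (h a x)
    have h2 : (G a' x)⁻¹ ≤ c⁻¹ := inv_anti₀ hc (h a' x)
    have h3 : 0 < (G a x)⁻¹ := inv_pos.2 (hp a x)
    have h4 : 0 < (G a' x)⁻¹ := inv_pos.2 (hp a' x)
    rw [e, abs_mul, abs_of_pos (mul_pos h3 h4), abs_sub_comm]
    have := mul_le_mul (hK a ha a' ha' x) (mul_le_mul h1 h2 h4.le (by positivity))
      (mul_pos h3 h4).le (by positivity)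
    linarith

theorem BL.lin {ι : Type*} [Fintype ι] (R : ℝ) {p : ι → ℝ → ℝ} (hp : ∀ i, Continuous (p i))
    (hb : ∀ i, ∃ B, ∀ x, |p i x| ≤ B) :
    BL {a : ι → ℝ | ‖a‖ ≤ R} (fun a x => ∑ i, a i * p i x) := by
  choose B hB using hb
  have hB0 : ∀ i, 0 ≤ B i := fun i => (abs_nonneg _).trans (hB i 0)
  have key : ∀ (a : ι → ℝ) x, |∑ i, a i * p i x| ≤ (∑ i, B i) * ‖a‖ := by
    intro a x
    refine (Finset.abs_sum_le_sum_abs _ _).trans ?_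
    rw [Finset.sum_mul]
    refine Finset.sum_le_sum fun i _ => ?_
    rw [abs_mul, mul_comm]
    exact mul_le_mul (hB i x) (norm_le_pi_norm a i) (abs_nonneg _) (hB0 i)
  have hS : 0 ≤ ∑ i, B i := Finset.sum_nonneg fun i _ => hB0 i
  refine ⟨fun a => continuous_finsetSum _ fun i _ => (hp i).const_mul _,
    ⟨(∑ i, B i) * |R|, by positivity, fun a ha x => (key a x).trans ?_⟩,
    ⟨∑ i, B i, hS, fun a _ a' _ x => ?_⟩⟩
  · have : ‖a‖ ≤ |R| := le_trans ha (le_abs_self R)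
    gcongr
  · have := key (a - a') x
    rw [← Finset.sum_sub_distrib]
    simpa [sub_mul] using this

/-- truncated Hartley sums -/
noncomputable def wS (P : ℝ) (N : ℕ) (a : ℤ → ℝ) (x : ℝ) : ℝ :=
  ∑ j ∈ Finset.Icc (-N:ℤ) N, a j * ph P j x

theorem wS_hasDeriv (P : ℝ) (N : ℕ) (a : ℤ → ℝ) (k : ℕ) (x : ℝ) :
    HasDerivAt (fun x => ∑ j ∈ Finset.Icc (-N:ℤ) N, a j * Dph P j k x)
      (∑ j ∈ Finset.Icc (-N:ℤ) N, a j * Dph P j (k+1) x) x :=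
  HasDerivAt.fun_sum fun j _ => (Dph_hasDerivAt P j k x).const_mul _

theorem wS_iter (P : ℝ) (N : ℕ) (a : ℤ → ℝ) (k : ℕ) :
    iteratedDeriv k (wS P N a) = fun x => ∑ j ∈ Finset.Icc (-N:ℤ) N, a j * Dph P j k x :=
  tower_iter (D := fun k x => ∑ j ∈ Finset.Icc (-N:ℤ) N, a j * Dph P j k x) (wS_hasDeriv P N a) k

theorem wS_SP {P : ℝ} (hP : 0 < P) (N : ℕ) (a : ℤ → ℝ) : SP P (wS P N a) := by
  refine ⟨tower_contDiff (D := fun k x => ∑ j ∈ Finset.Icc (-N:ℤ) N, a j * Dph P j k x)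
    (wS_hasDeriv P N a), fun x => ?_⟩
  simp only [wS]
  exact Finset.sum_congr rfl fun j _ => by rw [(ph_SP hP j).2 x]

theorem galerkin_exists {P : ℝ} (hP : 0 < P) {b ψ : ℝ → ℝ} {c : ℝ} (hC : Coef b ψ c)
    (A : ℤ → ℝ) (N : ℕ) {T : ℝ} (hT : 0 ≤ T) :
    ∃ a : ℤ → ℝ → ℝ, (∀ j ∉ Finset.Icc (-N:ℤ) N, ∀ t, a j t = 0) ∧
      (∀ j ∈ Finset.Icc (-N:ℤ) N, a j 0 = A j) ∧
      ∀ j ∈ Finset.Icc (-N:ℤ) N, ∀ t ∈ Set.Icc 0 T,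
        HasDerivWithinAt (a j) (cf P (FF P b ψ (wS P N (fun j => a j t))) j) (Set.Icc 0 T) t := by
  classical
  set s := Finset.Icc (-N:ℤ) N with hs
  let ex : (s → ℝ) → ℤ → ℝ := fun a j => if h : j ∈ s then a ⟨j, h⟩ else 0
  have hwS : ∀ a k x, ∑ j ∈ s, ex a j * Dph P j k x = ∑ i : s, a i * Dph P i k x := by
    intro a k x
    rw [← Finset.sum_coe_sort]
    refine Finset.sum_congr rfl fun i _ => ?_
    simp [ex]
  let W : ℕ → (s → ℝ) → ℝ → ℝ := fun k a x => ∑ i : s, a i * Dph P i k x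
  have hW0 : ∀ a, wS P N (ex a) = W 0 a := fun a => funext fun x => hwS a 0 x
  have hW2 : ∀ a, iteratedDeriv 2 (W 0 a) = W 2 a := by
    intro a
    rw [← hW0, wS_iter]
    exact funext fun x => hwS a 2 x
  have hWb : ∀ k R, BL {a : s → ℝ | ‖a‖ ≤ R} (W k) := fun k R =>
    BL.lin R (fun i => Dph_cont P i k) fun i => ⟨_, Dph_bound P i k⟩
  let V : (s → ℝ) → (s → ℝ) := fun a j => cf P (FF P b ψ (W 0 a)) j
  have hlin : ∀ k, ∃ S, 0 ≤ S ∧ ∀ a x, |W k a x| ≤ S * ‖a‖ := by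
    intro k
    refine ⟨∑ i : s, 2 * |om P i|^k, by positivity, fun a x => ?_⟩
    refine (Finset.abs_sum_le_sum_abs _ _).trans ?_
    rw [Finset.sum_mul]
    refine Finset.sum_le_sum fun i _ => ?_
    rw [abs_mul, mul_comm]
    exact mul_le_mul (Dph_bound P i k x) (norm_le_pi_norm a i) (abs_nonneg _) (by positivity)
  obtain ⟨S0, hS0, hS0'⟩ := hlin 0
  obtain ⟨S2, hS2, hS2'⟩ := hlin 2
  obtain ⟨B, hB0, hB⟩ := bd_upto hC.b_bd 0
  have hbB : ∀ y, |b y| ≤ B := fun y => by simpa using hB 0 le_rfl y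
  have hlip : ∀ R, ∃ K, ∀ a b, ‖a‖ ≤ R → ‖b‖ ≤ R → ‖V a - V b‖ ≤ K * ‖a - b‖ := by
    intro R
    have h0 := hWb 0 R
    have h1 := h0.comp hC.ψ_smooth hC.ψ_bd
    have hL : BL {a : s → ℝ | ‖a‖ ≤ R} (fun a _ => Lam P ψ (W 0 a)) := by
      have := ((h1.mul h0).integral hP).mul ((h1.integral hP).inv (c := c * P)
        (mul_pos hC.hc hP) (fun a _ => int_psi_pos hP hC (h0.cont a)))
      simpa [Lam, div_eq_mul_inv] using this
    have hF : BL {a : s → ℝ | ‖a‖ ≤ R} (fun a => FF P b ψ (W 0 a)) := by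
      have := (h0.comp hC.b_smooth hC.b_bd).mul ((hWb 2 R).add (h0.add hL.neg))
      refine (funext₂ fun a x => ?_ : (fun (a : s → ℝ) x => b (W 0 a x) * (W 2 a x + (W 0 a x + -Lam P ψ (W 0 a)))) = fun a => FF P b ψ (W 0 a)) ▸ this
      simp only [FF, gg, hW2]; ring
    have hV : ∀ j : s, BL {a : s → ℝ | ‖a‖ ≤ R} (fun a _ => V a j) := by
      intro j
      have := (BL.const {a : s → ℝ | ‖a‖ ≤ R} (continuous_const (y := 1/P)) (B := |1/P|)
        (fun _ => le_rfl)).mul ((hF.mul (BL.const {a : s → ℝ | ‖a‖ ≤ R} (Dph_cont P j 0)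
          (Dph_bound P j 0))).integral hP)
      exact this
    choose K hK0 hK using fun j => (hV j).lip
    refine ⟨∑ j, K j, fun a b ha hb => ?_⟩
    have hS : 0 ≤ ∑ j, K j := Finset.sum_nonneg fun i _ => hK0 i
    refine (pi_norm_le_iff_of_nonneg (by positivity)).2 fun j => ?_
    refine (hK j a ha b hb 0).trans ?_
    gcongr
    exact Finset.single_le_sum (f := K) (fun i _ => hK0 i) (Finset.mem_univ j)
  obtain ⟨a, ha0, ha⟩ := ode_exists V (C := 2 * (B * (S2 + 2 * S0))) (by positivity) (fun a => by
    refine (pi_norm_le_iff_of_nonneg (by positivity)).2 fun j => ?_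
    have := cf_bound hP (f := FF P b ψ (W 0 a)) (K := B * (S2 + 2 * S0) * ‖a‖) (fun x => by
      rw [FF, abs_mul, mul_assoc]
      have hcont : Continuous (W 0 a) := (hWb 0 0).cont a
      refine mul_le_mul (hbB _) ?_ (abs_nonneg _) hB0
      have h1 := abs_sub_lam_le hP hC hcont (x := x) (K := 2 * S0 * ‖a‖) (fun y => by
        refine (abs_sub _ _).trans ?_
        have := hS0' a x; have := hS0' a y
        linarith)
      rw [gg, hW2]
      refine (abs_add_le _ _).trans ?_
      have := hS2' a x
      linarith) j
    rw [Real.norm_eq_abs]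
    linarith) hlip (fun j => A j) hT
  refine ⟨fun j t => ex (a t) j, fun j hj t => by simp [ex, hj], fun j hj => by simp [ex, hj, ha0],
    fun j hj t ht => ?_⟩
  have h1 := hasDerivWithinAt_pi.1 (ha t ht) ⟨j, hj⟩
  have e : wS P N (fun j => ex (a t) j) = W 0 (a t) := hW0 (a t)
  rw [e]
  simpa [ex, hj] using h1

end APF

open scoped ContDiff

namespace APF

theorem gron {f f' : ℝ → ℝ} {T C ε δ : ℝ} (hC : 0 ≤ C) (hε : 0 ≤ ε) (hδ : 0 ≤ δ)
    (hf : ∀ t ∈ Set.Icc 0 T, HasDerivWithinAt f (f' t) (Set.Icc 0 T) t)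
    (h0 : f 0 ≤ δ) (hb : ∀ t ∈ Set.Icc 0 T, f' t ≤ C * f t + ε) :
    ∀ t ∈ Set.Icc 0 T, f t ≤ gronwallBound δ C ε T := by
  intro t ht
  have := le_gronwallBound_of_liminf_deriv_right_le (f := f) (f' := f') (a := 0) (b := T)
    (δ := δ) (K := C) (ε := ε) (fun t ht => (hf t ht).continuousWithinAt)
    (fun t ht r hr => (((hf t ⟨ht.1, ht.2.le⟩).mono (Set.Icc_subset_Icc_left ht.1)
      ).mono_of_mem_nhdsWithin (Icc_mem_nhdsGE ht.2)).liminf_right_slope_le hr) h0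
    (fun t ht => hb t ⟨ht.1, ht.2.le⟩) t ht
  rw [sub_zero] at this
  exact this.trans (gronwallBound_mono hδ hε hC ht.2)

/-- Galerkin solution -/
structure Gal (P : ℝ) (b ψ : ℝ → ℝ) (A : ℤ → ℝ) (N : ℕ) (a : ℤ → ℝ → ℝ) : Prop where
  supp : ∀ j ∉ Finset.Icc (-N:ℤ) N, ∀ t, a j t = 0
  start : ∀ j ∈ Finset.Icc (-N:ℤ) N, a j 0 = A j
  ode : ∀ j ∈ Finset.Icc (-N:ℤ) N, ∀ t ∈ Set.Icc (0:ℝ) N,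
    HasDerivWithinAt (a j) (cf P (FF P b ψ (wS P N (fun j => a j t))) j) (Set.Icc (0:ℝ) N) t

theorem X_wS {P : ℝ} (hP : 0 < P) (N : ℕ) (a : ℤ → ℝ) (k : ℕ) :
    X P k (wS P N a) = P * ∑ j ∈ Finset.Icc (-N:ℤ) N, om P j ^ (2*k) * a j ^ 2 := by
  have hw := wS_SP hP N a
  have h := hw.ibp_iter hw k k
  have e0 : ∀ j, ∫ x in (0:ℝ)..P, wS P N a x * ph P j x = if j ∈ Finset.Icc (-N:ℤ) N then P * a j else 0 := by
    intro j
    simp only [wS, Finset.sum_mul]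
    rw [intervalIntegral.integral_finsetSum]
    swap
    · exact fun i _ => (((Dph_cont P i 0).const_mul _).mul (Dph_cont P j 0)).intervalIntegrable _ _
    simp only [mul_assoc, intervalIntegral.integral_const_mul, ph_orth hP]
    simp [mul_comm]
  have e1 : ∫ x in (0:ℝ)..P, wS P N a x * iteratedDeriv (k+k) (wS P N a) x
      = (-1)^k * (P * ∑ j ∈ Finset.Icc (-N:ℤ) N, om P j ^ (2*k) * a j ^ 2) := by
    rw [← two_mul, wS_iter]
    simp only [Dph_even, Finset.mul_sum]
    have e : ∀ j x, wS P N a x * (a j * ((-1)^k * om P j ^ (2*k) * ph P j x))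
        = ((-1)^k * om P j ^(2*k) * a j) * (wS P N a x * ph P j x) := fun j x => by ring
    simp only [e]
    rw [intervalIntegral.integral_finsetSum]
    swap
    · exact fun i _ => ((hw.cont.mul (Dph_cont P i 0)).const_mul _).intervalIntegrable _ _
    refine Finset.sum_congr rfl fun j hj => ?_
    rw [intervalIntegral.integral_const_mul, e0, if_pos hj]
    ring
  rw [e1] at h
  have h2 := mul_left_cancel₀ (pow_ne_zero k (by norm_num : (-1:ℝ) ≠ 0)) h
  rw [h2, X]
  simp only [sq]

theorem Gal.X_deriv {P : ℝ} (hP : 0 < P) {b ψ : ℝ → ℝ} {c : ℝ} (hC : Coef b ψ c) {A : ℤ → ℝ} {N : ℕ}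
    {a : ℤ → ℝ → ℝ} (ha : Gal P b ψ A N a) (q : ℕ) {t : ℝ} (ht : t ∈ Set.Icc (0:ℝ) N) :
    HasDerivWithinAt (fun t => X P (q+1) (wS P N (fun j => a j t)))
      (-2 * ∫ x in (0:ℝ)..P, iteratedDeriv q (FF P b ψ (wS P N (fun j => a j t))) x *
        iteratedDeriv (q+2) (wS P N (fun j => a j t)) x) (Set.Icc (0:ℝ) N) t := by
  simp only [X_wS hP]
  have h1 : HasDerivWithinAt (fun t => P * ∑ j ∈ Finset.Icc (-N:ℤ) N, om P j ^ (2*(q+1)) * a j t ^ 2)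
      (P * ∑ j ∈ Finset.Icc (-N:ℤ) N, om P j ^ (2*(q+1)) *
        (2 * a j t * cf P (FF P b ψ (wS P N (fun j => a j t))) j)) (Set.Icc (0:ℝ) N) t := by
    refine HasDerivWithinAt.const_mul _ (HasDerivWithinAt.fun_sum fun j hj => ?_)
    refine HasDerivWithinAt.const_mul _ ?_
    simpa using (ha.ode j hj t ht).fun_pow 2
  refine h1.congr_deriv ?_
  set w := wS P N (fun j => a j t) with hw
  have hwS : SP P w := wS_SP hP N _
  have hF : SP P (FF P b ψ w) := FF_SP hC.b_smooth hwS
  have h := hF.ibp_iter hwS q (q+2)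
  have e2 : q + (q + 2) = 2 * (q+1) := by ring
  rw [e2, hw, wS_iter, ← hw] at h
  simp only [Dph_even, Finset.mul_sum] at h
  have e : ∀ j x, FF P b ψ w x * (a j t * ((-1)^(q+1) * om P j ^ (2*(q+1)) * ph P j x))
      = ((-1)^(q+1) * om P j ^(2*(q+1)) * a j t) * (FF P b ψ w x * ph P j x) := fun j x => by ring
  simp only [e] at h
  rw [intervalIntegral.integral_finsetSum] at h
  swap
  · exact fun i _ => ((hF.cont.mul (Dph_cont P i 0)).const_mul _).intervalIntegrable _ _
  simp only [intervalIntegral.integral_const_mul] at h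
  have s : ((-1:ℝ)^q) * (-1)^q = 1 := by rw [← mul_pow]; simp
  have h3 : ∑ j ∈ Finset.Icc (-N:ℤ) N, om P j ^(2*(q+1)) * a j t * (∫ x in (0:ℝ)..P, FF P b ψ w x * ph P j x)
      = - ∫ x in (0:ℝ)..P, iteratedDeriv q (FF P b ψ w) x * iteratedDeriv (q+2) w x := by
    have h4 : ∑ j ∈ Finset.Icc (-N:ℤ) N, (-1)^(q+1) * om P j ^(2*(q+1)) * a j t * (∫ x in (0:ℝ)..P, FF P b ψ w x * ph P j x)
      = (-1)^(q+1) * ∑ j ∈ Finset.Icc (-N:ℤ) N, om P j ^(2*(q+1)) * a j t * (∫ x in (0:ℝ)..P, FF P b ψ w x * ph P j x) := by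
      rw [Finset.mul_sum]; exact Finset.sum_congr rfl fun j _ => by ring
    rw [h4, pow_succ] at h
    have := mul_left_cancel₀ (pow_ne_zero q (by norm_num : (-1:ℝ) ≠ 0)) ((mul_assoc _ _ _).symm.trans h)
    linarith
  rw [Finset.mul_sum]
  calc ∑ j ∈ Finset.Icc (-N:ℤ) N, P * (om P j ^ (2*(q+1)) * (2 * a j t * cf P (FF P b ψ w) j))
      = 2 * ∑ j ∈ Finset.Icc (-N:ℤ) N, om P j ^(2*(q+1)) * a j t * (∫ x in (0:ℝ)..P, FF P b ψ w x * ph P j x) := by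
        rw [Finset.mul_sum]
        refine Finset.sum_congr rfl fun j _ => ?_
        rw [cf]; field_simp
    _ = _ := by rw [h3]; ring

theorem Gal.energy {P : ℝ} (hP : 0 < P) {b ψ : ℝ → ℝ} {c : ℝ} (hC : Coef b ψ c) {A : ℤ → ℝ}
    (hA : ∀ k, ∃ M, ∀ N, X P k (wS P N A) ≤ M) {T : ℝ} (hT : 0 ≤ T) (q : ℕ) :
    ∃ M, 0 ≤ M ∧ ∀ (N : ℕ) a, Gal P b ψ A N a → T ≤ N → ∀ t ∈ Set.Icc 0 T, ∀ i, 1 ≤ i → i ≤ q →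
      X P i (wS P N (fun j => a j t)) ≤ M := by
  induction q with
  | zero => exact ⟨0, le_rfl, fun N a _ _ t _ i h1 h2 => by omega⟩
  | succ q ih =>
    obtain ⟨M, hM0, hM⟩ := ih
    obtain ⟨C, hC0, hk⟩ := key_ineq hP hM0 hC q
    obtain ⟨M0, hM0'⟩ := hA (q+1)
    have hM00 : 0 ≤ M0 := (X_nonneg hP _ _).trans (hM0' 0)
    refine ⟨M + gronwallBound M0 C (C * (q * M)) T, ?_, ?_⟩
    · have := gronwallBound_mono hM00 (by positivity : 0 ≤ C * (q*M)) hC0 hT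
      rw [gronwallBound_x0] at this
      linarith
    intro N a ha hTN
    have hsub : Set.Icc 0 T ⊆ Set.Icc (0:ℝ) N := Set.Icc_subset_Icc_right hTN
    have hg := gron (f := fun t => X P (q+1) (wS P N (fun j => a j t))) (T := T) (δ := M0)
      hC0 (by positivity : 0 ≤ C * (q*M)) hM00
      (fun t ht => (ha.X_deriv hP hC q (hsub ht)).mono hsub)
      (by
        have e : wS P N (fun j => a j 0) = wS P N A := by
          funext x
          exact Finset.sum_congr rfl fun j hj => by simp only [ha.start j hj]
        simp only [e]; exact hM0' N)
      (fun t ht => by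
        refine (hk _ (wS_SP hP N _) (hM N a ha hTN t ht)).trans ?_
        have h1 := X_nonneg hP (q+2) (wS P N (fun j => a j t))
        have h2 : SX P (q+1) (wS P N (fun j => a j t)) ≤ q * M + X P (q+1) (wS P N (fun j => a j t)) := by
          rw [SX, Finset.sum_Icc_succ_top (by omega)]
          gcongr
          refine (Finset.sum_le_card_nsmul _ _ M fun i hi => ?_).trans ?_
          · rw [Finset.mem_Icc] at hi
            exact hM N a ha hTN t ht i hi.1 hi.2
          · simp
        have := mul_nonneg hC.hc.le h1
        have := mul_le_mul_of_nonneg_left h2 hC0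
        linarith)
    intro t ht i h1 h2
    have hgt := hg t ht
    rcases Nat.lt_or_ge q i with h | h
    · obtain rfl : i = q + 1 := by omega
      linarith
    · have := hM N a ha hTN t ht i h1 h
      have := X_nonneg hP (q+1) (wS P N (fun j => a j t))
      linarith

theorem FF_sup {P M B : ℝ} (hP : 0 < P) {b ψ : ℝ → ℝ} {c : ℝ} (hC : Coef b ψ c) (hB : ∀ y, |b y| ≤ B)
    {f : ℝ → ℝ} (hf : SP P f)
    (hX : ∀ i, 1 ≤ i → i ≤ 3 → X P i f ≤ M) (x : ℝ) : |FF P b ψ f x| ≤ B * (2 * (1 + P * M)) := by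
  rw [FF, abs_mul]
  have hM := (X_nonneg hP 1 f).trans (hX 1 le_rfl (by norm_num))
  refine mul_le_mul (hB _) ?_ (abs_nonneg _) ((abs_nonneg _).trans (hB 0))
  have h1 := iter_abs_le hP hf (i := 2) (by norm_num) (hX 3 (by norm_num) le_rfl) x
  have h2 := sq_sub_lam_le hP hC hf x
  have h3 : |f x - Lam P ψ f| ≤ 1 + P * M := by
    have : P * X P 1 f ≤ P * M := by gcongr; exact hX 1 le_rfl (by norm_num)
    have h4 : 0 ≤ P * M := by positivity
    refine abs_le_of_sq_le_sq ?_ (by linarith)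
    nlinarith
  rw [gg]
  refine (abs_add_le _ _).trans ?_
  linarith

theorem Gal.bounds {P : ℝ} (hP : 0 < P) {b ψ : ℝ → ℝ} {c : ℝ} (hC : Coef b ψ c) {A : ℤ → ℝ}
    (hA : ∀ k, ∃ M, ∀ N, X P k (wS P N A) ≤ M) {T : ℝ} (hT : 0 ≤ T) :
    ∃ (C : ℕ → ℝ) (K : ℝ), 0 ≤ K ∧ ∀ (N : ℕ) a, Gal P b ψ A N a → T ≤ N →
      (∀ t ∈ Set.Icc 0 T, RD C (fun j => a j t)) ∧
      (∀ t ∈ Set.Icc 0 T, ∀ x, |FF P b ψ (wS P N (fun j => a j t)) x| ≤ K) ∧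
      (∀ j, ∀ s ∈ Set.Icc 0 T, ∀ t ∈ Set.Icc 0 T, |a j t - a j s| ≤ 2 * K * |t - s|) := by
  choose M hM0 hM using Gal.energy hP hC hA hT
  obtain ⟨B, hB0, hB⟩ := bd_upto hC.b_bd 0
  have hbB : ∀ y, |b y| ≤ B := fun y => by simpa using hB 0 le_rfl y
  set K := B * (2 * (1 + P * M 3)) with hK
  have hK0 : 0 ≤ K := by have := hM0 3; positivity
  refine ⟨fun k => (|A 0| + 2 * K * T) + (P/π)^(k+1) * √(M (k+1) / P), K, hK0,
    fun N a ha hTN => ?_⟩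
  have hsub : Set.Icc 0 T ⊆ Set.Icc (0:ℝ) N := Set.Icc_subset_Icc_right hTN
  have hF : ∀ t ∈ Set.Icc 0 T, ∀ x, |FF P b ψ (wS P N (fun j => a j t)) x| ≤ K := fun t ht x =>
    FF_sup hP hC hbB (wS_SP hP N _) (hM 3 N a ha hTN t ht) x
  have hLip : ∀ j, ∀ s ∈ Set.Icc 0 T, ∀ t ∈ Set.Icc 0 T, |a j t - a j s| ≤ 2 * K * |t - s| := by
    intro j s hs t ht
    by_cases hj : j ∈ Finset.Icc (-N:ℤ) N
    · exact (convex_Icc 0 T).norm_image_sub_le_of_norm_hasDerivWithin_le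
        (fun t ht => (ha.ode j hj t (hsub ht)).mono hsub)
        (fun t ht => cf_bound hP (hF t ht) j) hs ht
    · rw [ha.supp j hj, ha.supp j hj]; simp; positivity
  refine ⟨fun t ht => ?_, hF, hLip⟩
  intro k j
  have hπ := pi_pos
  by_cases hj0 : j = 0
  · subst hj0
    have h1 := hLip 0 0 ⟨le_rfl, hT⟩ t ht
    have h2 : a 0 0 = A 0 := ha.start 0 (by simp)
    rw [h2, sub_zero, abs_of_nonneg ht.1] at h1
    have h3 : |a 0 t| ≤ |A 0| + |a 0 t - A 0| := by
      have := abs_add_le (A 0) (a 0 t - A 0)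
      simpa using this
    have h4 : 2 * K * t ≤ 2 * K * T := by gcongr; exact ht.2
    have h5 : 0 ≤ (P/π)^(k+1) * √(M (k+1) / P) := by positivity
    simp only [Int.cast_zero, abs_zero, add_zero, one_pow, mul_one]
    linarith
  · have h0 : 0 ≤ |A 0| + 2 * K * T := by positivity
    refine le_trans ?_ (le_add_of_nonneg_left h0)
    by_cases hj : j ∈ Finset.Icc (-N:ℤ) N
    · have hX := hM (k+1) N a ha hTN t ht (k+1) (by omega) le_rfl
      rw [X_wS hP] at hX
      have h1 : om P j ^ (2*(k+1)) * a j t ^ 2 ≤ M (k+1) / P := by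
        rw [le_div_iff₀ hP, mul_comm]
        refine le_trans ?_ hX
        gcongr
        exact Finset.single_le_sum (f := fun j => om P j ^ (2*(k+1)) * a j t ^ 2)
          (fun i _ => mul_nonneg (by rw [pow_mul]; positivity) (sq_nonneg _)) hj
      have h2 : |om P j ^ (k+1) * a j t| ≤ √(M (k+1) / P) := by
        refine Real.abs_le_sqrt ?_
        calc _ = om P j ^ (2*(k+1)) * a j t ^ 2 := by ring
          _ ≤ _ := h1
      have h3 : 1 + |(j:ℝ)| ≤ (P/π) * |om P j| := by
        have h4 : (P/π) * |om P j| = 2 * |(j:ℝ)| := by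
          rw [om, abs_mul, abs_of_pos (by positivity : 0 < 2 * π / P)]
          field_simp
        have h5 : (1:ℝ) ≤ |(j:ℝ)| := by
          have := Int.one_le_abs hj0
          exact_mod_cast this
        linarith
      have h6 : (1 + |(j:ℝ)|)^k ≤ (1 + |(j:ℝ)|)^(k+1) :=
        pow_le_pow_right₀ (by linarith [abs_nonneg (j:ℝ)]) (by omega)
      calc |a j t| * (1 + |(j:ℝ)|)^k ≤ |a j t| * (1 + |(j:ℝ)|)^(k+1) := by gcongr
        _ ≤ |a j t| * ((P/π) * |om P j|)^(k+1) := by gcongr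
        _ = (P/π)^(k+1) * |om P j ^(k+1) * a j t| := by
          rw [abs_mul, abs_pow, mul_pow]; ring
        _ ≤ _ := by gcongr
    · simp only [ha.supp j hj, abs_zero, zero_mul]
      positivity

theorem wS_eq_DS {P : ℝ} {N : ℕ} {a : ℤ → ℝ} (h : ∀ j ∉ Finset.Icc (-N:ℤ) N, a j = 0) :
    wS P N a = DS P a 0 := by
  funext x
  rw [wS, DS, tsum_eq_sum fun j hj => by rw [h j hj, zero_mul]]
  rfl

theorem RD.X_wS {P : ℝ} (hP : 0 < P) {C : ℕ → ℝ} {A : ℤ → ℝ} (hA : RD C A) (k : ℕ) :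
    ∃ M, ∀ N, X P k (wS P N A) ≤ M := by
  classical
  set S := ∑' j : ℤ, 2 * (2*π/P)^k * C (k+2) * (1 / (1 + |(j:ℝ)|)^2)
  refine ⟨S^2 * P, fun N => ?_⟩
  let A' : ℤ → ℝ := fun j => if j ∈ Finset.Icc (-N:ℤ) N then A j else 0
  have hC0 : ∀ k, 0 ≤ C k := fun k => le_trans (by positivity) (hA k 0)
  have hA' : RD C A' := by
    intro k j
    by_cases hj : j ∈ Finset.Icc (-N:ℤ) N
    · simp only [A', if_pos hj]; exact hA k j
    · simp only [A', if_neg hj, abs_zero, zero_mul]; exact hC0 k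
  have e : wS P N A = DS P A' 0 := by
    rw [← wS_eq_DS (N := N) (fun j hj => by simp only [A', if_neg hj])]
    funext x
    exact Finset.sum_congr rfl fun j hj => by simp only [A', if_pos hj]
  rw [e, X, hA'.iter hP]
  have hc : Continuous (DS P A' k) := by
    rw [← hA'.iter hP]; exact ((hA'.SP hP).iter k).cont
  have : ∫ x in (0:ℝ)..P, S^2 = S^2 * P := by simp [mul_comm]
  rw [← this]
  refine intervalIntegral.integral_mono_on hP.le ((hc.pow 2).intervalIntegrable _ _) (by simp)
    fun x _ => ?_
  rw [← sq_abs]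
  exact pow_le_pow_left₀ (abs_nonneg _) (hA'.bound hP k x) 2

theorem SP.RD {P : ℝ} (hP : 0 < P) {f : ℝ → ℝ} (hf : SP P f) : ∃ C, RD C (cf P f) := by
  have : ∀ k, ∃ C, ∀ j : ℤ, |cf P f j| * (1 + |(j:ℝ)|)^k ≤ C := by
    intro k
    obtain ⟨K, hK⟩ := SP.le_sup_all hP (hf.iter (2*(k+1))).cont (hf.iter (2*(k+1))).2
    have hπ := pi_pos
    refine ⟨|cf P f 0| + (P/π)^(2*(k+1)) * (2 * K), fun j => ?_⟩
    have hK0 : 0 ≤ K := (abs_nonneg _).trans (hK 0)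
    by_cases hj0 : j = 0
    · subst hj0
      simp only [Int.cast_zero, abs_zero, add_zero, one_pow, mul_one]
      have : 0 ≤ (P/π)^(2*(k+1)) * (2 * K) := by positivity
      linarith
    · refine le_trans ?_ (le_add_of_nonneg_left (abs_nonneg _))
      have h1 := cf_decay hP hf (k+1) j
      have h2 := cf_bound hP hK j
      have h2' : |om P j ^(2*(k+1)) * cf P f j| ≤ 2 * K := by
        rw [h1, abs_mul, abs_pow]; simpa using h2
      have h3 : 1 + |(j:ℝ)| ≤ (P/π) * |om P j| := by
        have h4 : (P/π) * |om P j| = 2 * |(j:ℝ)| := by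
          rw [om, abs_mul, abs_of_pos (by positivity : 0 < 2 * π / P)]
          field_simp
        have h5 : (1:ℝ) ≤ |(j:ℝ)| := by
          have := Int.one_le_abs hj0
          exact_mod_cast this
        linarith
      have h6 : (1 + |(j:ℝ)|)^k ≤ (1 + |(j:ℝ)|)^(2*(k+1)) :=
        pow_le_pow_right₀ (by linarith [abs_nonneg (j:ℝ)]) (by omega)
      calc |cf P f j| * (1 + |(j:ℝ)|)^k ≤ |cf P f j| * (1 + |(j:ℝ)|)^(2*(k+1)) := by gcongr
        _ ≤ |cf P f j| * ((P/π) * |om P j|)^(2*(k+1)) := by gcongr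
        _ = (P/π)^(2*(k+1)) * |om P j ^(2*(k+1)) * cf P f j| := by
          rw [abs_mul, abs_pow, mul_pow]; ring
        _ ≤ _ := by gcongr
  choose C hC using this
  exact ⟨C, hC⟩

end APF

namespace APF

/-- families with all space derivatives of class `C^r` on `S` -/
structure QQ (r : ℕ) (S : Set (ℝ × ℝ)) (g : ℝ → ℝ → ℝ) : Prop where
  smooth : ∀ t, ContDiff ℝ ∞ (g t)
  reg : ∀ k : ℕ, ContDiffOn ℝ r (fun p : ℝ × ℝ => iteratedDeriv k (g p.1) p.2) S

theorem QQ.add {r : ℕ} {S : Set (ℝ × ℝ)} {g h : ℝ → ℝ → ℝ} (hg : QQ r S g) (hh : QQ r S h) :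
    QQ r S (fun t x => g t x + h t x) := by
  refine ⟨fun t => (hg.smooth t).add (hh.smooth t), fun k => ?_⟩
  have e : (fun p : ℝ × ℝ => iteratedDeriv k (fun x => g p.1 x + h p.1 x) p.2)
      = fun p => iteratedDeriv k (g p.1) p.2 + iteratedDeriv k (h p.1) p.2 := by
    funext p
    exact iteratedDeriv_add ((hg.smooth p.1).of_le (by exact_mod_cast le_top)).contDiffAt
      ((hh.smooth p.1).of_le (by exact_mod_cast le_top)).contDiffAt
  rw [e]
  exact (hg.reg k).add (hh.reg k)

theorem QQ.mul_aux {r : ℕ} {S : Set (ℝ × ℝ)} {g h : ℝ → ℝ → ℝ} (sg : ∀ t, ContDiff ℝ ∞ (g t))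
    (sh : ∀ t, ContDiff ℝ ∞ (h t)) (k : ℕ)
    (hg : ∀ i ≤ k, ContDiffOn ℝ r (fun p : ℝ × ℝ => iteratedDeriv i (g p.1) p.2) S)
    (hh : ∀ i ≤ k, ContDiffOn ℝ r (fun p : ℝ × ℝ => iteratedDeriv i (h p.1) p.2) S) :
    ContDiffOn ℝ r (fun p : ℝ × ℝ => iteratedDeriv k (fun x => g p.1 x * h p.1 x) p.2) S := by
  have e : (fun p : ℝ × ℝ => iteratedDeriv k (fun x => g p.1 x * h p.1 x) p.2)
      = fun p => ∑ i ∈ Finset.range (k+1), (k.choose i : ℝ) * iteratedDeriv i (g p.1) p.2 *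
        iteratedDeriv (k - i) (h p.1) p.2 := by
    funext p
    exact iteratedDeriv_mul ((sg p.1).of_le (by exact_mod_cast le_top)).contDiffAt
      ((sh p.1).of_le (by exact_mod_cast le_top)).contDiffAt
  rw [e]
  refine ContDiffOn.sum fun i hi => ?_
  have : i ≤ k := by simp at hi; omega
  exact (contDiffOn_const.mul (hg i this)).mul (hh (k-i) (by omega))

theorem QQ.mul {r : ℕ} {S : Set (ℝ × ℝ)} {g h : ℝ → ℝ → ℝ} (hg : QQ r S g) (hh : QQ r S h) :
    QQ r S (fun t x => g t x * h t x) :=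
  ⟨fun t => (hg.smooth t).mul (hh.smooth t), fun k => QQ.mul_aux hg.smooth hh.smooth k
    (fun i _ => hg.reg i) (fun i _ => hh.reg i)⟩

theorem QQ.const {r : ℕ} {S : Set (ℝ × ℝ)} {l : ℝ → ℝ}
    (hl : ContDiffOn ℝ r (fun p : ℝ × ℝ => l p.1) S) : QQ r S (fun t _ => l t) := by
  refine ⟨fun t => contDiff_const, fun k => ?_⟩
  cases k with
  | zero => simpa using hl
  | succ k =>
    simp only [iteratedDeriv_const, Nat.add_eq_zero_iff, one_ne_zero, and_false, if_false]
    exact contDiffOn_const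

theorem QQ.iter {r : ℕ} {S : Set (ℝ × ℝ)} {g : ℝ → ℝ → ℝ} (hg : QQ r S g) (l : ℕ) :
    QQ r S (fun t x => iteratedDeriv l (g t) x) := by
  refine ⟨fun t => ?_, fun k => ?_⟩
  · have h := ContDiff.iterate_deriv l (hg.smooth t)
    rw [← iteratedDeriv_eq_iterate] at h
    exact h
  · have : ∀ p : ℝ × ℝ, iteratedDeriv k (fun x => iteratedDeriv l (g p.1) x) p.2
        = iteratedDeriv (k+l) (g p.1) p.2 := fun p => congrFun (iter_iter k l (g p.1)) p.2
    simp only [this]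
    exact hg.reg _

theorem QQ.comp {r : ℕ} {S : Set (ℝ × ℝ)} {g : ℝ → ℝ → ℝ} (hg : QQ r S g) {b : ℝ → ℝ}
    (hb : ContDiff ℝ ∞ b) : QQ r S (fun t x => b (g t x)) := by
  refine ⟨fun t => hb.comp (hg.smooth t), fun k => ?_⟩
  induction k using Nat.strong_induction_on generalizing b with
  | _ k ih =>
    cases k with
    | zero =>
      simp only [iteratedDeriv_zero]
      have := hg.reg 0
      simp only [iteratedDeriv_zero] at this
      exact (hb.of_le (by exact_mod_cast le_top)).comp_contDiffOn this
    | succ k =>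
      have hb' : ContDiff ℝ ∞ (deriv b) := (contDiff_infty_iff_deriv.1 hb).2
      have hd := hg.iter 1
      simp only [iteratedDeriv_one] at hd
      have e : ∀ p : ℝ × ℝ, iteratedDeriv (k+1) (fun x => b (g p.1 x)) p.2
          = iteratedDeriv k (fun x => deriv b (g p.1 x) * deriv (g p.1) x) p.2 := by
        intro p
        rw [iteratedDeriv_succ']
        congr 1
        funext x
        exact deriv_comp x (hb.differentiable (by simp) _)
          ((hg.smooth p.1).differentiable (by simp) _)
      simp only [e]
      exact QQ.mul_aux (g := fun t x => deriv b (g t x)) (h := fun t x => deriv (g t) x)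
        (fun t => hb'.comp (hg.smooth t)) hd.smooth k
        (fun i hi => ih i (by omega) hb') (fun i _ => hd.reg i)

theorem QQ.zeroth {r : ℕ} {S : Set (ℝ × ℝ)} {g : ℝ → ℝ → ℝ} (hg : QQ r S g) :
    ContDiffOn ℝ r (fun p : ℝ × ℝ => g p.1 p.2) S := by
  simpa using hg.reg 0

theorem QQ.FF {r : ℕ} {S : Set (ℝ × ℝ)} {u : ℝ → ℝ → ℝ} (hu : QQ r S u) {P : ℝ} {b ψ : ℝ → ℝ}
    (hb : ContDiff ℝ ∞ b) (hL : ContDiffOn ℝ r (fun p : ℝ × ℝ => Lam P ψ (u p.1)) S) :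
    QQ r S (fun t x => FF P b ψ (u t) x) := by
  have h1 := QQ.const (l := fun t => Lam P ψ (u t)) hL
  have h2 := (QQ.const (r := r) (S := S) (l := fun _ => (-1:ℝ)) contDiffOn_const).mul h1
  have := (hu.comp hb).mul ((hu.iter 2).add (hu.add h2))
  refine (funext₂ fun t x => ?_ : (fun t x => b (u t x) * (iteratedDeriv 2 (u t) x + (u t x + -1 * Lam P ψ (u t)))) = fun t x => APF.FF P b ψ (u t) x) ▸ this
  simp only [APF.FF, gg]; ring

theorem Lam_cont {u : ℝ → ℝ → ℝ} (hu : Continuous fun p : ℝ × ℝ => u p.1 p.2) {P : ℝ} (hP : 0 < P)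
    {b ψ : ℝ → ℝ} {c : ℝ} (hC : Coef b ψ c) : Continuous fun t => Lam P ψ (u t) := by
  have hψ : Continuous fun p : ℝ × ℝ => ψ (u p.1 p.2) := hC.ψ_smooth.continuous.comp hu
  have h1 : Continuous fun t => ∫ x in (0:ℝ)..P, ψ (u t x) * u t x :=
    intervalIntegral.continuous_parametric_intervalIntegral_of_continuous'
      (f := fun t x => ψ (u t x) * u t x) (hψ.mul hu) 0 P
  have h2 : Continuous fun t => ∫ x in (0:ℝ)..P, ψ (u t x) :=
    intervalIntegral.continuous_parametric_intervalIntegral_of_continuous'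
      (f := fun t x => ψ (u t x)) hψ 0 P
  refine h1.div h2 fun t => ?_
  have hut : Continuous (u t) := hu.comp (Continuous.prodMk_right t)
  exact ((mul_pos hC.hc hP).trans_le (int_psi_pos hP hC hut)).ne'

theorem QQ.cont0 {u : ℝ → ℝ → ℝ} (hu : QQ 0 Set.univ u) (k : ℕ) :
    Continuous fun p : ℝ × ℝ => iteratedDeriv k (u p.1) p.2 := by
  have := hu.reg k
  rw [contDiffOn_univ] at this
  exact this.continuous

theorem QQ.FF0 {u : ℝ → ℝ → ℝ} (hu : QQ 0 Set.univ u) {P : ℝ} (hP : 0 < P) {b ψ : ℝ → ℝ} {c : ℝ}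
    (hC : Coef b ψ c) : QQ 0 Set.univ (fun t x => APF.FF P b ψ (u t) x) := by
  refine hu.FF hC.b_smooth ?_
  have h := Lam_cont (u := u) (by simpa using hu.cont0 0) hP hC
  rw [contDiffOn_univ]
  exact contDiff_zero.2 (h.comp continuous_fst)

/-- continuity of the coefficient vector field along a continuous curve -/
theorem cf_FF_cont {u : ℝ → ℝ → ℝ} (hu : QQ 0 Set.univ u) {P : ℝ} (hP : 0 < P) {b ψ : ℝ → ℝ} {c : ℝ}
    (hC : Coef b ψ c) (j : ℤ) : Continuous fun t => cf P (FF P b ψ (u t)) j := by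
  have h := (hu.FF0 hP hC).cont0 0
  simp only [iteratedDeriv_zero] at h
  have h1 : Continuous fun t => ∫ x in (0:ℝ)..P, FF P b ψ (u t) x * ph P j x :=
    intervalIntegral.continuous_parametric_intervalIntegral_of_continuous'
      (f := fun t x => FF P b ψ (u t) x * ph P j x)
      (h.mul ((Dph_cont P j 0).comp continuous_snd)) 0 P
  exact h1.const_mul _

/-- convergence of series -/
theorem DS_tendsto {P : ℝ} (hP : 0 < P) {C : ℕ → ℝ} {a : ℕ → ℤ → ℝ} {a' : ℤ → ℝ}
    (ha : ∀ᶠ n in atTop, RD C (a n)) (hl : ∀ j, Tendsto (fun n => a n j) atTop (𝓝 (a' j))) (k : ℕ)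
    (x : ℝ) : Tendsto (fun n => DS P (a n) k x) atTop (𝓝 (DS P a' k x)) := by
  refine tendsto_tsum_of_dominated_convergence (RD.summ P C k) (fun j => (hl j).mul_const _) ?_
  filter_upwards [ha] with n hn j
  exact hn.term hP k j x

theorem RD_lim {C : ℕ → ℝ} {a : ℕ → ℤ → ℝ} {a' : ℤ → ℝ}
    (ha : ∀ᶠ n in atTop, RD C (a n)) (hl : ∀ j, Tendsto (fun n => a n j) atTop (𝓝 (a' j))) :
    RD C a' := by
  intro k j
  refine le_of_tendsto ((hl j).abs.mul_const _) ?_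
  filter_upwards [ha] with n hn
  exact hn k j

theorem cf_FF_tendsto {P : ℝ} (hP : 0 < P) {b ψ : ℝ → ℝ} {c : ℝ} (hC : Coef b ψ c)
    {C : ℕ → ℝ} {a : ℕ → ℤ → ℝ} {a' : ℤ → ℝ} {K : ℝ}
    (ha : ∀ᶠ n in atTop, RD C (a n)) (hl : ∀ j, Tendsto (fun n => a n j) atTop (𝓝 (a' j)))
    (hK : ∀ᶠ n in atTop, ∀ x, |FF P b ψ (DS P (a n) 0) x| ≤ K)
    (j : ℤ) :
    Tendsto (fun n => cf P (FF P b ψ (DS P (a n) 0)) j) atTop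
      (𝓝 (cf P (FF P b ψ (DS P a' 0)) j)) := by
  have ha' := RD_lim ha hl
  have hD := DS_tendsto hP ha hl
  obtain ⟨B, hB0, hB⟩ := bd_upto hC.ψ_bd 0
  have hψB : ∀ y, |ψ y| ≤ B := fun y => by simpa using hB 0 le_rfl y
  set S := ∑' j : ℤ, 2 * (2*π/P)^0 * C (0+2) * (1 / (1 + |(j:ℝ)|)^2)
  have hc : ∀ᶠ n in atTop, Continuous (DS P (a n) 0) := by
    filter_upwards [ha] with n hn
    exact (hn.SP hP).cont
  have h1 : Tendsto (fun n => ∫ x in (0:ℝ)..P, ψ (DS P (a n) 0 x)) atTop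
      (𝓝 (∫ x in (0:ℝ)..P, ψ (DS P a' 0 x))) := by
    refine intervalIntegral.tendsto_integral_filter_of_dominated_convergence (fun _ => B) ?_ ?_
      (by simp) (ae_of_all _ fun x _ => (hC.ψ_smooth.continuous.tendsto _).comp (hD 0 x))
    · filter_upwards [hc] with n hn
      exact (hC.ψ_smooth.continuous.comp hn).aestronglyMeasurable
    · exact Eventually.of_forall fun n => ae_of_all _ fun x _ => hψB _
  have h2 : Tendsto (fun n => ∫ x in (0:ℝ)..P, ψ (DS P (a n) 0 x) * DS P (a n) 0 x) atTop
      (𝓝 (∫ x in (0:ℝ)..P, ψ (DS P a' 0 x) * DS P a' 0 x)) := by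
    refine intervalIntegral.tendsto_integral_filter_of_dominated_convergence (fun _ => B * S) ?_ ?_
      (by simp) (ae_of_all _ fun x _ =>
        ((hC.ψ_smooth.continuous.tendsto _).comp (hD 0 x)).mul (hD 0 x))
    · filter_upwards [hc] with n hn
      exact ((hC.ψ_smooth.continuous.comp hn).mul hn).aestronglyMeasurable
    · filter_upwards [ha] with n hn
      refine ae_of_all _ fun x _ => ?_
      rw [norm_mul]
      exact mul_le_mul (hψB _) (hn.bound hP 0 x) (norm_nonneg _) hB0
  have hL : Tendsto (fun n => Lam P ψ (DS P (a n) 0)) atTop (𝓝 (Lam P ψ (DS P a' 0))) :=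
    h2.div h1 ((mul_pos hC.hc hP).trans_le (int_psi_pos hP hC (ha'.SP hP).cont)).ne'
  have hF : ∀ x, Tendsto (fun n => FF P b ψ (DS P (a n) 0) x) atTop (𝓝 (FF P b ψ (DS P a' 0) x)) := by
    intro x
    have h3 : Tendsto (fun n => iteratedDeriv 2 (DS P (a n) 0) x) atTop
        (𝓝 (iteratedDeriv 2 (DS P a' 0) x)) := by
      rw [ha'.iter hP]
      refine (hD 2 x).congr' ?_
      filter_upwards [ha] with n hn
      rw [hn.iter hP]
    exact ((hC.b_smooth.continuous.tendsto _).comp (hD 0 x)).mul (h3.add ((hD 0 x).sub hL))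
  refine Tendsto.const_mul _ ?_
  refine intervalIntegral.tendsto_integral_filter_of_dominated_convergence (fun _ => K * 2) ?_ ?_
      (by simp) (ae_of_all _ fun x _ => (hF x).mul_const _)
  · filter_upwards [ha] with n hn
    exact ((FF_SP hC.b_smooth (hn.SP hP)).cont.mul (Dph_cont P j 0)).aestronglyMeasurable
  · filter_upwards [hK] with n hn
    refine ae_of_all _ fun x _ => ?_
    rw [norm_mul]
    exact mul_le_mul (hn x) (ph_bound P j x) (norm_nonneg _) ((abs_nonneg _).trans (hn x))

end APF

namespace APF

theorem extract {a : ℕ → ℤ → ℝ → ℝ} (hb : ∀ T : ℝ, 0 ≤ T → ∃ B K : ℝ, 0 ≤ B ∧ 0 ≤ K ∧ ∀ N : ℕ, T ≤ N → ∀ j,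
      (∀ t ∈ Set.Icc 0 T, |a N j t| ≤ B) ∧
      (∀ s ∈ Set.Icc 0 T, ∀ t ∈ Set.Icc 0 T, |a N j t - a N j s| ≤ K * |t - s|)) :
    ∃ φ : ℕ → ℕ, StrictMono φ ∧ ∀ j t, 0 ≤ t → ∃ l, Tendsto (fun n => a (φ n) j t) atTop (𝓝 l) := by
  classical
  choose! B K hB0 hK0 hBK using hb
  let y : ℕ → (ℤ × ℚ) → ℝ := fun N p => if |(p.2:ℝ)| ≤ N then a N p.1 |(p.2:ℝ)| else 0
  have hcomp : IsCompact (Set.pi Set.univ fun p : ℤ × ℚ => Set.Icc (-B |(p.2:ℝ)|) (B |(p.2:ℝ)|)) :=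
    isCompact_univ_pi fun p => isCompact_Icc
  have hy : ∀ N, y N ∈ Set.pi Set.univ fun p : ℤ × ℚ => Set.Icc (-B |(p.2:ℝ)|) (B |(p.2:ℝ)|) := by
    intro N p _
    have h0 := hB0 _ (abs_nonneg (p.2:ℝ))
    simp only [y]
    split_ifs with h
    · exact abs_le.1 ((hBK _ (abs_nonneg _) N h p.1).1 _ ⟨abs_nonneg _, le_rfl⟩)
    · exact ⟨by linarith, h0⟩
  obtain ⟨z, -, φ, hφ, hz⟩ := hcomp.tendsto_subseq hy
  refine ⟨φ, hφ, fun j t ht => ?_⟩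
  have hq : ∀ q : ℚ, 0 ≤ q → Tendsto (fun n => a (φ n) j q) atTop (𝓝 (z (j, q))) := by
    intro q hq
    have h1 := (tendsto_pi_nhds.1 hz) (j, q)
    refine h1.congr' ?_
    have h2 : ∀ᶠ n in atTop, (q:ℝ) ≤ (φ n : ℝ) := by
      have := (tendsto_natCast_atTop_atTop (R := ℝ)).comp hφ.tendsto_atTop
      exact this.eventually_ge_atTop _
    filter_upwards [h2] with n hn
    have hq' : (0:ℝ) ≤ q := by exact_mod_cast hq
    simp only [y, Function.comp, abs_of_nonneg hq', if_pos hn]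
  refine cauchySeq_tendsto_of_complete ?_
  rw [Metric.cauchySeq_iff']
  intro ε hε
  set T := t + 1
  have hT : 0 ≤ T := by positivity
  have hK := hK0 T hT
  obtain ⟨q, hq1, hq2⟩ := exists_rat_btwn (show t < t + min 1 (ε / (4 * (K T + 1))) by
    have : 0 < min 1 (ε / (4 * (K T + 1))) := by positivity
    linarith)
  have hq0 : 0 ≤ q := by exact_mod_cast (ht.trans hq1.le)
  have hcau := (hq q hq0).cauchySeq
  rw [Metric.cauchySeq_iff'] at hcau
  obtain ⟨N1, hN1⟩ := hcau (ε/4) (by positivity)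
  have h2 : ∀ᶠ n in atTop, T ≤ (φ n : ℝ) := by
    have := (tendsto_natCast_atTop_atTop (R := ℝ)).comp hφ.tendsto_atTop
    exact this.eventually_ge_atTop _
  obtain ⟨N2, hN2⟩ := eventually_atTop.1 h2
  have hqT : (q:ℝ) ≤ T := by
    have := min_le_left 1 (ε / (4 * (K T + 1))); simp only [T]; linarith
  have hqt : |(q:ℝ) - t| ≤ ε / (4 * (K T + 1)) := by
    have := min_le_right 1 (ε / (4 * (K T + 1)))
    rw [abs_of_pos (by linarith)]; linarith
  have hKe : K T * |(q:ℝ) - t| ≤ ε/4 := by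
    calc K T * |(q:ℝ) - t| ≤ (K T + 1) * (ε / (4 * (K T + 1))) := by gcongr; linarith
      _ = ε/4 := by field_simp
  have hclose : ∀ n ≥ N2, |a (φ n) j q - a (φ n) j t| ≤ ε/4 := fun n hn =>
    ((hBK T hT _ (hN2 n hn) j).2 t ⟨ht, by simp only [T]; linarith⟩ q ⟨by exact_mod_cast hq0, hqT⟩).trans hKe
  refine ⟨max N1 N2, fun n hn => ?_⟩
  have e1 := hN1 n (le_of_max_le_left hn)
  have e2 := hN1 (max N1 N2) (le_max_left _ _)
  have e3 := abs_le.1 (hclose n (le_of_max_le_right hn))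
  have e4 := abs_le.1 (hclose (max N1 N2) (le_max_right _ _))
  rw [Real.dist_eq, abs_lt] at e1 e2
  rw [Real.dist_eq, abs_lt]
  constructor <;> linarith [e1.1, e1.2, e2.1, e2.2, e3.1, e3.2, e4.1, e4.2]

theorem DS_QQ {P : ℝ} (hP : 0 < P) {a : ℤ → ℝ → ℝ} (hc : ∀ j, Continuous (a j))
    (hR : ∀ T : ℝ, ∃ C, ∀ t, |t| ≤ T → RD C (fun j => a j t)) :
    QQ 0 Set.univ (fun t x => DS P (fun j => a j t) 0 x) := by
  have hR' : ∀ t, ∃ C, RD C (fun j => a j t) := fun t => by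
    obtain ⟨C, h⟩ := hR |t|; exact ⟨C, h t le_rfl⟩
  refine ⟨fun t => ?_, fun k => ?_⟩
  · obtain ⟨C, h⟩ := hR' t
    exact (h.SP hP).1
  · have e : (fun p : ℝ × ℝ => iteratedDeriv k (fun x => DS P (fun j => a j p.1) 0 x) p.2)
        = fun p => DS P (fun j => a j p.1) k p.2 := by
      funext p
      obtain ⟨C, h⟩ := hR' p.1
      exact congrFun (h.iter hP k) p.2
    rw [e, contDiffOn_univ]
    refine contDiff_zero.2 (continuous_iff_continuousAt.2 fun p => ?_)
    obtain ⟨C, h⟩ := hR (|p.1| + 1)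
    have hcon : ContinuousOn (fun p : ℝ × ℝ => DS P (fun j => a j p.1) k p.2)
        {p' : ℝ × ℝ | |p'.1| < |p.1| + 1} := by
      refine continuousOn_tsum (f := fun (j:ℤ) (p : ℝ × ℝ) => a j p.1 * Dph P j k p.2) (fun j => ?_)
        (RD.summ P C k) (fun j p' hp' => (h p'.1 (le_of_lt hp')).term hP k j p'.2)
      exact (((hc j).comp continuous_fst).mul ((Dph_cont P j k).comp continuous_snd)).continuousOn
    refine hcon.continuousAt (IsOpen.mem_nhds ?_ ?_)
    · exact isOpen_lt (continuous_fst.abs) continuous_const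
    · simp

/-- Galerkin solutions satisfy the integral equation -/
theorem Gal.int_eq {P : ℝ} (hP : 0 < P) {b ψ : ℝ → ℝ} {c : ℝ} (hC : Coef b ψ c) {A : ℤ → ℝ}
    (hA : ∀ k, ∃ M, ∀ N, X P k (wS P N A) ≤ M) {N : ℕ} {a : ℤ → ℝ → ℝ} (ha : Gal P b ψ A N a)
    {j : ℤ} (hj : j ∈ Finset.Icc (-N:ℤ) N) {t : ℝ} (ht : t ∈ Set.Icc (0:ℝ) N) :
    ContinuousOn (fun s => cf P (FF P b ψ (wS P N (fun j => a j s))) j) (Set.Icc 0 N) ∧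
    a j t = A j + ∫ s in (0:ℝ)..t, cf P (FF P b ψ (wS P N (fun j => a j s))) j := by
  have hN : (0:ℝ) ≤ N := Nat.cast_nonneg N
  obtain ⟨C, K, hK, hb⟩ := Gal.bounds hP hC hA hN
  obtain ⟨h1, h2, h3⟩ := hb N a ha le_rfl
  let a' : ℤ → ℝ → ℝ := fun j s => a j (Set.projIcc (0:ℝ) N hN s)
  have hacont : ∀ j, ContinuousOn (a j) (Set.Icc 0 N) := by
    intro i
    by_cases hi : i ∈ Finset.Icc (-N:ℤ) N
    · exact fun s hs => (ha.ode i hi s hs).continuousWithinAt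
    · refine continuousOn_const (c := (0:ℝ)) |>.congr fun s _ => ha.supp i hi s
  have hcont : ∀ j, Continuous (a' j) := fun j =>
    (hacont j).comp_continuous (continuous_subtype_val.comp continuous_projIcc) fun s => (Set.projIcc (0:ℝ) N hN s).2
  have hQ := DS_QQ hP hcont fun T => ⟨C, fun t _ => h1 _ (Set.projIcc (0:ℝ) N hN t).2⟩
  have hcf := cf_FF_cont hQ hP hC j
  have hcc : ContinuousOn (fun s => cf P (FF P b ψ (wS P N (fun j => a j s))) j) (Set.Icc 0 N) := by
    refine hcf.continuousOn.congr fun s hs => ?_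
    have : (fun j => a' j s) = fun j => a j s := by
      funext i; simp only [a']; rw [Set.projIcc_of_mem hN hs]
    simp only [this]
    rw [wS_eq_DS fun i hi => ha.supp i hi s]
  refine ⟨hcc, ?_⟩
  have hsub : Set.Icc 0 t ⊆ Set.Icc (0:ℝ) N := Set.Icc_subset_Icc_right ht.2
  have := intervalIntegral.integral_eq_sub_of_hasDerivAt_of_le ht.1 ((hacont j).mono hsub)
    (f' := fun s => cf P (FF P b ψ (wS P N (fun j => a j s))) j)
    (fun s hs => (ha.ode j hj s (hsub (Set.Ioo_subset_Icc_self hs))).hasDerivAt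
      (Icc_mem_nhds hs.1 (hs.2.trans_le ht.2)))
    ((hcc.mono (by rw [Set.uIcc_of_le ht.1]; exact hsub)).intervalIntegrable)
  rw [this, ha.start j hj]; ring

theorem limit_coeffs {P : ℝ} (hP : 0 < P) {b ψ : ℝ → ℝ} {c : ℝ} (hC : Coef b ψ c) {A : ℤ → ℝ}
    (hA : ∀ k, ∃ M, ∀ N, X P k (wS P N A) ≤ M) :
    ∃ a : ℤ → ℝ → ℝ, (∀ j, Continuous (a j)) ∧
      (∀ T : ℝ, ∃ C, ∀ t, |t| ≤ T → RD C (fun j => a j t)) ∧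
      ∀ j, ∀ t, 0 ≤ t →
        a j t = A j + ∫ s in (0:ℝ)..t, cf P (FF P b ψ (DS P (fun j => a j s) 0)) j := by
  have hG : ∀ N : ℕ, ∃ a, Gal P b ψ A N a := fun N => by
    obtain ⟨a, h1, h2, h3⟩ := galerkin_exists hP hC A N (Nat.cast_nonneg (α := ℝ) N)
    exact ⟨a, h1, h2, h3⟩
  choose aN hN using hG
  choose! C K hK0 hbd using fun (T:ℝ) (hT : 0 ≤ T) => Gal.bounds hP hC hA hT
  obtain ⟨φ, hφ, hlim⟩ := extract (a := aN) (fun T hT => by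
    refine ⟨|C T 0|, 2 * K T, abs_nonneg _, by have := hK0 T hT; positivity, fun N hTN j => ?_⟩
    obtain ⟨h1, h2, h3⟩ := hbd T hT N _ (hN N) hTN
    refine ⟨fun t ht => ?_, h3 j⟩
    have := h1 t ht 0 j
    simp only [pow_zero, mul_one] at this
    exact this.trans (le_abs_self _))
  choose! l hl using hlim
  have hev : ∀ T : ℝ, ∀ᶠ n in atTop, T ≤ (φ n : ℝ) := fun T => by
    have := (tendsto_natCast_atTop_atTop (R := ℝ)).comp hφ.tendsto_atTop
    exact this.eventually_ge_atTop _
  have hjev : ∀ j : ℤ, ∀ᶠ n in atTop, j ∈ Finset.Icc (-(φ n):ℤ) (φ n) := fun j => by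
    filter_upwards [hev (|j| : ℤ)] with n hn
    have : |j| ≤ (φ n : ℤ) := by exact_mod_cast hn
    rw [Finset.mem_Icc]; exact abs_le.1 this
  have hRDev : ∀ T, 0 ≤ T → ∀ t ∈ Set.Icc 0 T, ∀ᶠ n in atTop, RD (C T) (fun j => aN (φ n) j t) := by
    intro T hT t ht
    filter_upwards [hev T] with n hn
    exact (hbd T hT _ _ (hN _) hn).1 t ht
  have hlip : ∀ T, 0 ≤ T → ∀ j, ∀ s ∈ Set.Icc 0 T, ∀ t ∈ Set.Icc 0 T, |l j t - l j s| ≤ 2 * K T * |t - s| := by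
    intro T hT j s hs t ht
    refine le_of_tendsto ((hl j t ht.1).sub (hl j s hs.1)).abs ?_
    filter_upwards [hev T] with n hn
    exact (hbd T hT _ _ (hN _) hn).2.2 j s hs t ht
  have hlcont : ∀ j, ContinuousOn (l j) (Set.Ici 0) := by
    intro j t ht
    have ht' : (0:ℝ) ≤ t := ht
    have hT : 0 ≤ t + 1 := by linarith
    have hco : ContinuousOn (l j) (Set.Icc 0 (t+1)) := by
      refine LipschitzOnWith.continuousOn (K := (2 * K (t+1)).toNNReal) ?_
      refine LipschitzOnWith.of_dist_le_mul fun x hx y hy => ?_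
      rw [Real.dist_eq, Real.dist_eq, Real.coe_toNNReal _ (by have := hK0 _ hT; positivity)]
      exact hlip _ hT j y hy x hx
    have := hco t ⟨ht', by linarith⟩
    refine this.mono_of_mem_nhdsWithin ?_
    rw [mem_nhdsWithin]
    exact ⟨Set.Iio (t+1), isOpen_Iio, by simp, fun x hx => ⟨hx.2, le_of_lt hx.1⟩⟩
  refine ⟨fun j t => l j (max t 0), fun j => (hlcont j).comp_continuous (by fun_prop) (fun t => Set.mem_Ici.2 (le_max_right _ _)), ?_, ?_⟩
  · intro T
    refine ⟨C (max T 0), fun t ht => ?_⟩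
    have h0 : (0:ℝ) ≤ max T 0 := le_max_right _ _
    have : max t 0 ∈ Set.Icc 0 (max T 0) := ⟨le_max_right _ _, max_le_max ((le_abs_self t).trans ht) le_rfl⟩
    exact RD_lim (hRDev _ h0 _ this) fun j => hl j _ this.1
  · intro j t ht
    beta_reduce
    rw [max_eq_left ht]
    have h1 : Tendsto (fun n => A j + ∫ s in (0:ℝ)..t, cf P (FF P b ψ (wS P (φ n) (fun j => aN (φ n) j s))) j)
        atTop (𝓝 (A j + ∫ s in (0:ℝ)..t, cf P (FF P b ψ (DS P (fun j => l j (max s 0)) 0)) j)) := by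
      refine tendsto_const_nhds.add ?_
      refine intervalIntegral.tendsto_integral_filter_of_dominated_convergence (fun _ => 2 * K t) ?_ ?_
        (by simp) ?_
      · filter_upwards [hev t, hjev j] with n hn hj
        have hc := (Gal.int_eq hP hC hA (hN (φ n)) hj (t := 0) ⟨le_rfl, Nat.cast_nonneg _⟩).1
        rw [Set.uIoc_of_le ht]
        refine (hc.mono ?_).aestronglyMeasurable measurableSet_Ioc
        exact fun s hs => ⟨hs.1.le, hs.2.trans hn⟩
      · filter_upwards [hev t] with n hn
        refine ae_of_all _ fun s hs => ?_
        rw [Set.uIoc_of_le ht] at hs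
        exact cf_bound hP ((hbd t ht _ _ (hN _) hn).2.1 s ⟨hs.1.le, hs.2⟩) j
      · refine ae_of_all _ fun s hs => ?_
        rw [Set.uIoc_of_le ht] at hs
        have hs' : s ∈ Set.Icc 0 t := ⟨hs.1.le, hs.2⟩
        rw [max_eq_left hs'.1]
        have e : ∀ n, wS P (φ n) (fun j => aN (φ n) j s) = DS P (fun j => aN (φ n) j s) 0 :=
          fun n => wS_eq_DS fun i hi => (hN (φ n)).supp i hi s
        simp only [e]
        refine cf_FF_tendsto hP hC (hRDev t ht s hs') (fun j => hl j s hs'.1) (K := K t) ?_ j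
        filter_upwards [hev t] with n hn
        rw [← e n]
        exact (hbd t ht _ _ (hN _) hn).2.1 s hs'
    refine tendsto_nhds_unique (hl j t ht) (h1.congr' ?_)
    filter_upwards [hev t, hjev j] with n hn hj
    exact (Gal.int_eq hP hC hA (hN (φ n)) hj ⟨ht, hn⟩).2.symm

end APF

namespace APF

theorem diff_under {F F' : ℝ → ℝ → ℝ} (hF : Continuous fun p : ℝ × ℝ => F p.1 p.2)
    (hF' : Continuous fun p : ℝ × ℝ => F' p.1 p.2)
    (hd : ∀ x s, HasDerivAt (fun x => F x s) (F' x s) x) (c d x : ℝ) :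
    HasDerivAt (fun x => ∫ s in c..d, F x s) (∫ s in c..d, F' x s) x := by
  obtain ⟨B, hB⟩ := ((isCompact_Icc (a := x-1) (b := x+1)).prod
    (isCompact_uIcc (a := c) (b := d))).exists_bound_of_continuousOn hF'.continuousOn
  have hFx : ∀ x, Continuous (F x) := fun x => hF.comp (Continuous.prodMk_right x)
  have hFx' : ∀ x, Continuous (F' x) := fun x => hF'.comp (Continuous.prodMk_right x)
  refine (intervalIntegral.hasDerivAt_integral_of_dominated_loc_of_deriv_le (F := F) (F' := F')
    (bound := fun _ => B) (Icc_mem_nhds (by linarith : x - 1 < x) (by linarith : x < x + 1))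
    (Eventually.of_forall fun y => (hFx y).aestronglyMeasurable) ((hFx x).intervalIntegrable _ _)
    (hFx' x).aestronglyMeasurable (ae_of_all _ fun s hs y hy => ?_) (by simp)
    (ae_of_all _ fun s _ y _ => hd y s)).2
  exact hB (y, s) ⟨hy, Set.uIoc_subset_uIcc hs⟩

theorem QQ.hasDerivAt {r : ℕ} {S : Set (ℝ × ℝ)} {g : ℝ → ℝ → ℝ} (hg : QQ r S g) (t : ℝ) (k : ℕ)
    (x : ℝ) : HasDerivAt (iteratedDeriv k (g t)) (iteratedDeriv (k+1) (g t) x) x := by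
  have h : DifferentiableAt ℝ (iteratedDeriv k (g t)) x :=
    (((hg.iter k).smooth t).differentiable (by simp)) x
  rw [iteratedDeriv_succ]; exact h.hasDerivAt

theorem QQ.int_tower {g : ℝ → ℝ → ℝ} (hg : QQ 0 Set.univ g) (c d : ℝ) (k : ℕ) (x : ℝ) :
    HasDerivAt (fun x => ∫ s in c..d, iteratedDeriv k (g s) x)
      (∫ s in c..d, iteratedDeriv (k+1) (g s) x) x :=
  diff_under (F := fun x s => iteratedDeriv k (g s) x) (F' := fun x s => iteratedDeriv (k+1) (g s) x)
    ((hg.cont0 k).comp continuous_swap) ((hg.cont0 (k+1)).comp continuous_swap)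
    (fun x s => hg.hasDerivAt s k x) c d x

theorem swap_int {F : ℝ → ℝ → ℝ} (hF : Continuous fun p : ℝ × ℝ => F p.1 p.2) (a b c d : ℝ) :
    ∫ x in a..b, ∫ y in c..d, F x y = ∫ y in c..d, ∫ x in a..b, F x y := by
  refine intervalIntegral_intervalIntegral_swap ?_
  have h : IntegrableOn (fun p : ℝ × ℝ => F p.1 p.2) (Set.uIcc a b ×ˢ Set.uIcc c d) (volume.prod volume) :=
    hF.continuousOn.integrableOn_compact (isCompact_uIcc.prod isCompact_uIcc)
  have h2 := h.mono_set (Set.prod_mono (Set.uIoc_subset_uIcc (a := a) (b := b)) (Set.uIoc_subset_uIcc (a := c) (b := d)))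
  exact h2

/-- existence for the regularised equation -/
theorem sol_exists {P : ℝ} (hP : 0 < P) {b ψ : ℝ → ℝ} {c : ℝ} (hC : Coef b ψ c) {w0 : ℝ → ℝ}
    (h0 : SP P w0) : ∃ u : ℝ → ℝ → ℝ, QQ 0 Set.univ u ∧ (∀ t, SP P (u t)) ∧ u 0 = w0 ∧
      ∀ k x t, 0 ≤ t → HasDerivWithinAt (fun t => iteratedDeriv k (u t) x)
        (iteratedDeriv k (FF P b ψ (u t)) x) (Set.Ici 0) t := by
  obtain ⟨C0, hC0⟩ := h0.RD hP
  obtain ⟨a, ha, hR, hintg⟩ := limit_coeffs hP hC (A := cf P w0) (fun k => hC0.X_wS hP k)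
  set u : ℝ → ℝ → ℝ := fun t x => DS P (fun j => a j t) 0 x with hu
  have hQ : QQ 0 Set.univ u := DS_QQ hP ha hR
  have hR' : ∀ t, ∃ C, RD C (fun j => a j t) := fun t => by
    obtain ⟨C, h⟩ := hR |t|; exact ⟨C, h t le_rfl⟩
  have hS : ∀ t, SP P (u t) := fun t => by
    obtain ⟨C, h⟩ := hR' t
    exact h.SP hP
  have hcf : ∀ t j, cf P (u t) j = a j t := fun t j => by
    obtain ⟨C, h⟩ := hR' t
    exact h.cf hP j
  have hFQ := hQ.FF0 hP hC
  have hFc := hFQ.cont0 0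
  simp only [iteratedDeriv_zero] at hFc
  set G : ℝ → ℝ → ℝ := fun t x => ∫ s in (0:ℝ)..t, FF P b ψ (u s) x with hG
  have hGc : ∀ t, Continuous (G t) := fun t => by
    have := hFQ.int_tower 0 t 0
    simp only [iteratedDeriv_zero] at this
    exact continuous_iff_continuousAt.2 fun x => (this x).continuousAt
  have hGp : ∀ t, Function.Periodic (G t) P := fun t x => by
    simp only [hG]
    congr 1; funext s
    exact (FF_SP hC.b_smooth (hS s)).2 x
  have key : ∀ t, 0 ≤ t → u t = fun x => w0 x + G t x := by
    intro t ht
    refine eq_of_cf hP (hS t).cont (h0.cont.add (hGc t)) (hS t).2 (fun x => by simp [h0.2 x, hGp t x]) fun j => ?_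
    rw [hcf, hintg j t ht]
    have e1 : cf P (fun x => w0 x + G t x) j = cf P w0 j + cf P (G t) j := by
      simp only [cf, add_mul]
      have i1 : IntervalIntegrable (fun x => w0 x * ph P j x) volume 0 P :=
        (h0.cont.mul (Dph_cont P j 0)).intervalIntegrable _ _
      have i2 : IntervalIntegrable (fun x => G t x * ph P j x) volume 0 P :=
        ((hGc t).mul (Dph_cont P j 0)).intervalIntegrable _ _
      rw [intervalIntegral.integral_add i1 i2, mul_add]
    rw [e1]
    congr 1
    simp only [cf, hG, intervalIntegral.integral_const_mul, ← intervalIntegral.integral_mul_const]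
    congr 1
    exact (swap_int (F := fun x s => FF P b ψ (u s) x * ph P j x)
      ((hFc.comp continuous_swap).mul ((Dph_cont P j 0).comp continuous_fst)) 0 P 0 t).symm
  have key2 : ∀ k t x, 0 ≤ t → iteratedDeriv k (u t) x =
      iteratedDeriv k w0 x + ∫ s in (0:ℝ)..t, iteratedDeriv k (FF P b ψ (u s)) x := by
    intro k t x ht
    rw [key t ht]
    have ht1 := tower_iter (D := fun k x => ∫ s in (0:ℝ)..t, iteratedDeriv k (fun x => FF P b ψ (u s) x) x)
      (fun k x => hFQ.int_tower 0 t k x) k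
    have ht2 := tower_contDiff (D := fun k x => ∫ s in (0:ℝ)..t, iteratedDeriv k (fun x => FF P b ψ (u s) x) x)
      (fun k x => hFQ.int_tower 0 t k x)
    simp only [iteratedDeriv_zero] at ht1 ht2
    have := iteratedDeriv_add (n := k) (x := x) (f := w0) (g := G t)
      ((h0.1).of_le (by exact_mod_cast le_top)).contDiffAt (ht2.of_le (by exact_mod_cast le_top)).contDiffAt
    rw [show (fun x => w0 x + G t x) = w0 + G t from rfl, this]
    congr 1
    exact congrFun ht1 x
  refine ⟨u, hQ, hS, ?_, fun k x t ht => ?_⟩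
  · rw [key 0 le_rfl]; funext x; simp [hG]
  · have hc : Continuous fun s => iteratedDeriv k (FF P b ψ (u s)) x :=
      (hFQ.cont0 k).comp (Continuous.prodMk_left x)
    have h1 := (hc.integral_hasStrictDerivAt 0 t).hasDerivAt.const_add (iteratedDeriv k w0 x)
    exact h1.hasDerivWithinAt.congr (fun s hs => key2 k s x hs) (key2 k t x ht)

end APF

namespace APF

/-- the closed half plane of nonnegative times -/
def HP : Set (ℝ × ℝ) := Set.Ici 0 ×ˢ Set.univ

theorem HP_unique : UniqueDiffOn ℝ HP := (uniqueDiffOn_Ici 0).prod uniqueDiffOn_univ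

theorem mem_HP {t x : ℝ} (ht : 0 ≤ t) : (t, x) ∈ HP := ⟨ht, trivial⟩

theorem joint_fderiv {f ft fx : ℝ × ℝ → ℝ} (ct : ContinuousOn ft HP)
    (h1 : ∀ t x, 0 ≤ t → HasDerivWithinAt (fun s => f (s, x)) (ft (t, x)) (Set.Ici 0) t)
    (h2 : ∀ t x, 0 ≤ t → HasDerivAt (fun y => f (t, y)) (fx (t, x)) x) {p : ℝ × ℝ} (hp : p ∈ HP) :
    HasFDerivWithinAt f (ft p • ContinuousLinearMap.fst ℝ ℝ ℝ + fx p • ContinuousLinearMap.snd ℝ ℝ ℝ) HP p := by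
  obtain ⟨t, x⟩ := p
  have ht : 0 ≤ t := hp.1
  rw [hasFDerivWithinAt_iff_isLittleO, Asymptotics.isLittleO_iff]
  intro ε hε
  have hc := Metric.continuousWithinAt_iff.1 (ct _ hp) (ε/2) (by positivity)
  obtain ⟨δ, hδ, hc⟩ := hc
  have hx := (hasDerivAt_iff_isLittleO.1 (h2 t x ht))
  rw [Asymptotics.isLittleO_iff] at hx
  have hx := hx (c := ε/2) (by positivity)
  rw [Metric.eventually_nhds_iff] at hx
  obtain ⟨δ', hδ', hx⟩ := hx
  rw [eventually_nhdsWithin_iff, Metric.eventually_nhds_iff]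
  refine ⟨min δ δ', by positivity, fun q hq hqS => ?_⟩
  obtain ⟨s, y⟩ := q
  have hs : 0 ≤ s := hqS.1
  rw [Prod.dist_eq, max_lt_iff] at hq
  simp only at hq
  have hx := hx (hq.2.trans_le (min_le_right _ _))
  have hconv : Convex ℝ (Set.Ici (0:ℝ) ∩ Metric.ball t δ) := (convex_Ici 0).inter (convex_ball t δ)
  have hm := hconv.norm_image_sub_le_of_norm_hasDerivWithin_le (𝕜 := ℝ)
    (f := fun σ => f (σ, y) - ft (t, x) * σ) (f' := fun σ => ft (σ, y) - ft (t, x)) (C := ε/2) (x := t) (y := s)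
    (fun σ hσ => by
      have := (h1 σ y hσ.1).sub ((hasDerivWithinAt_id σ (Set.Ici 0)).const_mul (ft (t,x)))
      simp only [mul_one] at this
      exact this.mono Set.inter_subset_left)
    (fun σ hσ => by
      have := hc (x := (σ, y)) ⟨hσ.1, trivial⟩ (by
        rw [Prod.dist_eq, max_lt_iff]
        exact ⟨hσ.2, hq.2.trans_le (min_le_left _ _)⟩)
      exact this.le) ⟨ht, Metric.mem_ball_self hδ⟩ ⟨hs, hq.1.trans_le (min_le_left _ _)⟩
  simp only [Real.norm_eq_abs, smul_eq_mul] at hm hx ⊢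
  have n1 : |s - t| ≤ ‖((s, y) : ℝ × ℝ) - (t, x)‖ := by
    have := norm_fst_le (((s, y) : ℝ × ℝ) - (t, x)); simpa using this
  have n2 : |y - x| ≤ ‖((s, y) : ℝ × ℝ) - (t, x)‖ := by
    have := norm_snd_le (((s, y) : ℝ × ℝ) - (t, x)); simpa using this
  have e : f (s, y) - f (t, x) - (ft (t, x) • ContinuousLinearMap.fst ℝ ℝ ℝ + fx (t, x) • ContinuousLinearMap.snd ℝ ℝ ℝ) ((s, y) - (t, x))
      = (f (s, y) - ft (t, x) * s - (f (t, y) - ft (t, x) * t)) + (f (t, y) - f (t, x) - (y - x) * fx (t, x)) := by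
    simp; ring
  rw [e]
  refine (abs_add_le _ _).trans ?_
  nlinarith [hm, hx]

theorem joint_succ {r : ℕ} {f ft fx : ℝ × ℝ → ℝ} (ct : ContDiffOn ℝ r ft HP) (cx : ContDiffOn ℝ r fx HP)
    (h1 : ∀ t x, 0 ≤ t → HasDerivWithinAt (fun s => f (s, x)) (ft (t, x)) (Set.Ici 0) t)
    (h2 : ∀ t x, 0 ≤ t → HasDerivAt (fun y => f (t, y)) (fx (t, x)) x) :
    ContDiffOn ℝ (r+1 : ℕ) f HP := by
  have : ((r+1 : ℕ) : WithTop ℕ∞) = (r : WithTop ℕ∞) + 1 := by push_cast; rfl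
  rw [this, contDiffOn_succ_iff_hasFDerivWithinAt_of_uniqueDiffOn HP_unique]
  refine ⟨fun h => by simp at h, fun p => ft p • ContinuousLinearMap.fst ℝ ℝ ℝ + fx p • ContinuousLinearMap.snd ℝ ℝ ℝ,
    (ct.smul contDiffOn_const).add (cx.smul contDiffOn_const), fun p hp =>
    joint_fderiv ct.continuousOn h1 h2 hp⟩

/-- clamping of continuous functions -/
theorem clamp_cont {g : ℝ × ℝ → ℝ} (hg : ContinuousOn g HP) :
    Continuous fun p : ℝ × ℝ => g (max p.1 0, p.2) :=
  hg.comp_continuous (by fun_prop) fun p => mem_HP (le_max_right _ _)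

theorem par_int {r : ℕ} {g : ℝ × ℝ → ℝ} (hg : ContDiffOn ℝ r g HP) (P : ℝ) :
    ContDiffOn ℝ r (fun t => ∫ x in (0:ℝ)..P, g (t, x)) (Set.Ici 0) := by
  induction r generalizing g with
  | zero =>
    have hc := clamp_cont hg.continuousOn
    have : Continuous fun t => ∫ x in (0:ℝ)..P, g (max t 0, x) :=
      intervalIntegral.continuous_parametric_intervalIntegral_of_continuous'
        (f := fun t x => g (max t 0, x)) hc 0 P
    refine contDiffOn_zero.2 (this.continuousOn.congr fun t ht => ?_)
    simp only [max_eq_left (Set.mem_Ici.1 ht)]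
  | succ r ih =>
    have e : ((r+1 : ℕ) : WithTop ℕ∞) = (r : WithTop ℕ∞) + 1 := by push_cast; rfl
    rw [e] at hg ⊢
    obtain ⟨-, g', hg', hd⟩ := (contDiffOn_succ_iff_hasFDerivWithinAt_of_uniqueDiffOn HP_unique).1 hg
    set k : ℝ × ℝ → ℝ := fun p => g' p (1, 0) with hk
    have hk' : ContDiffOn ℝ r k HP := hg'.clm_apply contDiffOn_const
    have hkt : ∀ t x, 0 ≤ t → HasDerivWithinAt (fun s => g (s, x)) (k (t, x)) (Set.Ici 0) t := by
      intro t x ht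
      have hin : HasDerivWithinAt (fun s : ℝ => ((s, x) : ℝ × ℝ)) (1, 0) (Set.Ici 0) t :=
        (hasDerivWithinAt_id t _).prodMk (hasDerivWithinAt_const t _ x)
      have h3 := hd (t, x) (mem_HP ht)
      exact HasFDerivWithinAt.comp_hasDerivWithinAt (f := fun s : ℝ => ((s, x) : ℝ × ℝ)) t h3 hin (fun s hs => mem_HP hs)
    have hkc := clamp_cont hk'.continuousOn
    have hgc := clamp_cont hg.continuousOn
    have key : ∀ t, 0 ≤ t → ∫ x in (0:ℝ)..P, g (t, x) = (∫ x in (0:ℝ)..P, g (0, x)) +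
        ∫ s in (0:ℝ)..t, ∫ x in (0:ℝ)..P, k (max s 0, x) := by
      intro t ht
      have hh : ∀ x, g (t, x) = g (0, x) + ∫ s in (0:ℝ)..t, k (max s 0, x) := by
        intro x
        have hcx : Continuous fun s => k (max s 0, x) := hkc.comp (Continuous.prodMk_left x)
        have := intervalIntegral.integral_eq_sub_of_hasDerivAt_of_le ht (f := fun s => g (s, x))
          (f' := fun s => k (max s 0, x))
          (fun s hs => ((hkt s x hs.1).continuousWithinAt).mono (fun z hz => hz.1))
          (fun s hs => by
            rw [max_eq_left hs.1.le]
            exact (hkt s x hs.1.le).hasDerivAt (Ici_mem_nhds hs.1))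
          (hcx.intervalIntegrable _ _)
        rw [this]; ring
      rw [intervalIntegral.integral_congr (g := fun x => g (0, x) + ∫ s in (0:ℝ)..t, k (max s 0, x)) fun x _ => hh x]
      rw [intervalIntegral.integral_add]
      · congr 1
        exact swap_int (F := fun x s => k (max s 0, x)) (hkc.comp continuous_swap) 0 P 0 t
      · have : Continuous fun x => g (max 0 0, x) := hgc.comp (Continuous.prodMk_right 0)
        simp only [max_self] at this
        exact this.intervalIntegrable _ _
      · have : Continuous fun x => ∫ s in (0:ℝ)..t, k (max s 0, x) :=
          intervalIntegral.continuous_parametric_intervalIntegral_of_continuous'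
            (f := fun x s => k (max s 0, x)) (hkc.comp continuous_swap) 0 t
        exact this.intervalIntegrable _ _
    have hkI : Continuous fun s => ∫ x in (0:ℝ)..P, k (max s 0, x) :=
      intervalIntegral.continuous_parametric_intervalIntegral_of_continuous'
        (f := fun s x => k (max s 0, x)) hkc 0 P
    have hder : ∀ t ∈ Set.Ici (0:ℝ), HasDerivWithinAt (fun t => ∫ x in (0:ℝ)..P, g (t, x))
        (∫ x in (0:ℝ)..P, k (t, x)) (Set.Ici 0) t := by
      intro t ht
      have h1 := ((hkI.integral_hasStrictDerivAt 0 t).hasDerivAt.const_add (∫ x in (0:ℝ)..P, g (0, x))).hasDerivWithinAt (s := Set.Ici 0)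
      rw [max_eq_left (Set.mem_Ici.1 ht)] at h1
      exact h1.congr (fun s hs => key s hs) (key t ht)
    rw [contDiffOn_succ_iff_derivWithin (uniqueDiffOn_Ici 0)]
    refine ⟨fun t ht => (hder t ht).differentiableWithinAt, fun h => by simp at h, ?_⟩
    exact (ih hk').congr fun t ht => (hder t ht).derivWithin (uniqueDiffOn_Ici 0 t ht)

theorem fst_contDiffOn {r : ℕ} {l : ℝ → ℝ} (hl : ContDiffOn ℝ r l (Set.Ici 0)) :
    ContDiffOn ℝ r (fun p : ℝ × ℝ => l p.1) HP :=
  hl.comp contDiff_fst.contDiffOn fun p hp => hp.1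

theorem Lam_contDiffOn {r : ℕ} {u : ℝ → ℝ → ℝ} (hu : QQ r HP u) {P : ℝ} (hP : 0 < P)
    {b ψ : ℝ → ℝ} {c : ℝ} (hC : Coef b ψ c) : ContDiffOn ℝ r (fun t => Lam P ψ (u t)) (Set.Ici 0) := by
  have h0 := hu.reg 0
  have h1 := (hu.comp hC.ψ_smooth).reg 0
  have h2 := ((hu.comp hC.ψ_smooth).mul hu).reg 0
  simp only [iteratedDeriv_zero] at h0 h1 h2
  refine (par_int h2 P).div (par_int h1 P) fun t ht => ?_
  exact ((mul_pos hC.hc hP).trans_le (int_psi_pos hP hC (hu.smooth t).continuous)).ne'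

theorem sol_smooth {P : ℝ} (hP : 0 < P) {b ψ : ℝ → ℝ} {c : ℝ} (hC : Coef b ψ c) {u : ℝ → ℝ → ℝ}
    (h0 : QQ 0 Set.univ u) (hd : ∀ k x t, 0 ≤ t → HasDerivWithinAt (fun t => iteratedDeriv k (u t) x)
        (iteratedDeriv k (FF P b ψ (u t)) x) (Set.Ici 0) t) (r : ℕ) : QQ r HP u := by
  induction r with
  | zero => exact ⟨h0.smooth, fun k => (h0.reg k).mono (Set.subset_univ _)⟩
  | succ r ih =>
    refine ⟨h0.smooth, fun k => ?_⟩
    have hF := ih.FF hC.b_smooth (fst_contDiffOn (Lam_contDiffOn ih hP hC))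
    exact joint_succ (hF.reg k) (ih.reg (k+1)) (fun t x ht => hd k x t ht)
      (fun t x _ => h0.hasDerivAt t k x)

end APF

namespace APF

/-- time strip -/
def DD (T : ℝ) : Set (ℝ × ℝ) := Set.Icc 0 T ×ˢ Set.univ

theorem clampI {g : ℝ × ℝ → ℝ} {T : ℝ} (hT : 0 ≤ T) (hg : ContinuousOn g (DD T)) :
    Continuous fun p : ℝ × ℝ => g ((Set.projIcc 0 T hT p.1 : ℝ), p.2) :=
  hg.comp_continuous ((continuous_subtype_val.comp (continuous_projIcc.comp continuous_fst)).prodMk continuous_snd)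
    fun p => ⟨(Set.projIcc 0 T hT p.1).2, trivial⟩

theorem par_cont {g : ℝ → ℝ → ℝ} {T : ℝ} (hg : ContinuousOn (fun p : ℝ × ℝ => g p.1 p.2) (DD T)) (P : ℝ) :
    ContinuousOn (fun t => ∫ x in (0:ℝ)..P, g t x) (Set.Icc 0 T) := by
  intro t ht
  have hT : 0 ≤ T := ht.1.trans ht.2
  have hc := clampI hT hg
  have : Continuous fun t => ∫ x in (0:ℝ)..P, g (Set.projIcc 0 T hT t) x :=
    intervalIntegral.continuous_parametric_intervalIntegral_of_continuous'
      (f := fun t x => g (Set.projIcc 0 T hT t) x) hc 0 P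
  refine (this.continuousOn.congr fun s hs => ?_) t ht
  rw [Set.projIcc_of_mem hT hs]

theorem par_deriv {g gt : ℝ → ℝ → ℝ} {T : ℝ} (hg : ContinuousOn (fun p : ℝ × ℝ => g p.1 p.2) (DD T))
    (hgt : ContinuousOn (fun p : ℝ × ℝ => gt p.1 p.2) (DD T))
    (hd : ∀ t ∈ Set.Icc 0 T, ∀ x, HasDerivWithinAt (fun s => g s x) (gt t x) (Set.Icc 0 T) t) (P : ℝ)
    {t : ℝ} (ht : t ∈ Set.Icc 0 T) :
    HasDerivWithinAt (fun t => ∫ x in (0:ℝ)..P, g t x) (∫ x in (0:ℝ)..P, gt t x) (Set.Icc 0 T) t := by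
  have hT : 0 ≤ T := ht.1.trans ht.2
  have hkc := clampI hT hgt
  have hgc := clampI hT hg
  set π' : ℝ → ℝ := fun s => (Set.projIcc 0 T hT s : ℝ) with hπ
  have hπ' : ∀ s ∈ Set.Icc 0 T, π' s = s := fun s hs => by simp only [hπ]; rw [Set.projIcc_of_mem hT hs]
  have key : ∀ t ∈ Set.Icc 0 T, ∫ x in (0:ℝ)..P, g t x = (∫ x in (0:ℝ)..P, g 0 x) +
      ∫ s in (0:ℝ)..t, ∫ x in (0:ℝ)..P, gt (π' s) x := by
    intro t ht
    have hh : ∀ x, g t x = g 0 x + ∫ s in (0:ℝ)..t, gt (π' s) x := by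
      intro x
      have hcx : Continuous fun s => gt (π' s) x := hkc.comp (Continuous.prodMk_left x)
      have := intervalIntegral.integral_eq_sub_of_hasDerivAt_of_le ht.1 (f := fun s => g s x)
        (f' := fun s => gt (π' s) x)
        (fun s hs => ((hd s ⟨hs.1, hs.2.trans ht.2⟩ x).continuousWithinAt).mono (fun z hz => ⟨hz.1, hz.2.trans ht.2⟩))
        (fun s hs => by
          have hs' : s ∈ Set.Icc 0 T := ⟨hs.1.le, hs.2.le.trans ht.2⟩
          rw [hπ' s hs']
          exact (hd s hs' x).hasDerivAt (Icc_mem_nhds hs.1 (hs.2.trans_le ht.2)))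
        (hcx.intervalIntegrable _ _)
      rw [this]; ring
    rw [intervalIntegral.integral_congr (g := fun x => g 0 x + ∫ s in (0:ℝ)..t, gt (π' s) x) fun x _ => hh x]
    rw [intervalIntegral.integral_add]
    · congr 1
      exact swap_int (F := fun x s => gt (π' s) x) (hkc.comp continuous_swap) 0 P 0 t
    · have : Continuous fun x => g (π' 0) x := hgc.comp (Continuous.prodMk_right 0)
      rw [hπ' 0 ⟨le_rfl, hT⟩] at this
      exact this.intervalIntegrable _ _
    · have : Continuous fun x => ∫ s in (0:ℝ)..t, gt (π' s) x :=
        intervalIntegral.continuous_parametric_intervalIntegral_of_continuous'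
          (f := fun x s => gt (π' s) x) (hkc.comp continuous_swap) 0 t
      exact this.intervalIntegrable _ _
  have hkI : Continuous fun s => ∫ x in (0:ℝ)..P, gt (π' s) x :=
    intervalIntegral.continuous_parametric_intervalIntegral_of_continuous'
      (f := fun s x => gt (π' s) x) hkc 0 P
  have h1 := ((hkI.integral_hasStrictDerivAt 0 t).hasDerivAt.const_add (∫ x in (0:ℝ)..P, g 0 x)).hasDerivWithinAt (s := Set.Icc 0 T)
  rw [hπ' t ht] at h1
  exact h1.congr (fun s hs => key s hs) (key t ht)

theorem deriv_nonneg_of_max {f : ℝ → ℝ} {s0 T t d : ℝ} (h0 : s0 < t) (hT : t ≤ T)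
    (hm : ∀ s ∈ Set.Icc s0 T, f s ≤ f t) (hd : HasDerivWithinAt f d (Set.Icc s0 T) t) : 0 ≤ d := by
  have h1 := hd.mono (show Set.Ioo s0 t ⊆ Set.Icc s0 T from fun s hs => ⟨hs.1.le, hs.2.le.trans hT⟩)
  rw [hasDerivWithinAt_iff_tendsto_slope' (by simp)] at h1
  have : (𝓝[Set.Ioo s0 t] t).NeBot := right_nhdsWithin_Ioo_neBot h0
  refine ge_of_tendsto h1 ?_
  filter_upwards [self_mem_nhdsWithin] with s hs
  rw [slope_def_field]
  exact div_nonneg_of_nonpos (by linarith [hm s ⟨hs.1.le, hs.2.le.trans hT⟩]) (by linarith [hs.2])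

/-- maximum principle -/
theorem maxp {P s0 T K : ℝ} (hP : 0 < P) {f : ℝ → ℝ → ℝ}
    (hc : ContinuousOn (fun p : ℝ × ℝ => f p.1 p.2) (Set.Icc s0 T ×ˢ Set.univ))
    (hper : ∀ t ∈ Set.Icc s0 T, Function.Periodic (f t) P) (h0 : ∀ x, f s0 x ≤ K)
    (hneg : ∀ t ∈ Set.Ioc s0 T, ∀ x, (∀ y, f t y ≤ f t x) → K < f t x →
      ∃ d < 0, HasDerivWithinAt (fun s => f s x) d (Set.Icc s0 T) t) :
    ∀ t ∈ Set.Icc s0 T, ∀ x, f t x ≤ K := by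
  intro t ht x
  have hcomp : IsCompact (Set.Icc s0 T ×ˢ Set.Icc (0:ℝ) (0+P)) := isCompact_Icc.prod isCompact_Icc
  obtain ⟨⟨t1, x1⟩, hm, hmax⟩ := hcomp.exists_isMaxOn ⟨(t, 0), ht, by simp [hP.le]⟩
    (hc.mono (Set.prod_mono le_rfl (Set.subset_univ _)))
  have hall : ∀ s ∈ Set.Icc s0 T, ∀ y, f s y ≤ f t1 x1 := by
    intro s hs y
    obtain ⟨z, hz, he⟩ := exists_rep hP 0 y
    have h1 : f s y = f s z := (he (f s) (hper s hs)).symm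
    have h2 : f s z ≤ f t1 x1 := hmax (show (s, z) ∈ _ from ⟨hs, ⟨hz.1, hz.2.le⟩⟩)
    linarith
  refine (hall t ht x).trans ?_
  by_contra hK
  push Not at hK
  have ht1 : s0 < t1 := by
    refine lt_of_le_of_ne hm.1.1 fun h => ?_
    have := h0 x1
    rw [← h] at hK
    linarith
  obtain ⟨d, hd, hdd⟩ := hneg t1 ⟨ht1, hm.1.2⟩ x1 (fun y => hall t1 hm.1 y) hK
  have := deriv_nonneg_of_max ht1 hm.1.2 (fun s hs => hall s hs x1) hdd
  linarith

theorem second_deriv_test {φ : ℝ → ℝ} (hφ : ContDiff ℝ ∞ φ) {x : ℝ} (hm : ∀ y, φ y ≤ φ x) :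
    iteratedDeriv 2 φ x ≤ 0 := by
  by_contra h
  push Not at h
  have hmax : IsLocalMax φ x := Eventually.of_forall hm
  have hd0 : deriv φ x = 0 := hmax.deriv_eq_zero
  have h2 : deriv^[2] φ x > 0 := by rw [← iteratedDeriv_eq_iterate]; exact h
  have hmin := isLocalMin_of_deriv_deriv_pos (f := φ) (x₀ := x) h2 hd0 hφ.continuous.continuousAt
  have he : φ =ᶠ[𝓝 x] fun _ => φ x := by
    filter_upwards [hmin] with y hy
    exact le_antisymm (hm y) hy
  have : iteratedDeriv 2 φ x = 0 := by
    rw [he.iteratedDeriv_eq 2]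
    simp [iteratedDeriv_const]
  linarith

theorem wirt0 {κ P a : ℝ} (hκ : 0 < κ) (hP : 0 < P) (hκP : κ * P < π) {v : ℝ → ℝ} (hv : ContDiff ℝ ∞ v)
    (h0 : v a = 0) (h1 : v (a + P) = 0) :
    κ^2 * ∫ x in a..(a+P), v x ^ 2 ≤ ∫ x in a..(a+P), (deriv v x) ^ 2 := by
  have hd : ContDiff ℝ ∞ (deriv v) := (contDiff_infty_iff_deriv.1 hv).2
  have hvd : Differentiable ℝ v := hv.differentiable (by simp)
  set F : ℝ → ℝ := fun x => -κ * tan (κ * (x - a - P/2)) * v x ^ 2 with hF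
  have hcos : ∀ x ∈ Set.Icc a (a+P), 0 < cos (κ * (x - a - P/2)) := by
    intro x hx
    refine cos_pos_of_mem_Ioo ⟨?_, ?_⟩
    · nlinarith [mul_nonneg hκ.le (sub_nonneg.2 hx.1)]
    · nlinarith [mul_nonneg hκ.le (sub_nonneg.2 hx.2)]
  have hFd : ∀ x ∈ Set.Icc a (a+P), HasDerivAt F
      (-κ * (1 / cos (κ * (x - a - P/2)) ^ 2 * κ) * v x ^ 2 + -κ * tan (κ * (x - a - P/2)) * (2 * v x * deriv v x)) x := by
    intro x hx
    have e1 : HasDerivAt (fun x => κ * (x - a - P/2)) κ x := by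
      simpa using (((hasDerivAt_id x).sub_const a).sub_const (P/2)).const_mul κ
    have e2 := (Real.hasDerivAt_tan (hcos x hx).ne').comp x e1
    have e3 := (hvd x).hasDerivAt.pow 2
    have e4 := (e2.const_mul (-κ)).mul e3
    refine e4.congr_deriv ?_
    simp
  have hle := intervalIntegral.sub_le_integral_of_hasDeriv_right_of_le (a := a) (b := a + P) (by linarith)
    (g := F) (φ := fun x => (deriv v x)^2 - κ^2 * v x ^ 2)
    (fun x hx => (hFd x hx).continuousAt.continuousWithinAt)
    (fun x hx => (hFd x ⟨hx.1.le, hx.2.le⟩).hasDerivWithinAt)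
    (((hd.continuous.pow 2).sub ((hv.continuous.pow 2).const_mul _)).integrableOn_Icc)
    (fun x hx => by
      have hc := hcos x ⟨hx.1.le, hx.2.le⟩
      have ht : 1 / cos (κ * (x - a - P/2)) ^ 2 = 1 + tan (κ * (x - a - P/2))^2 := by
        generalize κ * (x - a - P/2) = θ at hc
        rw [tan_eq_sin_div_cos]; field_simp
        linarith [sin_sq_add_cos_sq θ]
      rw [ht]
      nlinarith [sq_nonneg (deriv v x + κ * tan (κ * (x - a - P/2)) * v x)])
  have e0 : F (a+P) - F a = 0 := by simp [hF, h0, h1]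
  rw [e0] at hle
  have i1 : IntervalIntegrable (fun x => (deriv v x)^2) volume a (a+P) := (hd.continuous.pow 2).intervalIntegrable _ _
  have i2 : IntervalIntegrable (fun x => κ^2 * v x ^ 2) volume a (a+P) :=
    ((hv.continuous.pow 2).const_mul _).intervalIntegrable _ _
  rw [intervalIntegral.integral_sub i1 i2, intervalIntegral.integral_const_mul] at hle
  linarith

theorem exists_mean {P : ℝ} (hP : 0 < P) {f : ℝ → ℝ} (hf : Continuous f) :
    ∃ x, f x = (∫ x in (0:ℝ)..P, f x) / P := by
  have hF : ∀ x, HasDerivAt (fun x => ∫ y in (0:ℝ)..x, f y) (f x) x :=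
    fun x => (hf.integral_hasStrictDerivAt 0 x).hasDerivAt
  obtain ⟨x, _, hx⟩ := exists_hasDerivAt_eq_slope (fun x => ∫ y in (0:ℝ)..x, f y) f hP
    (continuous_iff_continuousAt.2 fun x => (hF x).continuousAt).continuousOn (fun x _ => hF x)
  exact ⟨x, by simpa using hx⟩

theorem wirt {P : ℝ} (hP : 0 < P) (hPπ : P < π) : ∃ ν : ℝ, 0 < ν ∧ ∀ f, SP P f →
    ∫ x in (0:ℝ)..P, (f x - (∫ x in (0:ℝ)..P, f x) / P) ^ 2 ≤ (1 - ν) * X P 1 f := by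
  set κ := (1 + π / P) / 2 with hκ
  have h1 : 1 < π / P := by rw [lt_div_iff₀ hP]; linarith
  have hκ1 : 1 < κ := by rw [hκ]; linarith
  have hκP : κ * P < π := by
    have : κ < π / P := by rw [hκ]; linarith
    rwa [lt_div_iff₀ hP] at this
  refine ⟨1 - 1 / κ^2, ?_, fun f hf => ?_⟩
  · have : 1 < κ^2 := by nlinarith
    have := (div_lt_one (by positivity)).2 this
    linarith
  · obtain ⟨a, ha⟩ := exists_mean hP hf.cont
    set m := (∫ x in (0:ℝ)..P, f x) / P
    have hv : SP P (fun x => f x - m) := hf.sub (SP.const P m)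
    have := wirt0 (by linarith) hP hκP hv.1 (a := a) (by simp [ha]) (by
      have := hf.2 a; rw [this, ha]; ring)
    have d : deriv (fun x => f x - m) = deriv f := by funext x; simp
    rw [d, per_integral_shift (f := fun x => (f x - m)^2) (fun x => by simp [hf.2 x]),
      per_integral_shift (f := fun x => (deriv f x)^2) (fun x => by
        simp only; rw [hf.deriv.2 x])] at this
    have e : X P 1 f = ∫ x in (0:ℝ)..P, (deriv f x)^2 := by simp [X, iteratedDeriv_one]
    rw [e, sub_sub_cancel, one_div, inv_mul_eq_div, le_div_iff₀ (by positivity)]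
    linarith

/-- representation of the support function -/
theorem repr {P : ℝ} {h ρ : ℝ → ℝ} (hh : SP P h) (hr : ∀ x, h x + iteratedDeriv 2 h x = ρ x)
    (hρ : Continuous ρ) (x : ℝ) :
    2 * h x * sin (P/2) = ∫ y in x..(x+P), ρ y * cos (y - x - P/2) := by
  set G : ℝ → ℝ := fun y => deriv h y * cos (y - x - P/2) + h y * sin (y - x - P/2)
  have hG : ∀ y, HasDerivAt G (ρ y * cos (y - x - P/2)) y := by
    intro y
    have e1 : HasDerivAt (fun y => y - x - P/2) 1 y := by
      simpa using (((hasDerivAt_id y).sub_const x).sub_const (P/2))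
    have e2 : HasDerivAt (deriv h) (iteratedDeriv 2 h y) y := by
      have := hh.hasDerivAt_iter 1 y
      rwa [iteratedDeriv_one] at this
    have := (e2.mul e1.cos).add ((hh.diff y).hasDerivAt.mul e1.sin)
    refine this.congr_deriv ?_
    rw [← hr y]; ring
  rw [intervalIntegral.integral_eq_sub_of_hasDerivAt (fun y _ => hG y)
    ((hρ.mul (by fun_prop)).intervalIntegrable _ _)]
  simp only [G]
  rw [hh.2 x, hh.deriv.2 x, show x + P - x - P/2 = P/2 by ring, show x - x - P/2 = -(P/2) by ring,
    cos_neg, sin_neg]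
  ring

theorem repr_bounds {P : ℝ} (hP : 0 < P) (hPπ : P < π) {h ρ : ℝ → ℝ} (hh : SP P h)
    (hr : ∀ x, h x + iteratedDeriv 2 h x = ρ x)
    (hρ : Continuous ρ) (hpos : ∀ x, 0 ≤ ρ x) (x : ℝ) :
    cos (P/2) * (∫ y in (0:ℝ)..P, ρ y) ≤ 2 * sin (P/2) * h x ∧
      2 * sin (P/2) * h x ≤ ∫ y in (0:ℝ)..P, ρ y := by
  have hper : Function.Periodic ρ P := fun y => by
    rw [← hr, ← hr, hh.2 y, (hh.iter 2).2 y]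
  have e := repr hh hr hρ x
  have e' : 2 * sin (P/2) * h x = ∫ y in x..(x+P), ρ y * cos (y - x - P/2) := by rw [← e]; ring
  rw [e', ← per_integral_shift hper x, ← intervalIntegral.integral_const_mul]
  have i1 : IntervalIntegrable (fun y => ρ y * cos (y - x - P/2)) volume x (x+P) :=
    (hρ.mul (by fun_prop)).intervalIntegrable _ _
  constructor
  · refine intervalIntegral.integral_mono_on (by linarith) ((hρ.const_mul _).intervalIntegrable _ _) i1 fun y hy => ?_
    rw [mul_comm]
    refine mul_le_mul_of_nonneg_left ?_ (hpos y)
    rw [← cos_abs (y - x - P/2)]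
    refine cos_le_cos_of_nonneg_of_le_pi (abs_nonneg _) (by linarith) ?_
    rw [abs_le]; constructor <;> linarith [hy.1, hy.2]
  · refine intervalIntegral.integral_mono_on (by linarith) i1 (hρ.intervalIntegrable _ _) fun y hy => ?_
    exact mul_le_of_le_one_right (hpos y) (cos_le_one _)

end APF

namespace APF

/-- radius of curvature as a function of the speed `w` -/
noncomputable def psi (α y : ℝ) : ℝ := y ^ (-(1/α))

/-- diffusion coefficient -/
noncomputable def bet (α y : ℝ) : ℝ := α * y ^ (1 + 1/α)

theorem psi_pos {α y : ℝ} (hy : 0 < y) : 0 < psi α y := rpow_pos_of_pos hy _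

theorem psi_hasDerivAt {α y : ℝ} (hα : 0 < α) (hy : 0 < y) :
    HasDerivAt (psi α) (-(1 / bet α y)) y := by
  have := Real.hasDerivAt_rpow_const (x := y) (p := -(1/α)) (Or.inl hy.ne')
  refine this.congr_deriv ?_
  rw [bet, show -(1/α) - 1 = -(1 + 1/α) by ring, rpow_neg hy.le]
  have := rpow_pos_of_pos hy (1 + 1/α)
  field_simp

theorem bet_pos {α y : ℝ} (hα : 0 < α) (hy : 0 < y) : 0 < bet α y := mul_pos hα (rpow_pos_of_pos hy _)

theorem bet_mul_psi {α y : ℝ} (hy : 0 < y) : bet α y * psi α y = α * y := by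
  rw [bet, psi, mul_assoc, ← rpow_add hy]; simp

theorem psi_contOn (α : ℝ) : ContinuousOn (psi α) (Set.Ioi 0) :=
  fun y hy => (Real.continuousAt_rpow_const y _ (Or.inl (ne_of_gt hy))).continuousWithinAt

theorem bet_contOn (α : ℝ) : ContinuousOn (bet α) (Set.Ioi 0) :=
  fun y hy => ((Real.continuousAt_rpow_const y _ (Or.inl (ne_of_gt hy))).const_mul _).continuousWithinAt

theorem psi_anti {α x y : ℝ} (hα : 0 < α) (hx : 0 < x) (hxy : x ≤ y) : psi α y ≤ psi α x :=
  rpow_le_rpow_of_nonpos hx hxy (by have := one_div_pos.2 hα; linarith)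

theorem psi_inv {α y : ℝ} (hα : 0 < α) (hy : 0 < y) : (psi α y) ^ (-α) = y := by
  rw [psi, ← rpow_mul hy.le]
  rw [show -(1/α) * -α = 1 by field_simp, rpow_one]

theorem psi_rpow {α y : ℝ} (hα : 0 < α) (hy : 0 < y) : psi α (y ^ (-α)) = y := by
  rw [psi, ← rpow_mul hy.le]
  rw [show -α * -(1/α) = 1 by field_simp, rpow_one]

/-- a solution of the flow on `[0,T]` -/
structure Flow (P α T : ℝ) (u h : ℝ → ℝ → ℝ) : Prop where
  su : ∀ t ∈ Set.Icc 0 T, SP P (u t)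
  sh : ∀ t ∈ Set.Icc 0 T, SP P (h t)
  cu : ∀ k, ContinuousOn (fun p : ℝ × ℝ => iteratedDeriv k (u p.1) p.2) (DD T)
  ch : ContinuousOn (fun p : ℝ × ℝ => h p.1 p.2) (DD T)
  pos : ∀ t ∈ Set.Icc 0 T, ∀ x, 0 < u t x
  rel : ∀ t ∈ Set.Icc 0 T, ∀ x, h t x + iteratedDeriv 2 (h t) x = psi α (u t x)
  ut : ∀ t ∈ Set.Icc 0 T, ∀ x, HasDerivWithinAt (fun s => u s x)
    (bet α (u t x) * (iteratedDeriv 2 (u t) x + (u t x - Lam P (psi α) (u t)))) (Set.Icc 0 T) t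
  ht : ∀ t ∈ Set.Icc 0 T, ∀ x, HasDerivWithinAt (fun s => h s x)
    (Lam P (psi α) (u t) - u t x) (Set.Icc 0 T) t

variable {P α T : ℝ} {u h : ℝ → ℝ → ℝ}

theorem Flow.cu0 (F : Flow P α T u h) : ContinuousOn (fun p : ℝ × ℝ => u p.1 p.2) (DD T) := by
  simpa using F.cu 0

theorem Flow.rho_contOn (F : Flow P α T u h) :
    ContinuousOn (fun p : ℝ × ℝ => psi α (u p.1 p.2)) (DD T) :=
  (psi_contOn α).comp F.cu0 fun p hp => F.pos p.1 hp.1 p.2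

theorem Flow.rho_SP (F : Flow P α T u h) {t : ℝ} (ht : t ∈ Set.Icc 0 T) :
    SP P (fun x => psi α (u t x)) := by
  have := (F.sh t ht).add ((F.sh t ht).iter 2)
  refine (funext fun x => ?_ : (fun x => h t x + iteratedDeriv 2 (h t) x) = fun x => psi α (u t x)) ▸ this
  exact F.rel t ht x

theorem int_pos {P : ℝ} (hP : 0 < P) {f : ℝ → ℝ} (hf : Continuous f) (h : ∀ x, 0 < f x) :
    0 < ∫ x in (0:ℝ)..P, f x :=
  intervalIntegral.intervalIntegral_pos_of_pos (hf.intervalIntegrable _ _) h hP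

theorem Flow.L_pos (F : Flow P α T u h) (hP : 0 < P) {t : ℝ} (ht : t ∈ Set.Icc 0 T) :
    0 < ∫ x in (0:ℝ)..P, psi α (u t x) :=
  int_pos hP (F.rho_SP ht).cont fun x => psi_pos (F.pos t ht x)

theorem Flow.lam_contOn (F : Flow P α T u h) (hP : 0 < P) :
    ContinuousOn (fun t => Lam P (psi α) (u t)) (Set.Icc 0 T) :=
  (par_cont (g := fun t x => psi α (u t x) * u t x) (F.rho_contOn.mul F.cu0) P).div
    (par_cont (g := fun t x => psi α (u t x)) F.rho_contOn P) fun _ ht => (F.L_pos hP ht).ne'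

theorem Flow.lam_contOn2 (F : Flow P α T u h) (hP : 0 < P) :
    ContinuousOn (fun p : ℝ × ℝ => Lam P (psi α) (u p.1)) (DD T) :=
  (F.lam_contOn hP).comp continuous_fst.continuousOn fun _ hp => hp.1

theorem Flow.lam_mul (F : Flow P α T u h) (hP : 0 < P) {t : ℝ} (ht : t ∈ Set.Icc 0 T) :
    Lam P (psi α) (u t) * (∫ x in (0:ℝ)..P, psi α (u t x)) = ∫ x in (0:ℝ)..P, psi α (u t x) * u t x :=
  div_mul_cancel₀ _ (F.L_pos hP ht).ne'

theorem Flow.lam_pos (F : Flow P α T u h) (hP : 0 < P) {t : ℝ} (ht : t ∈ Set.Icc 0 T) :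
    0 < Lam P (psi α) (u t) :=
  div_pos (int_pos hP ((F.rho_SP ht).cont.mul (F.su t ht).cont)
    fun x => mul_pos (psi_pos (F.pos t ht x)) (F.pos t ht x)) (F.L_pos hP ht)

theorem Flow.lam_le (F : Flow P α T u h) (hP : 0 < P) {t : ℝ} (ht : t ∈ Set.Icc 0 T) {B : ℝ}
    (hB : ∀ x, u t x ≤ B) : Lam P (psi α) (u t) ≤ B := by
  rw [Lam, div_le_iff₀ (F.L_pos hP ht), ← intervalIntegral.integral_const_mul]
  refine intervalIntegral.integral_mono_on hP.le
    (((F.rho_SP ht).cont.mul (F.su t ht).cont).intervalIntegrable _ _)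
    (((F.rho_SP ht).cont.const_mul _).intervalIntegrable _ _) fun x _ => ?_
  rw [mul_comm]
  exact mul_le_mul_of_nonneg_right (hB x) (psi_pos (F.pos t ht x)).le

/-- Chebyshev inequality -/
theorem Flow.cheb (F : Flow P α T u h) (hP : 0 < P) (hα : 0 < α) {t : ℝ} (ht : t ∈ Set.Icc 0 T) :
    P * Lam P (psi α) (u t) ≤ ∫ x in (0:ℝ)..P, u t x := by
  obtain ⟨a, ha⟩ := exists_mean hP (F.su t ht).cont
  set I := ∫ x in (0:ℝ)..P, u t x with hI
  have hc := (F.su t ht).cont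
  have hr := (F.rho_SP ht).cont
  have hI' : I = P * u t a := by rw [ha]; field_simp
  have hle : ∫ x in (0:ℝ)..P, (psi α (u t x) - psi α (u t a)) * (u t x - u t a) ≤ 0 := by
    refine neg_nonneg.1 ?_
    rw [← intervalIntegral.integral_neg]
    refine intervalIntegral.integral_nonneg hP.le fun x _ => neg_nonneg.2 ?_
    rcases le_total (u t x) (u t a) with h | h
    · have := psi_anti hα (F.pos t ht x) h
      exact mul_nonpos_of_nonneg_of_nonpos (by linarith) (by linarith)
    · have := psi_anti hα (F.pos t ht a) h
      exact mul_nonpos_of_nonpos_of_nonneg (by linarith) (by linarith)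
  have e : ∀ x, (psi α (u t x) - psi α (u t a)) * (u t x - u t a)
      = psi α (u t x) * u t x - u t a * psi α (u t x) - (psi α (u t a) * u t x - psi α (u t a) * u t a) :=
    fun x => by ring
  simp only [e] at hle
  have i1 : IntervalIntegrable (fun x => psi α (u t x) * u t x) volume 0 P := (hr.mul hc).intervalIntegrable _ _
  have i2 : IntervalIntegrable (fun x => u t a * psi α (u t x)) volume 0 P := (hr.const_mul _).intervalIntegrable _ _
  have i3 : IntervalIntegrable (fun x => psi α (u t a) * u t x) volume 0 P := (hc.const_mul _).intervalIntegrable _ _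
  have i4 : IntervalIntegrable (fun _ => psi α (u t a) * u t a) volume 0 P := continuous_const.intervalIntegrable _ _
  rw [intervalIntegral.integral_sub (i1.sub i2) (i3.sub i4), intervalIntegral.integral_sub i1 i2,
    intervalIntegral.integral_sub i3 i4, intervalIntegral.integral_const_mul, intervalIntegral.integral_const_mul,
    intervalIntegral.integral_const, ← F.lam_mul hP ht, ← hI, hI'] at hle
  simp only [sub_zero, smul_eq_mul] at hle
  have hL := F.L_pos hP ht
  rw [hI']
  have : (Lam P (psi α) (u t) - u t a) * (∫ x in (0:ℝ)..P, psi α (u t x)) ≤ 0 := by linarith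
  have := nonpos_of_mul_nonpos_left this hL
  nlinarith

theorem Flow.rho_t (F : Flow P α T u h) (hα : 0 < α) {t : ℝ} (ht : t ∈ Set.Icc 0 T) (x : ℝ) :
    HasDerivWithinAt (fun s => psi α (u s x))
      (Lam P (psi α) (u t) - (iteratedDeriv 2 (u t) x + u t x)) (Set.Icc 0 T) t := by
  have := (psi_hasDerivAt hα (F.pos t ht x)).comp_hasDerivWithinAt t (F.ut t ht x)
  refine this.congr_deriv ?_
  have := bet_pos hα (F.pos t ht x)
  field_simp
  ring

theorem SP.int_d2 {f : ℝ → ℝ} (hf : SP P f) : ∫ x in (0:ℝ)..P, iteratedDeriv 2 f x = 0 := by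
  have := (hf.iter 1).integral_deriv
  rwa [← iteratedDeriv_succ] at this

theorem Flow.L_deriv (F : Flow P α T u h) (hP : 0 < P) (hα : 0 < α) {t : ℝ} (ht : t ∈ Set.Icc 0 T) :
    HasDerivWithinAt (fun s => ∫ x in (0:ℝ)..P, psi α (u s x))
      (P * Lam P (psi α) (u t) - ∫ x in (0:ℝ)..P, u t x) (Set.Icc 0 T) t := by
  have := par_deriv (g := fun s x => psi α (u s x))
    (gt := fun t x => Lam P (psi α) (u t) - (iteratedDeriv 2 (u t) x + u t x)) F.rho_contOn
    ((F.lam_contOn2 hP).sub ((F.cu 2).add F.cu0)) (fun t ht x => F.rho_t hα ht x) P ht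
  refine this.congr_deriv ?_
  have hc := (F.su t ht).cont
  have hc2 := ((F.su t ht).iter 2).cont
  have i1 : IntervalIntegrable (fun _ : ℝ => Lam P (psi α) (u t)) volume 0 P := continuous_const.intervalIntegrable _ _
  have i2 : IntervalIntegrable (fun x => iteratedDeriv 2 (u t) x) volume 0 P := hc2.intervalIntegrable _ _
  have i3 : IntervalIntegrable (fun x => u t x) volume 0 P := hc.intervalIntegrable _ _
  rw [intervalIntegral.integral_sub i1 (i2.add i3), intervalIntegral.integral_add i2 i3, (F.su t ht).int_d2]
  simp

theorem mvtI {f f' : ℝ → ℝ} (hf : ∀ t ∈ Set.Icc 0 T, HasDerivWithinAt f (f' t) (Set.Icc 0 T) t) {s t : ℝ}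
    (hs : 0 ≤ s) (hst : s < t) (ht : t ≤ T) : ∃ c ∈ Set.Icc 0 T, s ≤ c ∧ c ≤ t ∧ f t - f s = f' c * (t - s) := by
  obtain ⟨c, hc, he⟩ := exists_hasDerivAt_eq_slope f f' hst
    (fun x hx => ((hf x ⟨hs.trans hx.1, hx.2.trans ht⟩).continuousWithinAt).mono
      fun z hz => ⟨hs.trans hz.1, hz.2.trans ht⟩)
    (fun x hx => (hf x ⟨hs.trans hx.1.le, hx.2.le.trans ht⟩).hasDerivAt
      (Icc_mem_nhds (hs.trans_lt hx.1) (hx.2.trans_le ht)))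
  refine ⟨c, ⟨hs.trans hc.1.le, hc.2.le.trans ht⟩, hc.1.le, hc.2.le, ?_⟩
  rw [he, div_mul_cancel₀]
  linarith

theorem anti_of_deriv {f f' : ℝ → ℝ} (hf : ∀ t ∈ Set.Icc 0 T, HasDerivWithinAt f (f' t) (Set.Icc 0 T) t)
    (h0 : ∀ t ∈ Set.Icc 0 T, f' t ≤ 0) {s t : ℝ} (hs : 0 ≤ s) (hst : s ≤ t) (ht : t ≤ T) : f t ≤ f s := by
  rcases hst.eq_or_lt with rfl | hst
  · exact le_rfl
  · obtain ⟨c, hc, -, -, he⟩ := mvtI hf hs hst ht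
    nlinarith [h0 c hc]

theorem Flow.L_anti (F : Flow P α T u h) (hP : 0 < P) (hα : 0 < α) {s t : ℝ} (hs : 0 ≤ s) (hst : s ≤ t)
    (ht : t ≤ T) : ∫ x in (0:ℝ)..P, psi α (u t x) ≤ ∫ x in (0:ℝ)..P, psi α (u s x) :=
  anti_of_deriv (f := fun s => ∫ x in (0:ℝ)..P, psi α (u s x)) (fun _ ht => F.L_deriv hP hα ht)
    (fun _ ht => by linarith [F.cheb hP hα ht]) hs hst ht

theorem Flow.int_h (F : Flow P α T u h) {t : ℝ} (ht : t ∈ Set.Icc 0 T) :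
    ∫ x in (0:ℝ)..P, h t x = ∫ x in (0:ℝ)..P, psi α (u t x) := by
  simp only [← F.rel t ht]
  have i1 : IntervalIntegrable (fun x => h t x) volume 0 P := (F.sh t ht).cont.intervalIntegrable _ _
  have i2 : IntervalIntegrable (fun x => iteratedDeriv 2 (h t) x) volume 0 P :=
    ((F.sh t ht).iter 2).cont.intervalIntegrable _ _
  rw [intervalIntegral.integral_add i1 i2, (F.sh t ht).int_d2, add_zero]

theorem SP.ibp2 {f g : ℝ → ℝ} (hf : SP P f) (hg : SP P g) :
    ∫ x in (0:ℝ)..P, f x * iteratedDeriv 2 g x = ∫ x in (0:ℝ)..P, iteratedDeriv 2 f x * g x := by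
  have h1 := hf.ibp (hg.iter 1)
  have h2 := (hf.iter 1).ibp hg
  rw [← iteratedDeriv_succ] at h1 h2
  rw [iteratedDeriv_one] at h1 h2
  rw [h1, h2, neg_neg]

theorem Flow.area (F : Flow P α T u h) (hP : 0 < P) (hα : 0 < α) {t : ℝ} (ht : t ∈ Set.Icc 0 T) :
    ∫ x in (0:ℝ)..P, h t x * psi α (u t x) = ∫ x in (0:ℝ)..P, h 0 x * psi α (u 0 x) := by
  have hder : ∀ t ∈ Set.Icc 0 T, HasDerivWithinAt (fun s => ∫ x in (0:ℝ)..P, h s x * psi α (u s x)) 0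
      (Set.Icc 0 T) t := by
    intro t ht
    have := par_deriv (g := fun s x => h s x * psi α (u s x))
      (gt := fun t x => (Lam P (psi α) (u t) - u t x) * psi α (u t x) +
        h t x * (Lam P (psi α) (u t) - (iteratedDeriv 2 (u t) x + u t x))) (F.ch.mul F.rho_contOn)
      ((((F.lam_contOn2 hP).sub F.cu0).mul F.rho_contOn).add
        (F.ch.mul ((F.lam_contOn2 hP).sub ((F.cu 2).add F.cu0))))
      (fun t ht x => (F.ht t ht x).mul (F.rho_t hα ht x)) P ht
    refine this.congr_deriv ?_
    set Λ := Lam P (psi α) (u t)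
    have hc := (F.su t ht).cont
    have hc2 := ((F.su t ht).iter 2).cont
    have hh := (F.sh t ht).cont
    have hh2 := ((F.sh t ht).iter 2).cont
    have hr := (F.rho_SP ht).cont
    have e : ∀ x, (Λ - u t x) * psi α (u t x) + h t x * (Λ - (iteratedDeriv 2 (u t) x + u t x))
        = (Λ * psi α (u t x) - psi α (u t x) * u t x) + (Λ * h t x - psi α (u t x) * u t x)
          + (iteratedDeriv 2 (h t) x * u t x - h t x * iteratedDeriv 2 (u t) x) := by
      intro x
      rw [← F.rel t ht x]; ring
    simp only [e]
    have i1 : IntervalIntegrable (fun x => Λ * psi α (u t x)) volume 0 P := (hr.const_mul _).intervalIntegrable _ _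
    have i2 : IntervalIntegrable (fun x => psi α (u t x) * u t x) volume 0 P := (hr.mul hc).intervalIntegrable _ _
    have i3 : IntervalIntegrable (fun x => Λ * h t x) volume 0 P := (hh.const_mul _).intervalIntegrable _ _
    have i4 : IntervalIntegrable (fun x => iteratedDeriv 2 (h t) x * u t x) volume 0 P := (hh2.mul hc).intervalIntegrable _ _
    have i5 : IntervalIntegrable (fun x => h t x * iteratedDeriv 2 (u t) x) volume 0 P := (hh.mul hc2).intervalIntegrable _ _
    rw [intervalIntegral.integral_add ((i1.sub i2).add (i3.sub i2)) (i4.sub i5),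
      intervalIntegral.integral_add (i1.sub i2) (i3.sub i2), intervalIntegral.integral_sub i1 i2,
      intervalIntegral.integral_sub i3 i2, intervalIntegral.integral_sub i4 i5,
      (F.sh t ht).ibp2 (F.su t ht), intervalIntegral.integral_const_mul, intervalIntegral.integral_const_mul,
      F.int_h ht, F.lam_mul hP ht]
    ring
  have h1 := anti_of_deriv hder (fun _ _ => le_rfl) le_rfl ht.1 ht.2
  have h2 := anti_of_deriv (fun t ht => (hder t ht).neg) (fun _ _ => by simp) le_rfl ht.1 ht.2
  simp only [Pi.neg_apply] at h2
  linarith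

end APF

namespace APF

/-- admissible initial data -/
structure Init (P α : ℝ) (w0 h0 : ℝ → ℝ) : Prop where
  sw : SP P w0
  sh : SP P h0
  pos : ∀ x, 0 < w0 x
  rel : ∀ x, h0 x + iteratedDeriv 2 h0 x = psi α (w0 x)

variable {P α T : ℝ} {u h : ℝ → ℝ → ℝ} {w0 h0 : ℝ → ℝ}

theorem Init.rho_SP (I : Init P α w0 h0) : SP P (fun x => psi α (w0 x)) := by
  have := I.sh.add (I.sh.iter 2)
  refine (funext fun x => ?_ : (fun x => h0 x + iteratedDeriv 2 h0 x) = fun x => psi α (w0 x)) ▸ this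
  exact I.rel x

theorem Init.L_pos (I : Init P α w0 h0) (hP : 0 < P) : 0 < ∫ x in (0:ℝ)..P, psi α (w0 x) :=
  int_pos hP I.rho_SP.cont fun x => psi_pos (I.pos x)

theorem half_trig (hP : 0 < P) (hPπ : P < π) : 0 < sin (P/2) ∧ 0 < cos (P/2) :=
  ⟨sin_pos_of_pos_of_lt_pi (by linarith) (by linarith), cos_pos_of_mem_Ioo ⟨by linarith, by linarith⟩⟩

theorem h_bounds (hP : 0 < P) (hPπ : P < π) (hα : 0 < α) (I : Init P α w0 h0) :
    ∃ δ H : ℝ, 0 < δ ∧ 0 < H ∧ ∀ T u h, Flow P α T u h → u 0 = w0 → h 0 = h0 →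
      ∀ t ∈ Set.Icc 0 T, ∀ x, 2 * δ ≤ h t x ∧ h t x ≤ H := by
  obtain ⟨hs, hc⟩ := half_trig hP hPπ
  set s := sin (P/2)
  set c := cos (P/2)
  set L0 := ∫ x in (0:ℝ)..P, psi α (w0 x) with hL0
  have hL0p : 0 < L0 := I.L_pos hP
  have hh0 : ∀ x, 0 < h0 x := fun x => by
    have := (repr_bounds hP hPπ I.sh I.rel I.rho_SP.cont (fun x => (psi_pos (I.pos x)).le) x).1
    have h2 : 0 < 2 * s * h0 x := lt_of_lt_of_le (mul_pos hc hL0p) this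
    exact pos_of_mul_pos_right h2 (by positivity)
  set A := ∫ x in (0:ℝ)..P, h0 x * psi α (w0 x) with hA
  have hAp : 0 < A := int_pos hP (I.sh.cont.mul I.rho_SP.cont) fun x => mul_pos (hh0 x) (psi_pos (I.pos x))
  refine ⟨c * √(2 * s * A) / (4 * s), L0 / (2 * s), by positivity, by positivity, ?_⟩
  intro T u h F hu hh t ht x
  set L := ∫ x in (0:ℝ)..P, psi α (u t x) with hL
  have hLp : 0 < L := F.L_pos hP ht
  have hLL : L ≤ L0 := by
    have := F.L_anti hP hα le_rfl ht.1 ht.2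
    rwa [hu] at this
  have hb := repr_bounds hP hPπ (F.sh t ht) (F.rel t ht) (F.rho_SP ht).cont (fun x => (psi_pos (F.pos t ht x)).le)
  have hAL : 2 * s * A ≤ L ^ 2 := by
    have e := F.area hP hα ht
    rw [hu, hh] at e
    rw [hA, ← e, ← intervalIntegral.integral_const_mul, sq, hL, ← intervalIntegral.integral_const_mul, ← hL]
    refine intervalIntegral.integral_mono_on hP.le
      ((((F.sh t ht).cont.mul (F.rho_SP ht).cont).const_mul _).intervalIntegrable _ _)
      (((F.rho_SP ht).cont.const_mul _).intervalIntegrable _ _) fun y _ => ?_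
    rw [← mul_assoc]
    exact mul_le_mul_of_nonneg_right (hb y).2 (psi_pos (F.pos t ht y)).le
  have hsq : √(2 * s * A) ≤ L := Real.sqrt_le_iff.2 ⟨hLp.le, hAL⟩
  constructor
  · have h1 := (hb x).1
    have : c * √(2 * s * A) ≤ 2 * s * h t x := (mul_le_mul_of_nonneg_left hsq hc.le).trans h1
    rw [show 2 * (c * √(2 * s * A) / (4 * s)) = c * √(2 * s * A) / (2 * s) by field_simp; ring,
      div_le_iff₀ (by positivity)]
    linarith
  · rw [le_div_iff₀ (by positivity)]
    have := (hb x).2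
    linarith

/-- Tso's estimate -/
theorem tso (hP : 0 < P) (hPπ : P < π) (hα : 0 < α) (I : Init P α w0 h0) :
    ∃ B : ℝ, 0 < B ∧ ∀ T u h, Flow P α T u h → u 0 = w0 → h 0 = h0 →
      ∀ t ∈ Set.Icc 0 T, ∀ x, u t x ≤ B := by
  obtain ⟨δ, H, hδ, hH, hb⟩ := h_bounds hP hPπ hα I
  set ws : ℝ := (α * δ / (2 * (α + 1))) ^ (-α) with hws
  have hbase : 0 < α * δ / (2 * (α + 1)) := by positivity
  have hwsp : 0 < ws := rpow_pos_of_pos hbase _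
  obtain ⟨C0, hC0⟩ := SP.le_sup_all hP I.sw.cont I.sw.2
  have hC0p : 0 < C0 := lt_of_lt_of_le (I.pos 0) ((le_abs_self _).trans (hC0 0))
  set K := ws / δ + C0 / δ with hK
  have hKp : 0 < K := by positivity
  refine ⟨K * H, by positivity, ?_⟩
  intro T u h F hu hh t ht x
  have hbd := hb T u h F hu hh
  have hden : ∀ t ∈ Set.Icc 0 T, ∀ x, δ ≤ h t x - δ := fun t ht x => by linarith [(hbd t ht x).1]
  have key : ∀ t ∈ Set.Icc 0 T, ∀ x, u t x / (h t x - δ) ≤ K := by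
    refine maxp (f := fun t x => u t x / (h t x - δ)) hP ?_ ?_ ?_ ?_
    · exact F.cu0.div (F.ch.sub continuousOn_const) fun p hp => (hδ.trans_le (hden p.1 hp.1 p.2)).ne'
    · intro t ht x
      simp only [(F.su t ht).2 x, (F.sh t ht).2 x]
    · intro x
      have h0T : (0:ℝ) ∈ Set.Icc 0 T := ⟨le_rfl, ht.1.trans ht.2⟩
      have hd := hden 0 h0T x
      rw [div_le_iff₀ (hδ.trans_le hd)]
      have h1 : u 0 x ≤ C0 := by rw [hu]; exact (le_abs_self _).trans (hC0 x)
      have h2 : C0 ≤ K * δ := by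
        rw [hK, add_mul, div_mul_cancel₀ _ hδ.ne', div_mul_cancel₀ _ hδ.ne']; linarith
      exact h1.trans (h2.trans (mul_le_mul_of_nonneg_left hd hKp.le))
    · intro t ht' x hmax hgt
      have ht : t ∈ Set.Icc 0 T := ⟨ht'.1.le, ht'.2⟩
      set Q := u t x / (h t x - δ) with hQ
      have hd := hδ.trans_le (hden t ht x)
      have hw := F.pos t ht x
      have hQp : 0 < Q := div_pos hw hd
      have hwQ : u t x = Q * (h t x - δ) := by rw [hQ, div_mul_cancel₀ _ hd.ne']
      have hφ : SP P (fun y => u t y - Q * (h t y - δ)) :=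
        (F.su t ht).sub ((SP.const P Q).mul ((F.sh t ht).sub (SP.const P δ)))
      have h2 := second_deriv_test (φ := fun y => u t y - Q * (h t y - δ)) hφ.1 (x := x) (fun y => by
        have := hmax y
        rw [div_le_iff₀ (hδ.trans_le (hden t ht y))] at this
        rw [← hwQ]; linarith)
      have e2 : iteratedDeriv 2 (fun y => u t y - Q * (h t y - δ)) x
          = iteratedDeriv 2 (u t) x - Q * iteratedDeriv 2 (h t) x := by
        have d1 : ∀ y, HasDerivAt (fun y => u t y - Q * (h t y - δ))
            (iteratedDeriv 1 (u t) y - Q * iteratedDeriv 1 (h t) y) y := fun y => by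
          have a := (F.su t ht).hasDerivAt_iter 0 y
          have b := (F.sh t ht).hasDerivAt_iter 0 y
          simp only [iteratedDeriv_zero] at a b
          exact a.sub ((b.sub_const δ).const_mul Q)
        rw [iteratedDeriv_succ, iteratedDeriv_one, funext fun y => (d1 y).deriv]
        exact (((F.su t ht).hasDerivAt_iter 1 x).sub (((F.sh t ht).hasDerivAt_iter 1 x).const_mul Q)).deriv
      rw [e2] at h2
      have hρ := F.rel t ht x
      set ρ := psi α (u t x)
      set b := bet α (u t x) with hbb
      have hbp : 0 < b := bet_pos hα hw
      have hΛ := F.lam_pos hP ht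
      have hder := (F.ut t ht x).div ((F.ht t ht x).sub_const δ) hd.ne'
      refine ⟨_, ?_, hder⟩
      set Λ := Lam P (psi α) (u t)
      have hbr : b * ρ = α * u t x := bet_mul_psi hw
      refine div_neg_of_neg_of_pos ?_ (by positivity)
      have hw2 : b * (iteratedDeriv 2 (u t) x + (u t x - Λ)) ≤ Q * (α * u t x) - b * Q * δ := by
        have : iteratedDeriv 2 (u t) x + (u t x - Λ) ≤ Q * ρ - Q * δ := by
          rw [← hρ]; nlinarith
        nlinarith [mul_le_mul_of_nonneg_left this hbp.le]
      have hwgt : ws ≤ u t x := by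
        have : ws ≤ K * δ := by
          rw [hK, add_mul, div_mul_cancel₀ _ hδ.ne', div_mul_cancel₀ _ hδ.ne']; linarith
        rw [hwQ]
        exact this.trans (mul_le_mul hgt.le (hden t ht x) hδ.le hQp.le)
      have hρle : ρ ≤ α * δ / (2 * (α + 1)) := by
        have := psi_anti hα hwsp hwgt
        rwa [hws, psi_rpow hα hbase] at this
      have h3 : 2 * (α + 1) * u t x ≤ b * δ := by
        have h4 : b * ρ ≤ b * (α * δ / (2 * (α + 1))) := mul_le_mul_of_nonneg_left hρle hbp.le
        rw [hbr, ← mul_div_assoc, le_div_iff₀ (by positivity)] at h4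
        have : α * (2 * (α + 1) * u t x) ≤ α * (b * δ) := by linarith
        exact le_of_mul_le_mul_left this hα
      have h5 : b * (iteratedDeriv 2 (u t) x + (u t x - Λ)) + u t x * Q < 0 := by
        have : (2 * (α + 1) * u t x) * Q ≤ b * δ * Q := mul_le_mul_of_nonneg_right h3 hQp.le
        nlinarith [mul_pos hw hQp, mul_pos hα (mul_pos hw hQp)]
      have h6 : u t x * (Λ - u t x) ≥ - (u t x * Q) * (h t x - δ) := by
        rw [neg_mul, mul_assoc, ← hwQ]; nlinarith
      nlinarith
  have h1 := key t ht x
  rw [div_le_iff₀ (hδ.trans_le (hden t ht x))] at h1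
  refine h1.trans (mul_le_mul_of_nonneg_left ?_ hKp.le)
  linarith [(hbd t ht x).2]

end APF

namespace APF

variable {P α T : ℝ} {u h : ℝ → ℝ → ℝ} {w0 h0 : ℝ → ℝ}

/-- primitive used in the energy -/
noncomputable def VV (α B w : ℝ) : ℝ := ∫ s in B..w, psi α s / α

theorem psi_ii {a b : ℝ} (ha : 0 < a) (hb : 0 < b) :
    IntervalIntegrable (fun s => psi α s / α) volume a b := by
  refine (ContinuousOn.div_const ((psi_contOn α).mono fun s hs => ?_) _).intervalIntegrable
  exact lt_of_lt_of_le (lt_min ha hb) hs.1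

theorem VV_hasDerivAt {B w : ℝ} (hB : 0 < B) (hw : 0 < w) :
    HasDerivAt (VV α B) (psi α w / α) w := by
  have hc : ContinuousOn (fun s => psi α s / α) (Set.Ioi 0) := (psi_contOn α).div_const _
  exact intervalIntegral.integral_hasDerivAt_right (psi_ii hB hw)
    (hc.stronglyMeasurableAtFilter isOpen_Ioi w hw) (hc.continuousAt (Ioi_mem_nhds hw))

theorem VV_le {B w : ℝ} (hα : 0 < α) (hw : 0 < w) (hwB : w ≤ B) : VV α B w ≤ 0 := by
  rw [VV, intervalIntegral.integral_symm]
  refine neg_nonpos.2 (intervalIntegral.integral_nonneg hwB fun s hs => ?_)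
  exact div_nonneg (psi_pos (hw.trans_le hs.1)).le hα.le

theorem VV_ge {B w : ℝ} (hα : 0 < α) (hw : 0 < w) (hwB : w ≤ B) : -(B / α) * psi α w ≤ VV α B w := by
  rw [VV, intervalIntegral.integral_symm]
  have h1 : ∫ s in w..B, psi α s / α ≤ ∫ _ in w..B, psi α w / α := by
    refine intervalIntegral.integral_mono_on hwB (psi_ii hw (hw.trans_le hwB))
      (continuous_const.intervalIntegrable _ _) fun s hs => ?_
    exact div_le_div_of_nonneg_right (psi_anti hα hw hs.1) hα.le
  rw [intervalIntegral.integral_const, smul_eq_mul] at h1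
  have h2 : (B - w) * (psi α w / α) ≤ B * (psi α w / α) :=
    mul_le_mul_of_nonneg_right (by linarith) (div_nonneg (psi_pos hw).le hα.le)
  have : B / α * psi α w = B * (psi α w / α) := by ring
  linarith

/-- the energy -/
noncomputable def EE (P α B : ℝ) (u : ℝ → ℝ → ℝ) (t : ℝ) : ℝ :=
  (∫ x in (0:ℝ)..P, VV α B (u t x)) + B * ∫ x in (0:ℝ)..P, psi α (u t x)

theorem VV_contOn {B : ℝ} (hB : 0 < B) : ContinuousOn (VV α B) (Set.Ioi 0) :=
  fun _ hw => (VV_hasDerivAt hB hw).continuousAt.continuousWithinAt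

theorem Flow.V_cont (F : Flow P α T u h) {B : ℝ} (hB : 0 < B) {t : ℝ} (ht : t ∈ Set.Icc 0 T) :
    Continuous fun x => VV α B (u t x) :=
  (VV_contOn hB).comp_continuous (F.su t ht).cont fun x => F.pos t ht x

theorem Flow.EE_le (F : Flow P α T u h) (hP : 0 < P) (hα : 0 < α) {B : ℝ} (hB : 0 < B)
    {t : ℝ} (ht : t ∈ Set.Icc 0 T) (hu : ∀ x, u t x ≤ B) :
    EE P α B u t ≤ B * ∫ x in (0:ℝ)..P, psi α (u t x) := by
  rw [EE]
  have : 0 ≤ - ∫ x in (0:ℝ)..P, VV α B (u t x) := by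
    rw [← intervalIntegral.integral_neg]
    exact intervalIntegral.integral_nonneg hP.le fun x _ => neg_nonneg.2 (VV_le hα (F.pos t ht x) (hu x))
  linarith

theorem Flow.EE_ge (F : Flow P α T u h) (hP : 0 < P) (hα : 0 < α) {B : ℝ} (hB : 0 < B)
    {t : ℝ} (ht : t ∈ Set.Icc 0 T) (hu : ∀ x, u t x ≤ B) :
    -(B / α) * (∫ x in (0:ℝ)..P, psi α (u t x)) ≤ EE P α B u t := by
  rw [EE]
  have h1 : ∫ x in (0:ℝ)..P, -(B / α) * psi α (u t x) ≤ ∫ x in (0:ℝ)..P, VV α B (u t x) :=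
    intervalIntegral.integral_mono_on hP.le (((F.rho_SP ht).cont.const_mul _).intervalIntegrable _ _)
      ((F.V_cont hB ht).intervalIntegrable _ _) fun x _ => VV_ge hα (F.pos t ht x) (hu x)
  rw [intervalIntegral.integral_const_mul] at h1
  have := mul_pos hB (F.L_pos hP ht)
  linarith

/-- derivative of the energy -/
noncomputable def EE' (P α B : ℝ) (u : ℝ → ℝ → ℝ) (t : ℝ) : ℝ :=
  (∫ x in (0:ℝ)..P, u t x * (iteratedDeriv 2 (u t) x + (u t x - Lam P (psi α) (u t)))) +
    B * (P * Lam P (psi α) (u t) - ∫ x in (0:ℝ)..P, u t x)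

theorem Flow.EE_deriv (F : Flow P α T u h) (hP : 0 < P) (hα : 0 < α) {B : ℝ} (hB : 0 < B)
    {t : ℝ} (ht : t ∈ Set.Icc 0 T) :
    HasDerivWithinAt (EE P α B u) (EE' P α B u t) (Set.Icc 0 T) t := by
  refine HasDerivWithinAt.add ?_ ((F.L_deriv hP hα ht).const_mul B)
  refine par_deriv (g := fun t x => VV α B (u t x))
    (gt := fun t x => u t x * (iteratedDeriv 2 (u t) x + (u t x - Lam P (psi α) (u t)))) ?_ ?_ ?_ P ht
  · exact (VV_contOn hB).comp F.cu0 fun p hp => F.pos p.1 hp.1 p.2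
  · exact F.cu0.mul ((F.cu 2).add (F.cu0.sub (F.lam_contOn2 hP)))
  · intro t ht x
    have := (VV_hasDerivAt (α := α) hB (F.pos t ht x)).comp_hasDerivWithinAt t (F.ut t ht x)
    refine this.congr_deriv ?_
    have e := bet_mul_psi (α := α) (F.pos t ht x)
    rw [← mul_assoc, show psi α (u t x) / α * bet α (u t x) = (bet α (u t x) * psi α (u t x)) / α by ring, e]
    field_simp

theorem SP.ibp_self {f : ℝ → ℝ} (hf : SP P f) :
    ∫ x in (0:ℝ)..P, f x * iteratedDeriv 2 f x = - X P 1 f := by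
  have := hf.ibp_iter hf 1 1
  simp only [X]
  rw [this]; simp [sq]

theorem Flow.EE'_le (F : Flow P α T u h) (hP : 0 < P) (hα : 0 < α) {B ν : ℝ}
    (hν : ∀ f, SP P f →
      ∫ x in (0:ℝ)..P, (f x - (∫ x in (0:ℝ)..P, f x) / P) ^ 2 ≤ (1 - ν) * X P 1 f)
    {t : ℝ} (ht : t ∈ Set.Icc 0 T) (hu : ∀ x, u t x ≤ B) :
    EE' P α B u t ≤ - ν * X P 1 (u t) := by
  have hw := hν _ (F.su t ht)
  set I := ∫ x in (0:ℝ)..P, u t x with hI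
  set Λ := Lam P (psi α) (u t) with hΛ
  have hc := (F.su t ht).cont
  have hc2 := ((F.su t ht).iter 2).cont
  have hch := F.cheb hP hα ht
  have i1 : IntervalIntegrable (fun x => u t x * iteratedDeriv 2 (u t) x) volume 0 P := (hc.mul hc2).intervalIntegrable _ _
  have i2 : IntervalIntegrable (fun x => (u t x) ^ 2) volume 0 P := (hc.pow 2).intervalIntegrable _ _
  have i3 : IntervalIntegrable (fun x => Λ * u t x) volume 0 P := (hc.const_mul _).intervalIntegrable _ _
  have i4 : IntervalIntegrable (fun x => (2 * (I / P)) * u t x) volume 0 P := (hc.const_mul _).intervalIntegrable _ _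
  have i5 : IntervalIntegrable (fun _ => (I / P) ^ 2) volume 0 P := continuous_const.intervalIntegrable _ _
  have e1 : ∫ x in (0:ℝ)..P, u t x * (iteratedDeriv 2 (u t) x + (u t x - Λ))
      = - X P 1 (u t) + ((∫ x in (0:ℝ)..P, (u t x) ^ 2) - Λ * I) := by
    rw [← (F.su t ht).ibp_self, hI, ← intervalIntegral.integral_const_mul, ← intervalIntegral.integral_sub i2 i3,
      ← intervalIntegral.integral_add i1 (i2.sub i3)]
    exact intervalIntegral.integral_congr fun x _ => by ring
  have e2 : ∫ x in (0:ℝ)..P, (u t x - I / P) ^ 2 = (∫ x in (0:ℝ)..P, (u t x) ^ 2) - I * (I / P) := by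
    have : ∀ x, (u t x - I / P) ^ 2 = (u t x) ^ 2 - (2 * (I / P)) * u t x + (I / P) ^ 2 := fun x => by ring
    simp only [this]
    rw [intervalIntegral.integral_add (i2.sub i4) i5, intervalIntegral.integral_sub i2 i4,
      intervalIntegral.integral_const_mul, ← hI, intervalIntegral.integral_const]
    simp only [smul_eq_mul, sub_zero]
    field_simp; ring
  have hIB : I / P ≤ B := by
    rw [div_le_iff₀ hP]
    have : I ≤ ∫ _ in (0:ℝ)..P, B := intervalIntegral.integral_mono_on hP.le (hc.intervalIntegrable _ _)
      (continuous_const.intervalIntegrable _ _) fun x _ => hu x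
    rw [intervalIntegral.integral_const, smul_eq_mul, sub_zero] at this
    linarith
  rw [EE', e1]
  rw [e2] at hw
  have : (I / P - B) * (I - P * Λ) ≤ 0 := mul_nonpos_of_nonpos_of_nonneg (by linarith) (by linarith)
  have e3 : (I / P) * (P * Λ) = Λ * I := by field_simp
  nlinarith

end APF

namespace APF

variable {P α T : ℝ} {u h : ℝ → ℝ → ℝ} {w0 h0 : ℝ → ℝ}

theorem psi_le_iff {x y : ℝ} (hα : 0 < α) (hx : 0 < x) (hy : 0 < y) (hxy : psi α y ≤ psi α x) : x ≤ y := by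
  rw [← psi_inv hα hx, ← psi_inv hα hy]
  exact rpow_le_rpow_of_nonpos (psi_pos hy) hxy (by linarith)

/-- growth of the radius of curvature -/
theorem Flow.rho_growth (F : Flow P α T u h) (hP : 0 < P) (hα : 0 < α) {B R s t : ℝ}
    (hB : ∀ t ∈ Set.Icc 0 T, ∀ x, u t x ≤ B) (hs : 0 ≤ s) (hst : s ≤ t) (htT : t ≤ T)
    (hR : ∀ x, psi α (u s x) ≤ R) (x : ℝ) : psi α (u t x) ≤ R + B * (t - s) := by
  have hsub : Set.Icc s t ⊆ Set.Icc 0 T := fun z hz => ⟨hs.trans hz.1, hz.2.trans htT⟩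
  have := maxp (P := P) (s0 := s) (T := t) (K := R) (f := fun σ x => psi α (u σ x) - B * (σ - s)) hP
    ?_ ?_ ?_ ?_ t ⟨hst, le_rfl⟩ x
  · linarith
  · refine (F.rho_contOn.mono (Set.prod_mono hsub le_rfl)).sub (Continuous.continuousOn ?_)
    fun_prop
  · intro σ hσ x
    simp only [(F.su σ (hsub hσ)).2 x]
  · intro x
    simpa using hR x
  · intro σ hσ' x hmax _
    have hσ := hsub ⟨hσ'.1.le, hσ'.2⟩
    have hd := (F.rho_t hα hσ x).mono hsub
    have hid : HasDerivWithinAt (fun σ => B * (σ - s)) B (Set.Icc s t) σ := by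
      simpa using (((hasDerivAt_id σ).sub_const s).const_mul B).hasDerivWithinAt
    refine ⟨_, ?_, hd.sub hid⟩
    have h2 := second_deriv_test (φ := fun y => - u σ y) (F.su σ hσ).1.neg (x := x) (fun y => by
      have := hmax y
      simp only [sub_le_sub_iff_right] at this
      linarith [psi_le_iff hα (F.pos σ hσ x) (F.pos σ hσ y) this])
    rw [iteratedDeriv_fun_neg] at h2
    have := F.lam_le hP hσ (hB σ hσ)
    have := F.pos σ hσ x
    linarith

theorem apriori (hP : 0 < P) (hPπ : P < π) (hα : 0 < α) (I : Init P α w0 h0) :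
    ∃ a B : ℝ, 0 < a ∧ a < B ∧ ∀ T u h, Flow P α T u h → u 0 = w0 → h 0 = h0 →
      ∀ t ∈ Set.Icc 0 T, ∀ x, a < u t x ∧ u t x < B := by
  obtain ⟨B, hB, hub⟩ := tso hP hPπ hα I
  obtain ⟨ν, hν, hwirt⟩ := wirt hP hPπ
  obtain ⟨R0, hR0⟩ := SP.le_sup_all hP I.rho_SP.cont I.rho_SP.2
  have hR0' : ∀ x, psi α (w0 x) ≤ R0 := fun x => (le_abs_self _).trans (hR0 x)
  have hR0p : 0 < R0 := (psi_pos (I.pos 0)).trans_le (hR0' 0)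
  set L0 := ∫ x in (0:ℝ)..P, psi α (w0 x) with hL0
  have hL0p : 0 < L0 := I.L_pos hP
  set w1 : ℝ := (L0 / P) ^ (-α) with hw1
  have hw1p : 0 < w1 := rpow_pos_of_pos (by positivity) _
  set ε := w1 ^ 2 / (4 * P) with hε
  have hεp : 0 < ε := by positivity
  set τ := (B + B / α) * L0 / (ν * ε) with hτ
  have hτp : 0 < τ := by positivity
  set R := R0 + psi α (w1 / 2) with hR
  have hRp : 0 < R := add_pos hR0p (psi_pos (by positivity))
  set ρs := R + B * τ with hρs
  have hρsp : 0 < ρs := by positivity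
  refine ⟨min (ρs ^ (-α) / 2) B, 2 * B, lt_min (by positivity) hB, lt_of_le_of_lt (min_le_right _ _) (by linarith), ?_⟩
  intro T u h F hu hh t ht x
  have hub' := hub T u h F hu hh
  refine ⟨lt_of_le_of_lt (min_le_left _ _) ?_, lt_of_le_of_lt (hub' t ht x) (by linarith)⟩
  have hLle : ∀ s ∈ Set.Icc 0 T, ∫ x in (0:ℝ)..P, psi α (u s x) ≤ L0 := fun s hs => by
    have := F.L_anti hP hα le_rfl hs.1 hs.2
    rwa [hu] at this
  have good : ∃ s, 0 ≤ s ∧ s ≤ t ∧ t - s ≤ τ ∧ ∀ x, psi α (u s x) ≤ R := by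
    rcases le_total t τ with htτ | htτ
    · refine ⟨0, le_rfl, ht.1, by linarith, fun x => ?_⟩
      rw [hu]
      linarith [hR0' x, psi_pos (α := α) (half_pos hw1p)]
    · obtain ⟨s, hs, hs1, hs2, he⟩ := mvtI (fun t ht => F.EE_deriv hP hα hB ht) (s := t - τ) (t := t)
        (by linarith) (by linarith) ht.2
      have h1 := F.EE'_le hP hα hwirt hs (hub' s hs)
      have htm : t - τ ∈ Set.Icc 0 T := ⟨by linarith, by linarith [ht.2]⟩
      have h2 := F.EE_ge hP hα hB ht (hub' t ht)
      have h3 := F.EE_le hP hα hB htm (hub' _ htm)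
      have h4 : EE P α B u (t - τ) ≤ B * L0 := h3.trans (mul_le_mul_of_nonneg_left (hLle _ htm) hB.le)
      have h5 : -(B/α) * L0 ≤ EE P α B u t := by
        have : (B/α) * (∫ x in (0:ℝ)..P, psi α (u t x)) ≤ (B/α) * L0 :=
          mul_le_mul_of_nonneg_left (hLle _ ht) (by positivity)
        linarith
      have hX : X P 1 (u s) ≤ ε := by
        have h6 : EE' P α B u s * τ ≤ - ν * X P 1 (u s) * τ := mul_le_mul_of_nonneg_right h1 hτp.le
        have h7 : ν * X P 1 (u s) * τ ≤ (B + B / α) * L0 := by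
          have : t - (t - τ) = τ := by ring
          rw [this] at he
          linarith
        have h8 : ν * ε * τ = (B + B / α) * L0 := by rw [hτ]; field_simp
        have h9 : X P 1 (u s) * (ν * τ) ≤ ε * (ν * τ) := by linarith
        exact le_of_mul_le_mul_right h9 (by positivity)
      refine ⟨s, hs.1, hs2, by linarith, fun y => ?_⟩
      obtain ⟨z, hz⟩ := exists_mean hP (F.rho_SP hs).cont
      have hz1 : w1 ≤ u s z := by
        rw [← psi_inv hα (F.pos s hs z), hw1]
        refine rpow_le_rpow_of_nonpos (psi_pos (F.pos s hs z)) ?_ (by linarith)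
        rw [hz]
        exact div_le_div_of_nonneg_right (hLle s hs) hP.le
      have hosc := sq_sub_le hP (F.su s hs) y z
      have h10 : (u s y - u s z) ^ 2 ≤ (w1 / 2) ^ 2 := by
        refine hosc.trans ((mul_le_mul_of_nonneg_left hX hP.le).trans (le_of_eq ?_))
        rw [hε]; field_simp; ring
      have h11 := abs_le_of_sq_le_sq h10 (by positivity)
      have h12 : w1 / 2 ≤ u s y := by linarith [(abs_le.1 h11).1]
      linarith [psi_anti hα (half_pos hw1p) h12]
  obtain ⟨s, hs0, hst, hsτ, hsR⟩ := good
  have hfin := F.rho_growth hP hα hub' hs0 hst ht.2 hsR x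
  have h1 : psi α (u t x) ≤ ρs := by
    have := mul_le_mul_of_nonneg_left hsτ hB.le
    linarith
  have h2 : ρs ^ (-α) ≤ u t x := by
    rw [← psi_inv hα (F.pos t ht x)]
    exact rpow_le_rpow_of_nonpos (psi_pos (F.pos t ht x)) h1 (by linarith)
  have : 0 < ρs ^ (-α) := rpow_pos_of_pos hρsp _
  linarith

end APF

namespace APF

theorem cutoff {a B : ℝ} (ha : 0 < a) (hB : a < B) : ∃ τ : ℝ → ℝ, ContDiff ℝ ∞ τ ∧
    (∀ y ∈ Set.Icc a B, τ y = y) ∧ (∀ y, a / 2 ≤ τ y ∧ τ y ≤ 2 * B) ∧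
    (∀ y, y ∉ Set.Icc (a/2) (2*B) → τ y = a / 2) := by
  have hBp : 0 < B := ha.trans hB
  set S1 : ℝ → ℝ := fun y => smoothTransition ((y - a/2) / (a/2)) with hS1
  set S2 : ℝ → ℝ := fun y => smoothTransition ((y - B) / B) with hS2
  have n1 : ∀ y, 0 ≤ S1 y ∧ S1 y ≤ 1 := fun y => ⟨smoothTransition.nonneg _, smoothTransition.le_one _⟩
  have n2 : ∀ y, 0 ≤ S2 y ∧ S2 y ≤ 1 := fun y => ⟨smoothTransition.nonneg _, smoothTransition.le_one _⟩
  have z1 : ∀ y, y ≤ a/2 → S1 y = 0 := fun y hy =>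
    smoothTransition.zero_of_nonpos (div_nonpos_of_nonpos_of_nonneg (by linarith) (by linarith))
  have o1 : ∀ y, a ≤ y → S1 y = 1 := fun y hy =>
    smoothTransition.one_of_one_le ((one_le_div (by linarith)).2 (by linarith))
  have z2 : ∀ y, y ≤ B → S2 y = 0 := fun y hy =>
    smoothTransition.zero_of_nonpos (div_nonpos_of_nonpos_of_nonneg (by linarith) (by linarith))
  have o2 : ∀ y, 2 * B ≤ y → S2 y = 1 := fun y hy =>
    smoothTransition.one_of_one_le ((one_le_div (by linarith)).2 (by linarith))
  have hout : ∀ y, y ≤ a/2 ∨ 2*B ≤ y → a/2 + (y - a/2) * S1 y * (1 - S2 y) = a/2 := by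
    rintro y (hy | hy)
    · rw [z1 y hy]; ring
    · rw [o2 y hy]; ring
  refine ⟨fun y => a/2 + (y - a/2) * S1 y * (1 - S2 y), ?_, ?_, ?_, ?_⟩
  · have c1 : ContDiff ℝ ∞ S1 := smoothTransition.contDiff.comp ((contDiff_id.sub contDiff_const).div_const _)
    have c2 : ContDiff ℝ ∞ S2 := smoothTransition.contDiff.comp ((contDiff_id.sub contDiff_const).div_const _)
    exact contDiff_const.add (((contDiff_id.sub contDiff_const).mul c1).mul (contDiff_const.sub c2))
  · intro y hy
    simp only
    rw [o1 y hy.1, z2 y hy.2]; ring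
  · intro y
    simp only
    by_cases hy : y ≤ a/2 ∨ 2*B ≤ y
    · rw [hout y hy]; constructor <;> linarith
    · push Not at hy
      have h0 : 0 ≤ S1 y * (1 - S2 y) := mul_nonneg (n1 y).1 (by linarith [(n2 y).2])
      have h1 : S1 y * (1 - S2 y) ≤ 1 := mul_le_one₀ (n1 y).2 (by linarith [(n2 y).2]) (by linarith [(n2 y).1])
      have h3 : 0 < y - a/2 := by linarith [hy.1]
      rw [mul_assoc]
      constructor
      · nlinarith
      · nlinarith [hy.2]
  · intro y hy
    refine hout y ?_
    by_contra hc
    push Not at hc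
    exact hy ⟨hc.1.le, hc.2.le⟩

theorem bd_of_const {f : ℝ → ℝ} (hf : ContDiff ℝ ∞ f) {p q K : ℝ} (h : ∀ y, y ∉ Set.Icc p q → f y = K) (k : ℕ) :
    ∃ C, ∀ y, |iteratedDeriv k f y| ≤ C := by
  have hc : Continuous (iteratedDeriv k f) := hf.continuous_iteratedDeriv k (by exact_mod_cast le_top)
  obtain ⟨C, hC⟩ := isCompact_Icc.exists_bound_of_continuousOn (s := Set.Icc p q) hc.continuousOn
  refine ⟨max C |iteratedDeriv k (fun _ => K) (0:ℝ)|, fun y => ?_⟩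
  by_cases hy : y ∈ Set.Icc p q
  · exact (hC y hy).trans (le_max_left _ _)
  · have he : f =ᶠ[𝓝 y] fun _ => K := by
      filter_upwards [isClosed_Icc.isOpen_compl.mem_nhds hy] with z hz
      exact h z hz
    rw [he.iteratedDeriv_eq]
    have : iteratedDeriv k (fun _ : ℝ => K) y = iteratedDeriv k (fun _ : ℝ => K) (0:ℝ) := by
      simp [iteratedDeriv_const]
    rw [this]
    exact le_max_right _ _

/-- compositions with the cutoff are smooth with bounded derivatives -/
theorem cut_comp {a B : ℝ} (ha : 0 < a) {τ : ℝ → ℝ} (hτ : ContDiff ℝ ∞ τ)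
    (hb : ∀ y, a / 2 ≤ τ y ∧ τ y ≤ 2 * B) (ho : ∀ y, y ∉ Set.Icc (a/2) (2*B) → τ y = a / 2)
    {g : ℝ → ℝ} (hg : ContDiffOn ℝ ∞ g (Set.Ioi 0)) :
    ContDiff ℝ ∞ (fun y => g (τ y)) ∧ ∀ k, ∃ C, ∀ y, |iteratedDeriv k (fun y => g (τ y)) y| ≤ C := by
  have h1 : ContDiff ℝ ∞ (fun y => g (τ y)) :=
    hg.comp_contDiff hτ fun y => lt_of_lt_of_le (half_pos ha) (hb y).1
  exact ⟨h1, bd_of_const h1 (K := g (a/2)) fun y hy => by rw [ho y hy]⟩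

theorem rpow_smooth (p : ℝ) : ContDiffOn ℝ ∞ (fun y : ℝ => y ^ p) (Set.Ioi 0) :=
  fun _ hy => (Real.contDiffAt_rpow_const_of_ne (ne_of_gt hy)).contDiffWithinAt

theorem coef_cut {α a B : ℝ} (hα : 0 < α) (ha : 0 < a) (hB : a < B) {τ : ℝ → ℝ} (hτ : ContDiff ℝ ∞ τ)
    (hb : ∀ y, a / 2 ≤ τ y ∧ τ y ≤ 2 * B) (ho : ∀ y, y ∉ Set.Icc (a/2) (2*B) → τ y = a / 2) :
    ∃ c, Coef (fun y => bet α (τ y)) (fun y => psi α (τ y)) c := by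
  have h1 := cut_comp ha hτ hb ho (g := psi α) (rpow_smooth _)
  have h2 := cut_comp ha hτ hb ho (g := bet α) (contDiffOn_const.mul (rpow_smooth _))
  have hp : ∀ y, 0 < τ y := fun y => lt_of_lt_of_le (half_pos ha) (hb y).1
  refine ⟨min (bet α (a/2)) (psi α (2*B)), lt_min (bet_pos hα (half_pos ha)) (psi_pos (by linarith)),
    h2.1, h1.1, h2.2, h1.2, fun y => (min_le_left _ _).trans ?_, fun y => (min_le_right _ _).trans ?_⟩
  · have := one_div_pos.2 hα
    exact mul_le_mul_of_nonneg_left (rpow_le_rpow (half_pos ha).le (hb y).1 (by linarith)) hα.le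
  · exact psi_anti hα (hp y) (hb y).2

end APF

namespace APF

variable {P α T : ℝ} {w0 h0 : ℝ → ℝ}

/-- the speed of the support function -/
noncomputable def hsp (P : ℝ) (ψ : ℝ → ℝ) (u : ℝ → ℝ → ℝ) (t x : ℝ) : ℝ := Lam P ψ (u t) + (-1) * u t x

/-- the support function reconstructed from the speed -/
noncomputable def HH (P : ℝ) (ψ : ℝ → ℝ) (h0 : ℝ → ℝ) (u : ℝ → ℝ → ℝ) (t x : ℝ) : ℝ :=
  h0 x + ∫ s in (0:ℝ)..t, hsp P ψ u s x

theorem hasDeriv_sing (f : ℝ → ℝ) (d : ℝ) : HasDerivWithinAt f d {0} 0 := by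
  rw [hasDerivWithinAt_iff_hasFDerivWithinAt]
  exact HasFDerivWithinAt.singleton

theorem init_flow (I : Init P α w0 h0) : Flow P α 0 (fun _ => w0) (fun _ => h0) where
  su _ _ := I.sw
  sh _ _ := I.sh
  cu k := ((I.sw.iter k).cont.comp continuous_snd).continuousOn
  ch := (I.sh.cont.comp continuous_snd).continuousOn
  pos _ _ := I.pos
  rel _ _ := I.rel
  ut t ht x := by
    rw [Set.Icc_self] at ht ⊢
    rw [Set.mem_singleton_iff.1 ht]
    exact hasDeriv_sing _ _
  ht t ht x := by
    rw [Set.Icc_self] at ht ⊢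
    rw [Set.mem_singleton_iff.1 ht]
    exact hasDeriv_sing _ _

theorem hsp_QQ (hP : 0 < P) {b ψ : ℝ → ℝ} {c : ℝ} (hC : Coef b ψ c) {u : ℝ → ℝ → ℝ} (hu : QQ 0 Set.univ u) :
    QQ 0 Set.univ (hsp P ψ u) := by
  have h1 : QQ 0 Set.univ (fun t (_ : ℝ) => Lam P ψ (u t)) := by
    refine QQ.const ?_
    have : Continuous fun p : ℝ × ℝ => Lam P ψ (u p.1) :=
      (Lam_cont (by simpa using hu.cont0 0) hP hC).comp continuous_fst
    simpa using this
  have h2 : QQ 0 Set.univ (fun (_ _ : ℝ) => (-1:ℝ)) := QQ.const contDiffOn_const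
  exact h1.add (h2.mul hu)

theorem HH_tower {h0 : ℝ → ℝ} (s0 : SP P h0) {ψ : ℝ → ℝ} {u : ℝ → ℝ → ℝ} (hg : QQ 0 Set.univ (hsp P ψ u))
    (t : ℝ) (k : ℕ) (x : ℝ) :
    HasDerivAt (fun x => iteratedDeriv k h0 x + ∫ s in (0:ℝ)..t, iteratedDeriv k (hsp P ψ u s) x)
      (iteratedDeriv (k+1) h0 x + ∫ s in (0:ℝ)..t, iteratedDeriv (k+1) (hsp P ψ u s) x) x :=
  (s0.hasDerivAt_iter k x).add (hg.int_tower 0 t k x)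

theorem HH_zero {h0 : ℝ → ℝ} {ψ : ℝ → ℝ} {u : ℝ → ℝ → ℝ} (t : ℝ) :
    HH P ψ h0 u t = fun x => iteratedDeriv 0 h0 x + ∫ s in (0:ℝ)..t, iteratedDeriv 0 (hsp P ψ u s) x := by
  funext x; simp [HH]

theorem HH_iter {h0 : ℝ → ℝ} (s0 : SP P h0) {ψ : ℝ → ℝ} {u : ℝ → ℝ → ℝ} (hg : QQ 0 Set.univ (hsp P ψ u))
    (t : ℝ) (k : ℕ) : iteratedDeriv k (HH P ψ h0 u t) =
      fun x => iteratedDeriv k h0 x + ∫ s in (0:ℝ)..t, iteratedDeriv k (hsp P ψ u s) x := by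
  rw [HH_zero]
  exact tower_iter (D := fun k x => iteratedDeriv k h0 x + ∫ s in (0:ℝ)..t, iteratedDeriv k (hsp P ψ u s) x)
    (HH_tower s0 hg t) k

theorem HH_SP {h0 : ℝ → ℝ} (s0 : SP P h0) {ψ : ℝ → ℝ} {u : ℝ → ℝ → ℝ} (hg : QQ 0 Set.univ (hsp P ψ u))
    (hu : ∀ t, SP P (u t)) (t : ℝ) : SP P (HH P ψ h0 u t) := by
  constructor
  · rw [HH_zero]
    exact tower_contDiff (D := fun k x => iteratedDeriv k h0 x + ∫ s in (0:ℝ)..t, iteratedDeriv k (hsp P ψ u s) x)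
      (HH_tower s0 hg t)
  · intro x
    simp only [HH, hsp, s0.2 x, (hu _).2 x]

theorem HH_dt {h0 : ℝ → ℝ} (s0 : SP P h0) {ψ : ℝ → ℝ} {u : ℝ → ℝ → ℝ} (hg : QQ 0 Set.univ (hsp P ψ u))
    (t : ℝ) (k : ℕ) (x : ℝ) :
    HasDerivAt (fun t => iteratedDeriv k (HH P ψ h0 u t) x) (iteratedDeriv k (hsp P ψ u t) x) t := by
  have hc : Continuous fun s => iteratedDeriv k (hsp P ψ u s) x :=
    (hg.cont0 k).comp (continuous_id.prodMk continuous_const)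
  simp only [HH_iter s0 hg]
  exact ((hc.integral_hasStrictDerivAt 0 t).hasDerivAt).const_add _

theorem HH_cont {h0 : ℝ → ℝ} (s0 : SP P h0) {ψ : ℝ → ℝ} {u : ℝ → ℝ → ℝ} (hg : QQ 0 Set.univ (hsp P ψ u)) (k : ℕ) :
    Continuous fun p : ℝ × ℝ => iteratedDeriv k (HH P ψ h0 u p.1) p.2 := by
  simp only [HH_iter s0 hg]
  refine ((s0.iter k).cont.comp continuous_snd).add ?_
  have := intervalIntegral.continuous_parametric_primitive_of_continuous (μ := volume) (a₀ := 0)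
    (f := fun (x s : ℝ) => iteratedDeriv k (hsp P ψ u s) x) ((hg.cont0 k).comp continuous_swap)
  exact this.comp continuous_swap

theorem iter_hsp {ψ : ℝ → ℝ} {u : ℝ → ℝ → ℝ} {t : ℝ} (hu : SP P (u t)) (x : ℝ) :
    iteratedDeriv 2 (hsp P ψ u t) x = - iteratedDeriv 2 (u t) x := by
  have d1 : ∀ y, HasDerivAt (hsp P ψ u t) ((-1) * iteratedDeriv 1 (u t) y) y := fun y => by
    have a := hu.hasDerivAt_iter 0 y
    simp only [iteratedDeriv_zero] at a
    exact (a.const_mul (-1)).const_add _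
  rw [iteratedDeriv_succ, iteratedDeriv_one, funext fun y => (d1 y).deriv]
  rw [((hu.hasDerivAt_iter 1 x).const_mul (-1)).deriv]
  ring

/-- as long as the cutoff is inactive the cutoff solution is a flow -/
theorem flow_of_bounds (hP : 0 < P) (hα : 0 < α) (I : Init P α w0 h0) {a B c : ℝ} (ha : 0 < a)
    {τ : ℝ → ℝ} (hid : ∀ y ∈ Set.Icc a B, τ y = y)
    (hC : Coef (fun y => bet α (τ y)) (fun y => psi α (τ y)) c) {u : ℝ → ℝ → ℝ} (hu : QQ 0 Set.univ u)
    (su : ∀ t, SP P (u t)) (u0 : u 0 = w0)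
    (ut : ∀ k x t, 0 ≤ t → HasDerivWithinAt (fun t => iteratedDeriv k (u t) x)
        (iteratedDeriv k (FF P (fun y => bet α (τ y)) (fun y => psi α (τ y)) (u t)) x) (Set.Ici 0) t)
    (hb : ∀ t ∈ Set.Icc 0 T, ∀ x, u t x ∈ Set.Icc a B) :
    Flow P α T u (HH P (fun y => psi α (τ y)) h0 u) := by
  have hg := hsp_QQ hP hC hu
  have hlam : ∀ t ∈ Set.Icc 0 T, Lam P (fun y => psi α (τ y)) (u t) = Lam P (psi α) (u t) := fun t ht => by
    simp only [Lam, hid _ (hb t ht _)]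
  have hut : ∀ t ∈ Set.Icc 0 T, ∀ x, HasDerivWithinAt (fun s => u s x)
      (bet α (u t x) * (iteratedDeriv 2 (u t) x + (u t x - Lam P (psi α) (u t)))) (Set.Icc 0 T) t := by
    intro t ht x
    have := (ut 0 x t ht.1).mono (show Set.Icc 0 T ⊆ Set.Ici 0 from fun z hz => hz.1)
    simp only [iteratedDeriv_zero, FF, gg, hid _ (hb t ht x), hlam t ht] at this
    exact this
  have hht : ∀ k, ∀ t ∈ Set.Icc 0 T, ∀ x, HasDerivWithinAt
      (fun s => iteratedDeriv k (HH P (fun y => psi α (τ y)) h0 u s) x)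
      (iteratedDeriv k (hsp P (fun y => psi α (τ y)) u t) x) (Set.Icc 0 T) t :=
    fun k t _ x => (HH_dt I.sh hg t k x).hasDerivWithinAt
  have hpos : ∀ t ∈ Set.Icc 0 T, ∀ x, 0 < u t x := fun t ht x => ha.trans_le (hb t ht x).1
  refine ⟨fun t _ => su t, fun t _ => HH_SP I.sh hg su t, fun k => (hu.cont0 k).continuousOn, ?_, hpos, ?_, hut, ?_⟩
  · have := HH_cont I.sh hg 0
    simp only [iteratedDeriv_zero] at this
    exact this.continuousOn
  · intro t ht x
    set f : ℝ → ℝ := fun t => iteratedDeriv 0 (HH P (fun y => psi α (τ y)) h0 u t) x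
      + iteratedDeriv 2 (HH P (fun y => psi α (τ y)) h0 u t) x - psi α (u t x) with hf
    have hd : ∀ t ∈ Set.Icc 0 T, HasDerivWithinAt f 0 (Set.Icc 0 T) t := by
      intro t ht
      have h1 := ((hht 0 t ht x).add (hht 2 t ht x)).sub
        ((psi_hasDerivAt hα (hpos t ht x)).comp_hasDerivWithinAt t (hut t ht x))
      refine h1.congr_deriv ?_
      rw [iter_hsp (su t), iteratedDeriv_zero, hsp, hlam t ht]
      have := bet_pos hα (hpos t ht x)
      field_simp
      ring
    have h1 := anti_of_deriv hd (fun _ _ => le_rfl) le_rfl ht.1 ht.2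
    have h2 := anti_of_deriv (fun t ht => (hd t ht).neg) (fun _ _ => by simp) le_rfl ht.1 ht.2
    simp only [Pi.neg_apply] at h2
    have hf0 : f 0 = 0 := by
      simp only [hf, HH_iter I.sh hg, u0, intervalIntegral.integral_same, iteratedDeriv_zero]
      have := I.rel x
      linarith
    have : f t = 0 := by linarith
    simp only [hf, iteratedDeriv_zero] at this
    linarith
  · intro t ht x
    have := hht 0 t ht x
    simp only [iteratedDeriv_zero] at this
    refine this.congr_deriv ?_
    rw [hsp, hlam t ht]; ring

theorem global (hP : 0 < P) (hPπ : P < π) (hα : 0 < α) (I : Init P α w0 h0) :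
    ∃ (a B c : ℝ) (τ : ℝ → ℝ) (u : ℝ → ℝ → ℝ), 0 < a ∧ a < B ∧ ContDiff ℝ ∞ τ ∧
      (∀ y ∈ Set.Icc a B, τ y = y) ∧ (∀ y, a / 2 ≤ τ y ∧ τ y ≤ 2 * B) ∧
      (∀ y, y ∉ Set.Icc (a/2) (2*B) → τ y = a / 2) ∧
      Coef (fun y => bet α (τ y)) (fun y => psi α (τ y)) c ∧
      QQ 0 Set.univ u ∧ (∀ t, SP P (u t)) ∧ u 0 = w0 ∧
      (∀ k x t, 0 ≤ t → HasDerivWithinAt (fun t => iteratedDeriv k (u t) x)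
        (iteratedDeriv k (FF P (fun y => bet α (τ y)) (fun y => psi α (τ y)) (u t)) x) (Set.Ici 0) t) ∧
      (∀ t, 0 ≤ t → ∀ x, u t x ∈ Set.Icc a B) ∧
      ∀ T, Flow P α T u (HH P (fun y => psi α (τ y)) h0 u) := by
  obtain ⟨a, B, ha, hB, hap⟩ := apriori hP hPπ hα I
  obtain ⟨τ, τs, τid, τb, τo⟩ := cutoff ha hB
  obtain ⟨c, hC⟩ := coef_cut hα ha hB τs τb τo
  obtain ⟨u, hu, su, u0, ut⟩ := sol_exists hP hC I.sw
  have hcont : Continuous fun p : ℝ × ℝ => u p.1 p.2 := by simpa using hu.cont0 0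
  have fl : ∀ T, (∀ t ∈ Set.Icc 0 T, ∀ x, u t x ∈ Set.Icc a B) → Flow P α T u (HH P (fun y => psi α (τ y)) h0 u) :=
    fun T => flow_of_bounds hP hα I ha τid hC hu su u0 ut
  have H0 : HH P (fun y => psi α (τ y)) h0 u 0 = h0 := by funext x; simp [HH]
  have hbound : ∀ t, 0 ≤ t → ∀ x, u t x ∈ Set.Icc a B := by
    intro T hT
    set s : Set ℝ := {t | ∀ θ ∈ Set.Icc (0:ℝ) 1, ∀ x, u (θ * t) x ∈ Set.Icc a B} with hs
    have hsub : Set.Icc 0 T ⊆ s := by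
      refine IsClosed.Icc_subset_of_forall_exists_gt ?_ ?_ ?_
      · refine IsClosed.inter ?_ isClosed_Icc
        simp only [hs, Set.ofPred_forall]
        refine isClosed_iInter fun θ => isClosed_iInter fun _ => isClosed_iInter fun x => ?_
        refine isClosed_Icc.preimage (f := fun t => u (θ * t) x) ?_
        exact hcont.comp ((continuous_const.mul continuous_id).prodMk continuous_const)
      · intro θ _ x
        rw [mul_zero, u0]
        have := hap 0 _ _ (init_flow I) rfl rfl 0 ⟨le_rfl, le_rfl⟩ x
        exact ⟨this.1.le, this.2.le⟩
      · rintro t ⟨hts, ht0, htT⟩ y hy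
        have hbd : ∀ t' ∈ Set.Icc 0 t, ∀ x, u t' x ∈ Set.Icc a B := by
          intro t' ht' x
          rcases ht0.eq_or_lt with h | h
          · have h0 := hts 0 ⟨le_rfl, zero_le_one⟩ x
            have : t' = 0 := le_antisymm (by rw [h]; exact ht'.2) ht'.1
            rw [zero_mul] at h0
            rwa [this]
          · have h0 := hts (t' / t) ⟨div_nonneg ht'.1 ht0, (div_le_one h).2 ht'.2⟩ x
            rwa [div_mul_cancel₀ _ h.ne'] at h0
        have hstrict := hap t u _ (fl t hbd) u0 H0 t ⟨ht0, le_rfl⟩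
        have hev : ∀ᶠ t' in 𝓝 t, ∀ x ∈ Set.Icc (0:ℝ) (0+P), u t' x ∈ Set.Ioo a B := by
          refine isCompact_Icc.eventually_forall_of_forall_eventually fun x _ => ?_
          exact hcont.continuousAt.eventually (Ioo_mem_nhds (hstrict x).1 (hstrict x).2)
        obtain ⟨ε, hε, hball⟩ := Metric.eventually_nhds_iff.1 hev
        set t2 := min y (t + ε / 2) with ht2
        have htt2 : t < t2 := lt_min hy (by linarith)
        refine ⟨t2, ?_, htt2, min_le_left _ _⟩
        intro θ hθ x
        by_cases hle : θ * t2 ≤ t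
        · exact hbd _ ⟨mul_nonneg hθ.1 (ht0.trans htt2.le), hle⟩ x
        · push Not at hle
          have h2 : θ * t2 ≤ t2 := mul_le_of_le_one_left (ht0.trans htt2.le) hθ.2
          have h3 : t2 ≤ t + ε / 2 := min_le_right _ _
          obtain ⟨z, hz, hzf⟩ := exists_rep hP 0 x
          rw [← hzf _ (su _).2]
          have := hball (y := θ * t2) (by rw [Real.dist_eq, abs_of_pos (by linarith)]; linarith) z ⟨hz.1, hz.2.le⟩
          exact ⟨this.1.le, this.2.le⟩
    intro x
    have := hsub ⟨hT, le_rfl⟩ 1 ⟨zero_le_one, le_rfl⟩ x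
    rwa [one_mul] at this
  exact ⟨a, B, c, τ, u, ha, hB, τs, τid, τb, τo, hC, hu, su, u0, ut, hbound,
    fun T => fl T fun t ht => hbound t ht.1⟩

end APF

namespace APF

variable {P α : ℝ}

theorem prim {f : ℝ → ℝ} (hf : Continuous f) (t : ℝ) :
    HasDerivAt (fun t => ∫ s in (0:ℝ)..t, f s) (f t) t := (hf.integral_hasStrictDerivAt 0 t).hasDerivAt

theorem conv0 {f f' : ℝ → ℝ} {D K : ℝ} (hf : Continuous f) (h0 : ∀ t, 0 ≤ f t)
    (hd : ∀ t, 0 ≤ t → HasDerivWithinAt f (f' t) (Set.Ici 0) t) (hD : 0 < D) (hb : ∀ t, 0 ≤ t → f' t ≤ D)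
    (hK : ∀ T, 0 ≤ T → ∫ s in (0:ℝ)..T, f s ≤ K) : Tendsto f atTop (𝓝 0) := by
  set G : ℝ → ℝ := fun t => ∫ s in (0:ℝ)..t, f s with hG
  have hmono : Monotone G := by
    refine monotone_of_deriv_nonneg (fun t => (prim hf t).differentiableAt) fun t => ?_
    rw [(prim hf t).deriv]; exact h0 t
  have hbdd : BddAbove (Set.range G) := by
    refine ⟨K, ?_⟩
    rintro _ ⟨t, rfl⟩
    exact (hmono (le_max_left t 0)).trans (hK _ (le_max_right _ _))
  have hlim := tendsto_atTop_ciSup hmono hbdd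
  set ℓ := ⨆ i, G i
  rw [Metric.tendsto_atTop]
  intro ε hε
  set η := ε / (2 * D) with hη
  have hηp : 0 < η := by positivity
  have h2 : Tendsto (fun t => G t - G (t - η)) atTop (𝓝 0) := by
    have := hlim.sub (hlim.comp (tendsto_atTop_add_const_right atTop (-η) tendsto_id))
    simpa [sub_eq_add_neg] using this
  obtain ⟨N, hN⟩ := Metric.tendsto_atTop.1 h2 (η * ε / 2) (by positivity)
  refine ⟨max N η, fun t ht => ?_⟩
  have hNt := hN t ((le_max_left _ _).trans ht)
  have hηt : η ≤ t := (le_max_right _ _).trans ht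
  rw [Real.dist_eq, sub_zero] at hNt ⊢
  rw [abs_of_nonneg (h0 t)]
  have h3 := (le_abs_self _).trans_lt hNt
  have hfs : ∀ s ∈ Set.Icc (t - η) t, f t - D * η ≤ f s := by
    intro s hs
    have := anti_of_deriv (T := t) (f := fun t => f t - D * t) (f' := fun t => f' t - D) (fun r hr => ?_)
      (fun r hr => by linarith [hb r hr.1]) (s := s) (t := t) (by linarith [hs.1]) hs.2 le_rfl
    · nlinarith [hs.1]
    · refine ((hd r hr.1).mono fun z hz => hz.1).sub ?_
      simpa using ((hasDerivAt_id r).const_mul D).hasDerivWithinAt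
  have h4 : η * (f t - D * η) ≤ G t - G (t - η) := by
    have e : G t - G (t - η) = ∫ s in (t-η)..t, f s :=
      intervalIntegral.integral_interval_sub_left (hf.intervalIntegrable _ _) (hf.intervalIntegrable _ _)
    have : ∫ _ in (t-η)..t, (f t - D * η) ≤ ∫ s in (t-η)..t, f s :=
      intervalIntegral.integral_mono_on (by linarith) (continuous_const.intervalIntegrable _ _)
        (hf.intervalIntegrable _ _) hfs
    rw [intervalIntegral.integral_const, smul_eq_mul, sub_sub_cancel] at this
    rw [e]; exact this
  have h5 : η * (f t - D * η) < η * (ε / 2) := by linarith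
  have h6 := lt_of_mul_lt_mul_left h5 hηp.le
  have h7 : D * η = ε / 2 := by rw [hη]; field_simp
  linarith

/-- the bootstrap for the sequence of energies -/
theorem bootstrap {x x' : ℕ → ℝ → ℝ} {c K1 : ℝ} (hc : 0 < c) (hx : ∀ k, Continuous (x k))
    (h0 : ∀ k t, 0 ≤ x k t)
    (hd : ∀ k t, 0 ≤ t → HasDerivWithinAt (x k) (x' k t) (Set.Ici 0) t)
    (base : ∀ T, 0 ≤ T → ∫ s in (0:ℝ)..T, x 1 s ≤ K1)
    (step : ∀ q M, (∀ i, 1 ≤ i → i ≤ q → ∀ t, 0 ≤ t → x i t ≤ M) → ∃ C, 0 ≤ C ∧ ∀ t, 0 ≤ t →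
      x' (q+1) t ≤ -c * x (q+2) t + C * ∑ i ∈ Finset.Icc 1 (q+1), x i t) :
    ∀ k, 1 ≤ k → Tendsto (x k) atTop (𝓝 0) := by
  have main : ∀ q, (∃ M, ∀ i, 1 ≤ i → i ≤ q → ∀ t, 0 ≤ t → x i t ≤ M) ∧
      (∃ K, ∀ i, 1 ≤ i → i ≤ q + 1 → ∀ T, 0 ≤ T → ∫ s in (0:ℝ)..T, x i s ≤ K) := by
    intro q
    induction q with
    | zero =>
      refine ⟨⟨0, fun i h1 h2 => by omega⟩, K1, fun i h1 h2 => ?_⟩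
      obtain rfl : i = 1 := by omega
      exact base
    | succ q ih =>
      obtain ⟨⟨M, hM⟩, K, hK⟩ := ih
      obtain ⟨C, hC, hstep⟩ := step q M hM
      set S : ℝ → ℝ := fun t => ∑ i ∈ Finset.Icc 1 (q+1), x i t with hS
      have hSc : Continuous S := continuous_finsetSum _ fun i _ => hx i
      have hSK : ∀ T, 0 ≤ T → ∫ s in (0:ℝ)..T, S s ≤ (q+1) * K := by
        intro T hT
        simp only [hS]
        rw [intervalIntegral.integral_finsetSum]
        swap
        · exact fun i _ => (hx i).intervalIntegrable _ _
        refine (Finset.sum_le_card_nsmul _ _ K fun i hi => ?_).trans ?_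
        · rw [Finset.mem_Icc] at hi
          exact hK i hi.1 hi.2 T hT
        · simp
      have hintg : ∀ T, 0 ≤ T → x (q+1) T + c * ∫ s in (0:ℝ)..T, x (q+2) s ≤ x (q+1) 0 + C * ((q+1) * K) := by
        intro T hT
        have := anti_of_deriv (T := T) (s := 0) (t := T)
          (f := fun t => x (q+1) t + c * (∫ s in (0:ℝ)..t, x (q+2) s) - C * ∫ s in (0:ℝ)..t, S s)
          (f' := fun t => x' (q+1) t + c * x (q+2) t - C * S t) (fun t ht => ?_) (fun t ht => ?_) le_rfl hT le_rfl
        · simp only [intervalIntegral.integral_same, mul_zero, add_zero, sub_zero] at this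
          linarith [mul_le_mul_of_nonneg_left (hSK T hT) hC]
        · exact (((hd (q+1) t ht.1).mono fun z hz => hz.1).add
            ((prim (hx (q+2)) t).const_mul c).hasDerivWithinAt).sub
            ((prim hSc t).const_mul C).hasDerivWithinAt
        · linarith [hstep t ht.1]
      have hIpos : ∀ k T, 0 ≤ T → 0 ≤ ∫ s in (0:ℝ)..T, x k s := fun k T hT =>
        intervalIntegral.integral_nonneg hT fun s _ => h0 k s
      set A := x (q+1) 0 + C * ((q+1) * K)
      refine ⟨⟨max M A, fun i h1 h2 t ht => ?_⟩, max K (A / c), fun i h1 h2 T hT => ?_⟩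
      · rcases Nat.lt_or_ge q i with h | h
        · obtain rfl : i = q + 1 := by omega
          refine le_trans ?_ (le_max_right _ _)
          linarith [hintg t ht, mul_nonneg hc.le (hIpos (q+2) t ht)]
        · exact (hM i h1 h t ht).trans (le_max_left _ _)
      · rcases Nat.lt_or_ge (q+1) i with h | h
        · obtain rfl : i = q + 2 := by omega
          refine le_trans ?_ (le_max_right _ _)
          rw [le_div_iff₀ hc]
          linarith [hintg T hT, h0 (q+1) T]
        · exact (hK i h1 h T hT).trans (le_max_left _ _)
  intro k hk
  obtain ⟨q, rfl⟩ : ∃ q, k = q + 1 := ⟨k - 1, by omega⟩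
  obtain ⟨⟨M, hM⟩, K, hK⟩ := main (q+1)
  obtain ⟨C, hC, hstep⟩ := step q M fun i h1 h2 => hM i h1 (by omega)
  refine conv0 (D := C * ((q+1) * M) + 1) (hx _) (h0 _) (hd _) ?_ (fun t ht => ?_) (hK (q+1) (by omega) (by omega))
  · have : 0 ≤ M := (h0 (q+1) 0).trans (hM (q+1) (by omega) le_rfl 0 le_rfl)
    positivity
  · have h1 : ∑ i ∈ Finset.Icc 1 (q+1), x i t ≤ (q+1) * M := by
      refine (Finset.sum_le_card_nsmul _ _ M fun i hi => ?_).trans ?_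
      · rw [Finset.mem_Icc] at hi
        exact hM i hi.1 hi.2 t ht
      · simp
    linarith [hstep t ht, mul_le_mul_of_nonneg_left h1 hC, mul_nonneg hc.le (h0 (q+2) t)]

end APF

namespace APF

variable {P α : ℝ}

theorem Icc_to_Ici {f : ℝ → ℝ} {d t : ℝ} (ht : 0 ≤ t)
    (h : HasDerivWithinAt f d (Set.Icc 0 (t+1)) t) : HasDerivWithinAt f d (Set.Ici 0) t := by
  refine h.mono_of_mem_nhdsWithin ?_
  rw [← Set.Ici_inter_Iic]
  exact inter_mem self_mem_nhdsWithin (mem_nhdsWithin_of_mem_nhds (Iic_mem_nhds (by linarith)))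

theorem X_deriv (hP : 0 < P) {b ψ : ℝ → ℝ} {c : ℝ} (hC : Coef b ψ c) {u : ℝ → ℝ → ℝ} (hu : QQ 0 Set.univ u)
    (su : ∀ t, SP P (u t))
    (ut : ∀ k x t, 0 ≤ t → HasDerivWithinAt (fun t => iteratedDeriv k (u t) x)
        (iteratedDeriv k (FF P b ψ (u t)) x) (Set.Ici 0) t) (k : ℕ) {t : ℝ} (ht : 0 ≤ t) :
    HasDerivWithinAt (fun t => X P k (u t))
      (∫ x in (0:ℝ)..P, 2 * (iteratedDeriv k (u t) x * iteratedDeriv k (FF P b ψ (u t)) x)) (Set.Ici 0) t := by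
  refine Icc_to_Ici ht ?_
  have c1 := hu.cont0 k
  have c2 := (QQ.FF0 hu hP hC).cont0 k
  refine par_deriv (g := fun t x => (iteratedDeriv k (u t) x)^2)
    (gt := fun t x => 2 * (iteratedDeriv k (u t) x * iteratedDeriv k (FF P b ψ (u t)) x))
    (c1.pow 2).continuousOn ((c1.mul c2).const_mul 2).continuousOn (fun s hs x => ?_) P
    ⟨ht, by linarith⟩
  have := ((ut k x s hs.1).mono (show Set.Icc 0 (t+1) ⊆ Set.Ici 0 from fun z hz => hz.1)).fun_pow 2
  refine this.congr_deriv ?_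
  simp; ring

theorem X_cont {u : ℝ → ℝ → ℝ} (hu : QQ 0 Set.univ u) (k : ℕ) : Continuous fun t => X P k (u t) := by
  have c1 : Continuous (fun p : ℝ × ℝ => (iteratedDeriv k (u p.1) p.2)^2) := (hu.cont0 k).pow 2
  exact intervalIntegral.continuous_parametric_intervalIntegral_of_continuous'
    (f := fun t x => (iteratedDeriv k (u t) x)^2) c1 0 P

theorem X_tendsto (hP : 0 < P) (hPπ : P < π) (hα : 0 < α) {B c : ℝ} (hB : 0 < B) {b ψ : ℝ → ℝ}
    (hC : Coef b ψ c) {u h : ℝ → ℝ → ℝ} (hu : QQ 0 Set.univ u) (su : ∀ t, SP P (u t))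
    (ut : ∀ k x t, 0 ≤ t → HasDerivWithinAt (fun t => iteratedDeriv k (u t) x)
        (iteratedDeriv k (FF P b ψ (u t)) x) (Set.Ici 0) t)
    (hub : ∀ t, 0 ≤ t → ∀ x, u t x ≤ B) (hfl : ∀ T, Flow P α T u h) (k : ℕ) (hk : 1 ≤ k) :
    Tendsto (fun t => X P k (u t)) atTop (𝓝 0) := by
  obtain ⟨ν, hν, hwirt⟩ := wirt hP hPπ
  set L0 := ∫ x in (0:ℝ)..P, psi α (u 0 x) with hL0
  refine bootstrap (x := fun k t => X P k (u t)) (K1 := (B + B / α) * L0 / ν) hC.hc (fun k => X_cont hu k)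
    (fun k t => X_nonneg hP k _) (fun k t ht => X_deriv hP hC hu su ut k ht) ?_ ?_ k hk
  · intro T hT
    have F := hfl T
    have h0m : (0:ℝ) ∈ Set.Icc 0 T := ⟨le_rfl, hT⟩
    have hTm : T ∈ Set.Icc 0 T := ⟨hT, le_rfl⟩
    have := anti_of_deriv (T := T) (s := 0) (t := T)
      (f := fun t => EE P α B u t + ν * ∫ s in (0:ℝ)..t, X P 1 (u s))
      (f' := fun t => EE' P α B u t + ν * X P 1 (u t)) (fun t ht => ?_) (fun t ht => ?_) le_rfl hT le_rfl
    · simp only [intervalIntegral.integral_same, mul_zero, add_zero] at this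
      have h1 := F.EE_le hP hα hB h0m (hub 0 le_rfl)
      have h2 := F.EE_ge hP hα hB hTm (hub T hT)
      have h3 : (B/α) * (∫ x in (0:ℝ)..P, psi α (u T x)) ≤ (B/α) * L0 :=
        mul_le_mul_of_nonneg_left (F.L_anti hP hα le_rfl hT le_rfl) (by positivity)
      rw [le_div_iff₀ hν]
      linarith
    · exact (F.EE_deriv hP hα hB ht).add ((prim (X_cont hu 1) t).const_mul ν).hasDerivWithinAt
    · linarith [F.EE'_le hP hα hwirt ht (hub t ht.1)]
  · intro q M hM
    obtain ⟨C, hC0, hkey⟩ := key_ineq (M := max M 0) hP (le_max_right _ _) hC q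
    refine ⟨C, hC0, fun t ht => ?_⟩
    have h1 := hkey (u t) (su t) fun i h1 h2 => (hM i h1 h2 t ht).trans (le_max_left _ _)
    refine le_trans (le_of_eq ?_) h1
    have e := ((FF_SP (ψ := ψ) hC.b_smooth (su t)).iter q).ibp ((su t).iter (q+1))
    rw [← iteratedDeriv_succ, ← iteratedDeriv_succ] at e
    rw [e, intervalIntegral.integral_const_mul]
    simp only [mul_comm (iteratedDeriv (q+1) (u t) _)]
    ring

theorem curv_tendsto (hP : 0 < P) (hα : 0 < α) {a B : ℝ} (ha : 0 < a) (hB : a < B) {τ : ℝ → ℝ}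
    (τs : ContDiff ℝ ∞ τ) (τid : ∀ y ∈ Set.Icc a B, τ y = y) (τb : ∀ y, a / 2 ≤ τ y ∧ τ y ≤ 2 * B)
    (τo : ∀ y, y ∉ Set.Icc (a/2) (2*B) → τ y = a / 2)
    {u h : ℝ → ℝ → ℝ} (su : ∀ t, SP P (u t))
    (hub : ∀ t, 0 ≤ t → ∀ x, u t x ∈ Set.Icc a B) (hfl : ∀ T, Flow P α T u h)
    (hX : ∀ k, 1 ≤ k → Tendsto (fun t => X P k (u t)) atTop (𝓝 0)) :
    ∃ c : ℝ, 0 < c ∧ ∀ k : ℕ, TendstoUniformly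
      (fun t x => iteratedDeriv k (fun x => (psi α (u t x))⁻¹) x) (fun _ => if k = 0 then c else 0) atTop := by
  have hBp : 0 < B := ha.trans hB
  obtain ⟨κs, κb⟩ := cut_comp ha τs τb τo (g := fun y => (psi α y)⁻¹)
    (ContDiffOn.inv (rpow_smooth _) fun y hy => (psi_pos hy).ne')
  set κ : ℝ → ℝ := fun y => (psi α (τ y))⁻¹ with hκ
  have hκu : ∀ t, 0 ≤ t → (fun x => (psi α (u t x))⁻¹) = fun x => κ (u t x) := fun t ht => by
    funext x; rw [hκ]; simp only [τid _ (hub t ht x)]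
  set L : ℝ → ℝ := fun t => ∫ x in (0:ℝ)..P, psi α (u (max t 0) x) with hL
  have hLanti : Antitone L := fun s t hst => by
    have h1 : max s 0 ≤ max t 0 := max_le_max_right 0 hst
    exact (hfl (max t 0)).L_anti hP hα (le_max_right _ _) h1 le_rfl
  have hLlow : ∀ t, P * psi α B ≤ L t := fun t => by
    have hm : max t 0 ∈ Set.Icc 0 (max t 0) := ⟨le_max_right _ _, le_rfl⟩
    have : ∫ _ in (0:ℝ)..P, psi α B ≤ L t :=
      intervalIntegral.integral_mono_on hP.le (continuous_const.intervalIntegrable _ _)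
        (((hfl (max t 0)).rho_SP hm).cont.intervalIntegrable _ _)
        fun x _ => psi_anti hα ((hfl (max t 0)).pos _ hm x) (hub _ hm.1 x).2
    simpa using this
  have hlowp : 0 < P * psi α B := mul_pos hP (psi_pos hBp)
  have hlim := tendsto_atTop_ciInf hLanti ⟨P * psi α B, by rintro _ ⟨t, rfl⟩; exact hLlow t⟩
  set ℓ := ⨅ i, L i
  have hℓ : 0 < ℓ := hlowp.trans_le (ge_of_tendsto' hlim hLlow)
  have hcl : Tendsto (fun t => P / L t) atTop (𝓝 (P / ℓ)) := tendsto_const_nhds.div hlim hℓ.ne'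
  refine ⟨P / ℓ, by positivity, fun k => ?_⟩
  rw [Metric.tendstoUniformly_iff]
  intro ε hε
  rcases Nat.eq_zero_or_pos k with rfl | hk
  · obtain ⟨C, hC⟩ := κb 1
    have hC0 : 0 ≤ C := (abs_nonneg _).trans (hC 0)
    have hlip : ∀ x y, |κ x - κ y| ≤ C * |x - y| := fun x y => by
      have := Convex.norm_image_sub_le_of_norm_deriv_le (f := κ) (s := Set.univ) (C := C) (x := y) (y := x)
        (fun z _ => (κs.differentiable (by simp)).differentiableAt)
        (fun z _ => by rw [← iteratedDeriv_one]; exact hC z) convex_univ trivial trivial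
      simpa using this
    have h1 : Tendsto (fun t => C * √(P * X P 1 (u t))) atTop (𝓝 0) := by
      have := ((hX 1 le_rfl).const_mul P).sqrt.const_mul C
      simpa using this
    have e1 : ∀ᶠ t in atTop, C * √(P * X P 1 (u t)) < ε / 2 := h1.eventually_lt_const (by positivity)
    have e2 := (Metric.tendsto_nhds.1 hcl) (ε/2) (by positivity)
    filter_upwards [e1, e2, eventually_ge_atTop 0] with t h1 h2 ht x
    simp only [iteratedDeriv_zero, if_true]
    have hm : t ∈ Set.Icc 0 t := ⟨ht, le_rfl⟩
    obtain ⟨z, hz⟩ := exists_mean hP ((hfl t).rho_SP hm).cont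
    have hz' : κ (u t z) = P / L t := by
      rw [← congrFun (hκu t ht) z]
      simp only [hz, hL, max_eq_left ht, inv_div]
    have h3 : |κ (u t x) - κ (u t z)| < ε / 2 := by
      refine lt_of_le_of_lt ((hlip _ _).trans (mul_le_mul_of_nonneg_left ?_ hC0)) h1
      exact Real.abs_le_sqrt (sq_sub_le hP (su t) x z)
    rw [congrFun (hκu t ht) x, dist_comm, Real.dist_eq]
    rw [Real.dist_eq, ← hz'] at h2
    have := abs_sub_le (κ (u t x)) (κ (u t z)) (P / ℓ)
    linarith
  · obtain ⟨C, hC0, hC⟩ := bd_upto κb k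
    set A : ℝ := k.factorial * C + 1 with hA
    have hAp : 0 < A := by positivity
    set η : ℝ := min 1 (ε / (2 * A)) with hη
    have hηp : 0 < η := lt_min one_pos (by positivity)
    have hη1 : η ≤ 1 := min_le_left _ _
    have hder : ∀ i ∈ Finset.Icc 1 k, ∀ᶠ t in atTop, P * X P (i+1) (u t) ≤ (η ^ k) ^ 2 := by
      intro i hi
      have := (hX (i+1) (by omega)).const_mul P
      rw [mul_zero] at this
      filter_upwards [this.eventually_lt_const (show 0 < (η ^ k) ^ 2 by positivity)] with t h using h.le
    filter_upwards [(Finset.eventually_all _).2 hder, eventually_ge_atTop 0] with t h1 ht x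
    rw [if_neg (by omega), dist_comm, Real.dist_eq, sub_zero, hκu t ht]
    have := comp_bound κs (su t).1 (k := k) (C := C) (D := η) (x := x) hC (fun i hi1 hi2 => by
      have h2 := h1 i (Finset.mem_Icc.2 ⟨hi1, hi2⟩)
      obtain ⟨j, rfl⟩ : ∃ j, i = j + 1 := ⟨i - 1, by omega⟩
      have h3 := ((su t).sup_iter hP j x).trans h2
      exact (abs_le_of_sq_le_sq h3 (by positivity)).trans (pow_le_pow_of_le_one hηp.le hη1 hi2))
    refine lt_of_le_of_lt this ?_
    have h4 : η ^ k ≤ η := by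
      have := pow_le_pow_of_le_one hηp.le hη1 hk
      simpa using this
    have h5 : (k.factorial * C : ℝ) * η ^ k ≤ A * η := mul_le_mul (by linarith) h4 (by positivity) hAp.le
    have h6 : A * η ≤ A * (ε / (2 * A)) := mul_le_mul_of_nonneg_left (min_le_right _ _) hAp.le
    have h7 : A * (ε / (2 * A)) = ε / 2 := by field_simp
    linarith

end APF

namespace APF

theorem HH_reg {P : ℝ} (hP : 0 < P) {b ψ : ℝ → ℝ} {c : ℝ} (hC : Coef b ψ c) {h0 : ℝ → ℝ} (s0 : SP P h0)
    {u : ℝ → ℝ → ℝ} (hu : QQ 0 Set.univ u) (su : ∀ t, SP P (u t))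
    (ut : ∀ k x t, 0 ≤ t → HasDerivWithinAt (fun t => iteratedDeriv k (u t) x)
        (iteratedDeriv k (FF P b ψ (u t)) x) (Set.Ici 0) t) (r : ℕ) :
    ∀ k, ContDiffOn ℝ r (fun p : ℝ × ℝ => iteratedDeriv k (HH P ψ h0 u p.1) p.2) HP := by
  have hg := hsp_QQ hP hC hu
  induction r with
  | zero =>
    intro k
    have := (HH_cont s0 hg k).continuousOn (s := HP)
    simpa using this
  | succ r ih =>
    intro k
    have q := sol_smooth hP hC hu ut r
    have h1 : QQ r HP (fun t (_ : ℝ) => Lam P ψ (u t)) := QQ.const (fst_contDiffOn (Lam_contDiffOn q hP hC))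
    have h2 : QQ r HP (fun (_ _ : ℝ) => (-1:ℝ)) := QQ.const contDiffOn_const
    have h3 : QQ r HP (hsp P ψ u) := h1.add (h2.mul q)
    exact joint_succ (h3.reg k) (ih (k+1)) (fun t x _ => (HH_dt s0 hg t k x).hasDerivWithinAt)
      (fun t x _ => (HH_SP s0 hg su t).hasDerivAt_iter k x)

theorem HH_smooth {P : ℝ} (hP : 0 < P) {b ψ : ℝ → ℝ} {c : ℝ} (hC : Coef b ψ c) {h0 : ℝ → ℝ} (s0 : SP P h0)
    {u : ℝ → ℝ → ℝ} (hu : QQ 0 Set.univ u) (su : ∀ t, SP P (u t))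
    (ut : ∀ k x t, 0 ≤ t → HasDerivWithinAt (fun t => iteratedDeriv k (u t) x)
        (iteratedDeriv k (FF P b ψ (u t)) x) (Set.Ici 0) t) :
    ContDiffOn ℝ (⊤ : ℕ∞) (Function.uncurry fun x t => HH P ψ h0 u t x) (Set.univ ×ˢ Set.Ici (0:ℝ)) := by
  refine contDiffOn_infty.2 fun r => ?_
  have := HH_reg hP hC s0 hu su ut r 0
  simp only [iteratedDeriv_zero] at this
  have h2 := this.comp (s := Set.univ ×ˢ Set.Ici (0:ℝ)) (f := fun p : ℝ × ℝ => (p.2, p.1))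
    (contDiff_snd.prodMk contDiff_fst).contDiffOn (fun p hp => ⟨hp.2, trivial⟩)
  exact h2

theorem int_nat {P : ℝ} {f : ℝ → ℝ} (hf : Function.Periodic f P) (hc : Continuous f) (n : ℕ) :
    ∫ x in (0:ℝ)..(n * P), f x = n * ∫ x in (0:ℝ)..P, f x := by
  induction n with
  | zero => simp
  | succ n ih =>
    rw [← intervalIntegral.integral_add_adjacent_intervals (b := n * P) (hc.intervalIntegrable _ _)
      (hc.intervalIntegrable _ _), ih,
      show ((n+1 : ℕ) : ℝ) * P = n * P + P by push_cast; ring, per_integral_shift hf]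
    push_cast; ring

theorem init_mk {P α : ℝ} (hα : 0 < α) {h0 : ℝ → ℝ} (s0 : SP P h0)
    (hc : ∀ x, 0 < h0 x + iteratedDeriv 2 h0 x) :
    Init P α (fun x => (h0 x + iteratedDeriv 2 h0 x) ^ (-α)) h0 where
  sw := by
    have s1 := s0.add (s0.iter 2)
    refine ⟨?_, fun x => ?_⟩
    · exact s1.1.rpow_const_of_ne fun x => (hc x).ne'
    · have := s1.2 x
      simp only at this ⊢
      rw [this]
  sh := s0
  pos x := rpow_pos_of_pos (hc x) _
  rel x := (psi_rpow hα (hc x)).symm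

end APF

end APFProof

/-- For an initial curve in `H_{m,n}` (locally convex, total curvature `2mπ`, `n`-fold
rotational symmetry, `gcd(m,n) = 1`, `n > 2m`), the AP flow exists globally and the
curvature converges, with all its `θ`-derivatives, uniformly to a positive constant,
i.e. the flow converges in the `C^∞` metric to an `m`-fold circle. -/
theorem ap_flow_highly_symmetric_global_convergence
    (m n : ℕ) (hm : 1 ≤ m) (hn : 1 ≤ n) (hmn : Nat.Coprime m n) (hn2m : 2 * m < n)
    (α : ℝ) (hα : 0 < α) (h₀ : ℝ → ℝ)
    (h₀smooth : ContDiff ℝ (⊤ : ℕ∞) h₀)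
    (h₀per : ∀ θ, h₀ (θ + 2 * m * π / n) = h₀ θ)
    (h₀conv : ∀ θ, 0 < h₀ θ + iteratedDeriv 2 h₀ θ) :
    ∃ h : ℝ → ℝ → ℝ,
      ContDiffOn ℝ (⊤ : ℕ∞) (Function.uncurry h) (Set.univ ×ˢ Set.Ici (0:ℝ)) ∧
      (∀ θ, h θ 0 = h₀ θ) ∧
      (∀ θ t, 0 ≤ t → h (θ + 2 * m * π) t = h θ t) ∧
      (∀ θ t, 0 ≤ t → 0 < h θ t + hpp h θ t) ∧
      (∀ θ t, 0 ≤ t →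
        derivWithin (fun s => h θ s) (Set.Ici 0) t
          = -(h θ t + hpp h θ t) ^ (-α) + lamAP m α h t) ∧
      ∃ c : ℝ, 0 < c ∧ ∀ k : ℕ,
        TendstoUniformly
          (fun t θ => iteratedDeriv k (fun x => (h x t + hpp h x t)⁻¹) θ)
          (fun _ => if k = 0 then c else 0) atTop := by
  have hn0 : (0:ℝ) < n := by exact_mod_cast hn
  have hm0 : (0:ℝ) < m := by exact_mod_cast hm
  set P : ℝ := 2 * m * π / n with hPdef
  have hP : 0 < P := by positivity
  have hPπ : P < π := by
    rw [hPdef, div_lt_iff₀ hn0]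
    have : (2 * m : ℝ) < n := by exact_mod_cast hn2m
    nlinarith [Real.pi_pos]
  have hnP : (2 * m * π : ℝ) = n * P := by rw [hPdef]; field_simp
  have s0 : APF.SP P h₀ := ⟨h₀smooth, h₀per⟩
  have I := APF.init_mk hα s0 h₀conv
  obtain ⟨a, B, c, τ, u, ha, hB, τs, τid, τb, τo, hC, hu, su, u0, ut, hub, hfl⟩ := APF.global hP hPπ hα I
  set H := APF.HH P (fun y => APF.psi α (τ y)) h₀ u with hH
  have hg := APF.hsp_QQ hP hC hu
  have hpos : ∀ t, 0 ≤ t → ∀ x, 0 < u t x := fun t ht x => ha.trans_le (hub t ht x).1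
  have hper : ∀ t, Function.Periodic (H t) P := fun t => (APF.HH_SP s0 hg su t).2
  have hrel : ∀ t, 0 ≤ t → ∀ x, H t x + hpp (fun x t => H t x) x t = APF.psi α (u t x) :=
    fun t ht x => (hfl t).rel t ⟨ht, le_rfl⟩ x
  have hlam : ∀ t, 0 ≤ t → lamAP m α (fun x t => H t x) t = APF.Lam P (APF.psi α) (u t) := by
    intro t ht
    have F := hfl t
    have htm : t ∈ Set.Icc 0 t := ⟨ht, le_rfl⟩
    have e : ∀ x, (APF.psi α (u t x)) ^ (1 - α) = APF.psi α (u t x) * u t x := fun x => by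
      rw [sub_eq_add_neg, rpow_add (APF.psi_pos (hpos t ht x)), rpow_one, APF.psi_inv hα (hpos t ht x)]
    have sρ := F.rho_SP htm
    have sm := sρ.mul (su t)
    simp only [lamAP, hrel t ht, e]
    rw [hnP, APF.int_nat sm.2 sm.cont, APF.int_nat (hper t) (F.sh t htm).cont, F.int_h htm,
      mul_div_mul_left _ _ hn0.ne']
    rfl
  refine ⟨fun x t => H t x, APF.HH_smooth hP hC s0 hu su ut, ?_, ?_, ?_, ?_, ?_⟩
  · intro θ; simp [hH, APF.HH]
  · intro θ t _
    have := (hper t).nat_mul n θ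
    simp only
    rw [hnP, this]
  · intro θ t ht
    simp only
    rw [hrel t ht]
    exact APF.psi_pos (hpos t ht θ)
  · intro θ t ht
    simp only
    rw [hrel t ht, hlam t ht, APF.psi_inv hα (hpos t ht θ)]
    have h1 := APF.Icc_to_Ici ht (((hfl (t+1)).ht t ⟨ht, by linarith⟩ θ))
    rw [h1.derivWithin (uniqueDiffOn_Ici 0 t ht)]
    ring
  · obtain ⟨c', hc', hk⟩ := APF.curv_tendsto hP hα ha hB τs τid τb τo su hub hfl
      (APF.X_tendsto hP hPπ hα (ha.trans hB) hC hu su ut (fun t ht x => (hub t ht x).2) hfl)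
    refine ⟨c', hc', fun k V hV => ?_⟩
    filter_upwards [eventually_ge_atTop 0, hk k V hV] with t ht hV' θ
    simp only [hrel t ht]
    exact hV' θ
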